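/- Let d > 4. There exist β0 > 0 and C > 0 such that for all β ∈ (0, β0], all integers r ≥ 3, all real z ∈ (0, z_c), and all x ∈ 𝕋_r^d (identified with its representative in [−r/2, r/2)^d ∩ ℤ^d): Γ_z(x) ≤ G_z(x) + C χ(z)/V; (Γ_z ⋆ Γ_z)(x) ≤ B_z(x) + C χ(z)²/V; and (Γ_z ⋆ Γ_z ⋆ Γ_z)(x) ≤ T_z(x) + C χ(z)³/V. -/

import Mathlib

open scoped BigOperators

/-- A unit step in `ℤ^d`: a coordinate direction together with a sign. -/
def wsawStep (d : ℕ) (e : Fin d × Bool) : Fin d → ℤ :=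
  fun i => if i = e.1 then (if e.2 then 1 else -1) else 0

/-- The position after `k` steps of the walk on `ℤ^d` with step sequence `s`.
(An `n`-step nearest-neighbour walk on `ℤ^d` started at `0` is the same thing as a
sequence of `n` unit steps.) -/
def wsawPos {d n : ℕ} (s : Fin n → Fin d × Bool) (k : ℕ) : Fin d → ℤ :=
  ∑ j ∈ Finset.univ.filter (fun j : Fin n => (j : ℕ) < k), wsawStep d (s j)

/-- The weakly self-avoiding walk weight `∏_{0 ≤ s < t ≤ n} (1 + β U_{st}(ω))`
of the `ℤ^d` walk with step sequence `s`. -/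
noncomputable def wsawWeight {d : ℕ} (β : ℝ) (n : ℕ) (s : Fin n → Fin d × Bool) : ℝ :=
  ∏ p ∈ (Finset.range (n + 1) ×ˢ Finset.range (n + 1)).filter (fun p => p.1 < p.2),
    (1 + β * (if wsawPos s p.1 = wsawPos s p.2 then (-1 : ℝ) else 0))

/-- The two-point partition function `c_n(x)` on `ℤ^d`. -/
noncomputable def cZx (d : ℕ) (β : ℝ) (n : ℕ) (x : Fin d → ℤ) : ℝ :=
  ∑ s ∈ Finset.univ.filter (fun s : Fin n → Fin d × Bool => wsawPos s n = x),
    wsawWeight β n s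

/-- The partition function `c_n = Σ_x c_n(x)` on `ℤ^d`. -/
noncomputable def cZ (d : ℕ) (β : ℝ) (n : ℕ) : ℝ :=
  ∑ s : Fin n → Fin d × Bool, wsawWeight β n s

/-- The position after `k` steps of the torus walk with step sequence `s`:
the mod-`r` projection of the `ℤ^d` position (for `r ≥ 3`, `n`-step torus walks
started at `0` correspond bijectively to step sequences). -/
def wsawPosT {d : ℕ} (r : ℕ) {n : ℕ} (s : Fin n → Fin d × Bool) (k : ℕ) : Fin d → ZMod r :=
  fun i => ((wsawPos s k i : ℤ) : ZMod r)

/-- The weakly self-avoiding walk weight of the torus walk with step sequence `s`. -/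
noncomputable def wsawWeightT {d : ℕ} (r : ℕ) (β : ℝ) (n : ℕ) (s : Fin n → Fin d × Bool) : ℝ :=
  ∏ p ∈ (Finset.range (n + 1) ×ˢ Finset.range (n + 1)).filter (fun p => p.1 < p.2),
    (1 + β * (if wsawPosT r s p.1 = wsawPosT r s p.2 then (-1 : ℝ) else 0))

/-- The torus partition function `c_n^𝕋`. -/
noncomputable def cT (d r : ℕ) (β : ℝ) (n : ℕ) : ℝ :=
  ∑ s : Fin n → Fin d × Bool, wsawWeightT r β n s

/-- `μ` is the growth constant: `μ = lim_{n→∞} c_n^{1/n}`. -/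
def HasGrowthConst (d : ℕ) (β μ : ℝ) : Prop :=
  Filter.Tendsto (fun n : ℕ => (cZ d β n) ^ ((n : ℝ)⁻¹)) Filter.atTop (nhds μ)

/-- The susceptibility `χ(z)` on `ℤ^d`, for complex `z`. -/
noncomputable def chi (d : ℕ) (β : ℝ) (z : ℂ) : ℂ := ∑' n : ℕ, (cZ d β n : ℂ) * z ^ n

/-- The susceptibility `χ(z)` on `ℤ^d`, for real `z`. -/
noncomputable def chiR (d : ℕ) (β : ℝ) (z : ℝ) : ℝ := ∑' n : ℕ, cZ d β n * z ^ n

/-- The torus susceptibility `χ^𝕋(z)`, for complex `z`. -/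
noncomputable def chiT (d r : ℕ) (β : ℝ) (z : ℂ) : ℂ := ∑' n : ℕ, (cT d r β n : ℂ) * z ^ n

/-- The torus susceptibility `χ^𝕋(z)`, for real `z`. -/
noncomputable def chiTR (d r : ℕ) (β : ℝ) (z : ℝ) : ℝ := ∑' n : ℕ, cT d r β n * z ^ n

/-- The sup norm `‖x‖_∞` of `x ∈ ℤ^d`, as a real number. -/
noncomputable def nInf {d : ℕ} (x : Fin d → ℤ) : ℝ :=
  ((Finset.univ.sup fun i => (x i).natAbs : ℕ) : ℝ)

/-- `⟨x⟩ = max {1, ‖x‖_∞}`. -/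
noncomputable def vee {d : ℕ} (x : Fin d → ℤ) : ℝ := max 1 (nInf x)

/-- The two-point function `G_z(x) = Σ_n c_n(x) z^n` on `ℤ^d`. -/
noncomputable def Gpt (d : ℕ) (β z : ℝ) (x : Fin d → ℤ) : ℝ := ∑' n : ℕ, cZx d β n x * z ^ n

/-- The bubble diagram `B_z = G_z * G_z`. -/
noncomputable def Bpt (d : ℕ) (β z : ℝ) (x : Fin d → ℤ) : ℝ :=
  ∑' y : Fin d → ℤ, Gpt d β z (x - y) * Gpt d β z y

/-- The triangle diagram `T_z = G_z * G_z * G_z`. -/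
noncomputable def Tpt (d : ℕ) (β z : ℝ) (x : Fin d → ℤ) : ℝ :=
  ∑' y : Fin d → ℤ, Bpt d β z (x - y) * Gpt d β z y

/-- The representative in `[-r/2, r/2) ∩ ℤ` of `x ∈ ℤ/rℤ`. -/
def repC (r : ℕ) (x : ZMod r) : ℤ :=
  if 2 * (x.val : ℤ) < (r : ℤ) then (x.val : ℤ) else (x.val : ℤ) - (r : ℤ)

/-- The periodization `Γ_z(x) = Σ_{u ∈ ℤ^d} G_z(x + ru)` of the two-point function,
as a function on the torus (with `x` identified with its representative in
`[-r/2,r/2)^d ∩ ℤ^d`). -/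
noncomputable def Gam (d r : ℕ) (β z : ℝ) (x : Fin d → ZMod r) : ℝ :=
  ∑' u : Fin d → ℤ, Gpt d β z (fun i => repC r (x i) + (r : ℤ) * u i)

/-- The torus convolution `(f ⋆ g)(x) = Σ_{y ∈ 𝕋_r^d} f(x-y) g(y)`
(with subtraction modulo `r` in each component). -/
noncomputable def tconv (d r : ℕ) (f g : (Fin d → ZMod r) → ℝ) (x : Fin d → ZMod r) : ℝ :=
  ∑' y : Fin d → ZMod r, f (x - y) * g y

open scoped ENNReal NNReal

section Lace

variable {X S : Type} [AddCommGroup X] [DecidableEq X]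

/-- The obstacle created by a single visit to `v`. -/
noncomputable def siteObs (b : ℝ≥0∞) (v : X) : X → ℝ≥0∞ := fun w => if v = w then 1 - b else 1

/-- The product of the obstacle `a` over the positions after the start of a walk. -/
noncomputable def obsWt (st : S → X) (a : X → ℝ≥0∞) : X → List S → ℝ≥0∞
  | _, [] => 1
  | v, e :: l => a (v + st e) * obsWt st a (v + st e) l

/-- The endpoint of a walk. -/
def endPt (st : S → X) : X → List S → X
  | v, [] => v
  | v, e :: l => endPt st (v + st e) l

/-- The self-interaction weight of a walk. -/
noncomputable def selfWt (st : S → X) (b : ℝ≥0∞) : X → List S → ℝ≥0∞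
  | _, [] => 1
  | v, e :: l => obsWt st (siteObs b v) v (e :: l) * selfWt st b (v + st e) l

/-- The obstacle created by all the positions of a walk except its endpoint. -/
noncomputable def walkObs (st : S → X) (b : ℝ≥0∞) : X → List S → X → ℝ≥0∞
  | _, [] => fun _ => 1
  | v, e :: l => fun w => siteObs b v w * walkObs st b (v + st e) l w

variable (st : S → X) (b z : ℝ≥0∞)

omit [DecidableEq X] in
lemma endPt_append (v : X) (l₁ l₂ : List S) :
    endPt st v (l₁ ++ l₂) = endPt st (endPt st v l₁) l₂ := by
  induction l₁ generalizing v with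
  | nil => rfl
  | cons e l ih => simp [endPt, ih]

omit [DecidableEq X] in
lemma obsWt_append (a : X → ℝ≥0∞) (v : X) (l₁ l₂ : List S) :
    obsWt st a v (l₁ ++ l₂) = obsWt st a v l₁ * obsWt st a (endPt st v l₁) l₂ := by
  induction l₁ generalizing v with
  | nil => simp [obsWt, endPt]
  | cons e l ih => simp [obsWt, endPt, ih, mul_assoc]

omit [DecidableEq X] in
lemma obsWt_mul (a a' : X → ℝ≥0∞) (v : X) (l : List S) :
    obsWt st (fun w => a w * a' w) v l = obsWt st a v l * obsWt st a' v l := by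
  induction l generalizing v with
  | nil => simp [obsWt]
  | cons e l ih => simp only [obsWt, ih]; ring

omit [DecidableEq X] in
lemma obsWt_one (v : X) (l : List S) : obsWt st (fun _ => 1) v l = 1 := by
  induction l generalizing v with
  | nil => rfl
  | cons e l ih => simp [obsWt, ih]

omit [DecidableEq X] in
lemma obsWt_le_one {a : X → ℝ≥0∞} (ha : ∀ w, a w ≤ 1) (v : X) (l : List S) :
    obsWt st a v l ≤ 1 := by
  induction l generalizing v with
  | nil => exact le_rfl
  | cons e l ih => exact mul_le_one' (ha _) (ih _)

omit [AddCommGroup X] in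
lemma siteObs_le_one (v w : X) : siteObs b v w ≤ 1 := by
  unfold siteObs; split_ifs <;> simp

lemma walkObs_le_one (v : X) (l : List S) (w : X) : walkObs st b v l w ≤ 1 := by
  induction l generalizing v with
  | nil => exact le_rfl
  | cons e l ih => exact mul_le_one' (siteObs_le_one b v w) (ih _)

lemma selfWt_append (v : X) (l₁ l₂ : List S) :
    selfWt st b v (l₁ ++ l₂) = selfWt st b v l₁ * selfWt st b (endPt st v l₁) l₂ *
      obsWt st (walkObs st b v l₁) (endPt st v l₁) l₂ := by
  induction l₁ generalizing v with
  | nil => simp [selfWt, endPt, walkObs, obsWt_one]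
  | cons e l ih =>
    have h1 : obsWt st (walkObs st b v (e :: l)) (endPt st v (e :: l)) l₂ =
        obsWt st (siteObs b v) (endPt st v (e :: l)) l₂ *
          obsWt st (walkObs st b (v + st e) l) (endPt st v (e :: l)) l₂ :=
      obsWt_mul st _ _ _ _
    rw [h1, List.cons_append]
    simp only [selfWt, ih, ← List.cons_append, obsWt_append]
    simp only [endPt]
    ring

lemma selfWt_append_le (v : X) (l₁ l₂ : List S) :
    selfWt st b v (l₁ ++ l₂) ≤ selfWt st b v l₁ * selfWt st b (endPt st v l₁) l₂ := by
  rw [selfWt_append]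
  exact mul_le_of_le_one_right' (obsWt_le_one st (walkObs_le_one st b v l₁) _ _)

/-- Cutting a list at one of its entries. -/
def splitEquiv : (Σ l : List S, Fin l.length) ≃ List S × S × List S where
  toFun p := (p.1.take p.2, p.1[p.2], p.1.drop (p.2 + 1))
  invFun t := ⟨t.1 ++ t.2.1 :: t.2.2, ⟨t.1.length, by simp⟩⟩
  left_inv := by
    rintro ⟨l, i, hi⟩
    have h : l.take i ++ l[i] :: l.drop (i + 1) = l := by
      rw [List.getElem_cons_drop, List.take_append_drop]
    refine Sigma.ext h ?_
    refine (Fin.heq_ext_iff (congrArg List.length h)).2 ?_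
    simp; omega
  right_inv := by
    rintro ⟨l, e, l'⟩
    simp

lemma tsum_split (g : List S → S → List S → ℝ≥0∞) :
    ∑' l : List S, ∑ i : Fin l.length, g (l.take i) l[i] (l.drop (i + 1)) =
      ∑' p : List S × S, ∑' l₂, g p.1 p.2 l₂ := by
  calc _ = ∑' l : List S, ∑' i : Fin l.length, g (l.take i) l[i] (l.drop (i + 1)) := by
        simp only [tsum_fintype]
    _ = ∑' p : (Σ l : List S, Fin l.length),
          g (p.1.take p.2) p.1[p.2] (p.1.drop (p.2 + 1)) :=
        (ENNReal.tsum_sigma (fun (l : List S) (i : Fin l.length) =>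
          g (l.take i) l[i] (l.drop (i + 1)))).symm
    _ = ∑' t : List S × S × List S, g t.1 t.2.1 t.2.2 :=
        (splitEquiv (S := S)).tsum_eq (fun t => g t.1 t.2.1 t.2.2)
    _ = ∑' t : (List S × S) × List S, g t.1.1 t.1.2 t.2 :=
        (Equiv.prodAssoc (List S) S (List S)).tsum_eq (fun t => g t.1 t.2.1 t.2.2) |>.symm
    _ = _ := ENNReal.tsum_prod'

omit [DecidableEq X] in
lemma obsWt_add_sum {a : X → ℝ≥0∞} (ha : ∀ w, a w ≤ 1) (v : X) (l : List S) :
    obsWt st a v l + ∑ i : Fin l.length,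
      obsWt st a v (l.take i) * (1 - a (endPt st v (l.take i ++ [l[i]]))) = 1 := by
  induction l generalizing v with
  | nil => simp [obsWt]
  | cons e l ih =>
    have : ∑ i : Fin (e :: l).length,
        obsWt st a v ((e :: l).take i) * (1 - a (endPt st v ((e :: l).take i ++ [(e :: l)[i]])))
        = (1 - a (v + st e)) + a (v + st e) * ∑ i : Fin l.length,
      obsWt st a (v + st e) (l.take i) * (1 - a (endPt st (v + st e) (l.take i ++ [l[i]]))) := by
      rw [Finset.mul_sum]
      refine (Fin.sum_univ_succ (n := l.length) _).trans ?_
      simp [obsWt, endPt, mul_assoc]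
    rw [this]
    calc _ = a (v + st e) * (obsWt st a (v + st e) l + ∑ i : Fin l.length,
      obsWt st a (v + st e) (l.take i) * (1 - a (endPt st (v + st e) (l.take i ++ [l[i]]))))
        + (1 - a (v + st e)) := by rw [obsWt]; ring
      _ = 1 := by rw [ih, mul_one, add_tsub_cancel_of_le (ha _)]

lemma one_sub_walkObs_le (v : X) (l : List S) (w : X) :
    1 - walkObs st b v l w ≤
      ∑ i : Fin l.length, b * (if endPt st v (l.take i) = w then 1 else 0) := by
  induction l generalizing v with
  | nil => simp [walkObs]
  | cons e l ih =>
    have h0 : ∑ i : Fin (e :: l).length,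
        b * (if endPt st v ((e :: l).take i) = w then (1 : ℝ≥0∞) else 0) =
        b * (if v = w then 1 else 0) + ∑ i : Fin l.length,
          b * (if endPt st (v + st e) (l.take i) = w then (1 : ℝ≥0∞) else 0) := by
      refine (Fin.sum_univ_succ (n := l.length) _).trans ?_
      simp [endPt]
    rw [h0]
    refine le_trans ?_ (add_le_add_right (ih _) _)
    set y := walkObs st b (v + st e) l w
    have hy : y ≤ 1 := walkObs_le_one st b _ l w
    simp only [walkObs, siteObs]
    split_ifs with hvw
    · rw [tsub_le_iff_right]
      simp only [mul_one]
      calc (1 : ℝ≥0∞) = (1 - y) + y := (tsub_add_cancel_of_le hy).symm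
        _ ≤ (1 - y) + (b * y + (1 - b) * y) := by
          gcongr
          rw [← add_mul]
          exact le_mul_of_one_le_left' le_add_tsub
        _ ≤ (1 - y) + (b * 1 + (1 - b) * y) := by gcongr
        _ = b + (1 - y) + (1 - b) * y := by ring
    · simp [y]

/-- The two-point function in the presence of the obstacle `a`. -/
noncomputable def obsGreen (a : X → ℝ≥0∞) (v x : X) : ℝ≥0∞ :=
  ∑' l : List S, if endPt st v l = x then z ^ l.length * selfWt st b v l * obsWt st a v l else 0

/-- The two-point function, as a sum over lists of steps. -/
noncomputable def listGreen (v x : X) : ℝ≥0∞ :=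
  ∑' l : List S, if endPt st v l = x then z ^ l.length * selfWt st b v l else 0

/-- One step of the lace expansion. -/
noncomputable def laceOp (f : (X → ℝ≥0∞) → X → ℝ≥0∞) (a : X → ℝ≥0∞) (v : X) : ℝ≥0∞ :=
  ∑' p : List S × S, z ^ (p.1.length + 1) * selfWt st b v (p.1 ++ [p.2]) * obsWt st a v p.1 *
    (1 - a (endPt st v (p.1 ++ [p.2]))) *
      f (walkObs st b v (p.1 ++ [p.2])) (endPt st v (p.1 ++ [p.2]))

lemma listGreen_eq (a : X → ℝ≥0∞) (ha : ∀ w, a w ≤ 1) (v x : X) :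
    listGreen st b z v x = obsGreen st b z a v x +
      laceOp st b z (fun a' p => obsGreen st b z a' p x) a v := by
  set g : List S → S → List S → ℝ≥0∞ := fun l₁ e l₂ =>
    if endPt st v (l₁ ++ e :: l₂) = x then
      z ^ (l₁ ++ e :: l₂).length * selfWt st b v (l₁ ++ e :: l₂) *
        (obsWt st a v l₁ * (1 - a (endPt st v (l₁ ++ [e])))) else 0 with hg
  have h1 : laceOp st b z (fun a' p => obsGreen st b z a' p x) a v =
      ∑' p : List S × S, ∑' l₂ : List S, g p.1 p.2 l₂ := by
    unfold laceOp
    refine tsum_congr fun p => ?_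
    simp only [obsGreen, hg]
    rw [← ENNReal.tsum_mul_left]
    refine tsum_congr fun l₂ => ?_
    have hl : p.1 ++ p.2 :: l₂ = (p.1 ++ [p.2]) ++ l₂ := by simp
    have hlen : (p.1 ++ p.2 :: l₂).length = (p.1.length + 1) + l₂.length := by simp; omega
    simp only [hlen, pow_add _ _ l₂.length]
    rw [hl, endPt_append st v (p.1 ++ [p.2]) l₂, selfWt_append st b v (p.1 ++ [p.2]) l₂]
    split_ifs
    · ring
    · simp
  rw [h1, ← tsum_split g, listGreen, obsGreen, ← ENNReal.tsum_add]
  refine tsum_congr fun l => ?_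
  have hl : ∀ i : Fin l.length, l.take i ++ l[i] :: l.drop (i + 1) = l := fun i => by
    rw [Fin.getElem_fin, List.getElem_cons_drop, List.take_append_drop]
  simp only [hg, hl]
  split_ifs
  · rw [← Finset.mul_sum, ← mul_add, obsWt_add_sum st ha, mul_one]
  · simp

lemma laceOp_add (f g : (X → ℝ≥0∞) → X → ℝ≥0∞) (a : X → ℝ≥0∞) (v : X) :
    laceOp st b z (fun a v => f a v + g a v) a v = laceOp st b z f a v + laceOp st b z g a v := by
  simp only [laceOp, mul_add, ENNReal.tsum_add]

lemma laceOp_tsum {ι : Type} (f : ι → (X → ℝ≥0∞) → X → ℝ≥0∞) (c : ι → ℝ≥0∞)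
    (a : X → ℝ≥0∞) (v : X) :
    laceOp st b z (fun a v => ∑' i, f i a v * c i) a v = ∑' i, laceOp st b z (f i) a v * c i := by
  simp only [laceOp, ← ENNReal.tsum_mul_left, ← ENNReal.tsum_mul_right]
  rw [ENNReal.tsum_comm]
  simp only [mul_assoc]

/-- The function of obstacle and starting point obtained by iterating the lace expansion. -/
noncomputable def laceIter (f : (X → ℝ≥0∞) → X → ℝ≥0∞) : ℕ → (X → ℝ≥0∞) → X → ℝ≥0∞
  | 0 => f
  | k + 1 => laceOp st b z (laceIter f k)

lemma laceIter_green (x : X) (k : ℕ) (a : X → ℝ≥0∞) (ha : ∀ w, a w ≤ 1) (v : X) :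
    laceIter st b z (fun _ p => listGreen st b z p x) k a v =
      laceIter st b z (fun a' p => obsGreen st b z a' p x) k a v +
      laceIter st b z (fun a' p => obsGreen st b z a' p x) (k + 1) a v := by
  induction k generalizing a v with
  | zero => exact listGreen_eq st b z a ha v x
  | succ k ih =>
    change laceOp st b z _ a v = laceOp st b z _ a v + laceOp st b z _ a v
    rw [← laceOp_add]
    unfold laceOp
    refine tsum_congr fun p => ?_
    rw [ih _ (walkObs_le_one st b _ _)]

lemma laceIter_green_eq_tsum (x : X) (k : ℕ) (a : X → ℝ≥0∞) (v : X) :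
    laceIter st b z (fun _ p => listGreen st b z p x) k a v =
      ∑' q, laceIter st b z (fun _ p => if p = q then 1 else 0) k a v *
        listGreen st b z q x := by
  induction k generalizing a v with
  | zero => simp [laceIter]
  | succ k ih =>
    simp only [laceIter]
    rw [← laceOp_tsum]
    congr 1
    ext a v
    exact ih a v

omit [AddCommGroup X] [DecidableEq X] in
lemma tsum_nonempty_le (f : List S → ℝ≥0∞) :
    ∑' p : List S × S, f (p.1 ++ [p.2]) ≤ ∑' l, f l := by
  refine ENNReal.tsum_comp_le_tsum_of_injective (f := fun p : List S × S => p.1 ++ [p.2]) ?_ f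
  rintro ⟨l, e⟩ ⟨l', e'⟩ h
  simpa using h

lemma laceOp_le (f : (X → ℝ≥0∞) → X → ℝ≥0∞) (a : X → ℝ≥0∞) (ha : ∀ w, a w ≤ 1) (v : X) :
    laceOp st b z f a v ≤ ∑' p, (1 - a p) * ∑' l : List S,
      if endPt st v l = p then z ^ l.length * selfWt st b v l * f (walkObs st b v l) p else 0 := by
  simp only [← ENNReal.tsum_mul_left]
  rw [ENNReal.tsum_comm]
  simp only [mul_ite, mul_zero]
  have h0 : ∀ l : List S, (∑' p, if endPt st v l = p then
      (1 - a p) * (z ^ l.length * selfWt st b v l * f (walkObs st b v l) p) else 0) =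
      (1 - a (endPt st v l)) * (z ^ l.length * selfWt st b v l *
        f (walkObs st b v l) (endPt st v l)) := fun l => by
    rw [tsum_eq_single (endPt st v l) fun p hp => if_neg hp.symm, if_pos rfl]
  simp only [h0]
  refine le_trans ?_ (tsum_nonempty_le _)
  refine ENNReal.tsum_le_tsum fun p => ?_
  have h1 := obsWt_le_one st ha v p.1
  calc _ ≤ z ^ (p.1.length + 1) * selfWt st b v (p.1 ++ [p.2]) * 1 *
    (1 - a (endPt st v (p.1 ++ [p.2]))) *
      f (walkObs st b v (p.1 ++ [p.2])) (endPt st v (p.1 ++ [p.2])) := by gcongr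
    _ = _ := by simp; ring

lemma tsum_one_sub_walkObs_le (v p q : X) :
    ∑' l : List S, (if endPt st v l = p then
      z ^ l.length * selfWt st b v l * (1 - walkObs st b v l q) else 0) ≤
      b * (listGreen st b z v q * listGreen st b z q p) := by
  calc _ ≤ ∑' l : List S, ∑ i : Fin l.length, (fun l₁ e l₂ =>
        if endPt st v (l₁ ++ e :: l₂) = p then z ^ (l₁ ++ e :: l₂).length *
          selfWt st b v (l₁ ++ e :: l₂) * (b * (if endPt st v l₁ = q then 1 else 0)) else 0)
          (l.take i) l[i] (l.drop (i + 1)) := by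
        refine ENNReal.tsum_le_tsum fun l => ?_
        have hl : ∀ i : Fin l.length, l.take i ++ l[i] :: l.drop (i + 1) = l := fun i => by
          rw [Fin.getElem_fin, List.getElem_cons_drop, List.take_append_drop]
        simp only [hl]
        split_ifs
        · rw [← Finset.mul_sum]
          gcongr
          exact one_sub_walkObs_le st b v l q
        · simp
    _ = ∑' p' : List S × S, ∑' l₂ : List S,
        if endPt st v (p'.1 ++ p'.2 :: l₂) = p then z ^ (p'.1 ++ p'.2 :: l₂).length *
          selfWt st b v (p'.1 ++ p'.2 :: l₂) *
            (b * (if endPt st v p'.1 = q then 1 else 0)) else 0 := tsum_split (fun l₁ e l₂ =>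
        if endPt st v (l₁ ++ e :: l₂) = p then z ^ (l₁ ++ e :: l₂).length *
          selfWt st b v (l₁ ++ e :: l₂) * (b * (if endPt st v l₁ = q then 1 else 0)) else 0)
    _ ≤ ∑' p' : List S × S, ∑' l₂ : List S,
        b * ((if endPt st v p'.1 = q then z ^ p'.1.length * selfWt st b v p'.1 else 0) *
          (if endPt st q (p'.2 :: l₂) = p then
            z ^ (p'.2 :: l₂).length * selfWt st b q (p'.2 :: l₂) else 0)) := by
        refine ENNReal.tsum_le_tsum fun p' => ENNReal.tsum_le_tsum fun l₂ => ?_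
        rw [endPt_append]
        by_cases hq : endPt st v p'.1 = q
        · subst hq
          simp only [if_true]
          split_ifs
          · rw [List.length_append, pow_add]
            calc _ ≤ z ^ p'.1.length * z ^ (p'.2 :: l₂).length *
                  (selfWt st b v p'.1 * selfWt st b (endPt st v p'.1) (p'.2 :: l₂)) *
                    (b * 1) := by
                  gcongr
                  exact selfWt_append_le st b v _ _
              _ = _ := by ring
          · simp
        · simp [hq]
    _ = b * (listGreen st b z v q * ∑' t : S × List S,
          if endPt st q (t.1 :: t.2) = p then
            z ^ (t.1 :: t.2).length * selfWt st b q (t.1 :: t.2) else 0) := by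
        rw [ENNReal.tsum_prod']
        simp only [ENNReal.tsum_mul_left]
        rw [← ENNReal.tsum_mul_left, ENNReal.tsum_prod']
        simp only [ENNReal.tsum_mul_left, ENNReal.tsum_mul_right, listGreen]
    _ ≤ _ := by
        gcongr
        refine ENNReal.tsum_comp_le_tsum_of_injective (f := fun t : S × List S => t.1 :: t.2) ?_
          (fun l => if endPt st q l = p then z ^ l.length * selfWt st b q l else 0)
        rintro ⟨e, l⟩ ⟨e', l'⟩ h
        simpa using h

omit [AddCommGroup X] [DecidableEq X] in
lemma tsum_list (f : List S → ℝ≥0∞) : ∑' l, f l = f [] + ∑' e, ∑' l, f (e :: l) := by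
  let E : Unit ⊕ (S × List S) ≃ List S :=
    { toFun := Sum.elim (fun _ => []) fun p => p.1 :: p.2
      invFun := fun l => match l with
        | [] => Sum.inl ()
        | e :: l => Sum.inr (e, l)
      left_inv := by rintro (_ | ⟨e, l⟩) <;> rfl
      right_inv := by rintro (_ | ⟨e, l⟩) <;> rfl }
  rw [← E.tsum_eq, Summable.tsum_sum ENNReal.summable ENNReal.summable, ENNReal.tsum_prod',
    tsum_fintype]
  simp [E]

lemma listGreen_zero (hst : ∀ e, st e ≠ 0) (x : X) :
    listGreen st b z 0 x = (if (0 : X) = x then 1 else 0) +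
      z * ∑' e, obsGreen st b z (siteObs b 0) (st e) x := by
  rw [listGreen, tsum_list, ← ENNReal.tsum_mul_left]
  congr 1
  · simp [endPt, selfWt]
  · refine tsum_congr fun e => ?_
    rw [obsGreen, ← ENNReal.tsum_mul_left]
    refine tsum_congr fun l => ?_
    have h : siteObs b 0 (st e) = 1 := if_neg (hst e).symm
    simp only [endPt, zero_add, selfWt, obsWt, h, List.length_cons, pow_succ, mul_ite, mul_zero]
    congr 1
    ring

lemma listGreen_translate (v x y : X) :
    listGreen st b z (v + y) (x + y) = listGreen st b z v x := by
  have h1 : ∀ (l : List S) (v : X), endPt st (v + y) l = endPt st v l + y := fun l => by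
    induction l with
    | nil => exact fun v => rfl
    | cons e l ih => exact fun v => by simp only [endPt, ← ih, add_right_comm]
  have h2 : ∀ (l : List S) (w v : X),
      obsWt st (siteObs b (w + y)) (v + y) l = obsWt st (siteObs b w) v l := fun l => by
    induction l with
    | nil => exact fun w v => rfl
    | cons e l ih =>
      intro w v
      simp only [obsWt, add_right_comm v y, ih, siteObs, add_left_inj]
  have h3 : ∀ (l : List S) (v : X), selfWt st b (v + y) l = selfWt st b v l := fun l => by
    induction l with
    | nil => exact fun v => rfl
    | cons e l ih => exact fun v => by simp only [selfWt, h2, add_right_comm v y, ih]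
  simp only [listGreen, h1, h3, add_left_inj]

lemma listGreen_map (τ : X ≃+ X) (σ : S ≃ S) (h : ∀ e, st (σ e) = τ (st e)) (v x : X) :
    listGreen st b z (τ v) (τ x) = listGreen st b z v x := by
  have h1 : ∀ (l : List S) (v : X), endPt st (τ v) (l.map σ) = τ (endPt st v l) := fun l => by
    induction l with
    | nil => exact fun v => rfl
    | cons e l ih => exact fun v => by simp only [endPt, List.map_cons, h, ← map_add, ih]
  have h2 : ∀ (l : List S) (w v : X),
      obsWt st (siteObs b (τ w)) (τ v) (l.map σ) = obsWt st (siteObs b w) v l := fun l => by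
    induction l with
    | nil => exact fun w v => rfl
    | cons e l ih =>
      intro w v
      simp only [obsWt, List.map_cons, h, ← map_add, ih, siteObs, EmbeddingLike.apply_eq_iff_eq]
  have h3 : ∀ (l : List S) (v : X), selfWt st b (τ v) (l.map σ) = selfWt st b v l := fun l => by
    induction l with
    | nil => exact fun v => rfl
    | cons e l ih =>
      intro v
      simp only [selfWt, List.map_cons, h, ← map_add, ih, ← h2 (e :: l)]
  rw [listGreen, ← (Equiv.listEquivOfEquiv σ).tsum_eq, listGreen]
  refine tsum_congr fun l => ?_
  change (if endPt st (τ v) (l.map σ) = τ x then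
    z ^ (l.map σ).length * selfWt st b (τ v) (l.map σ) else 0) = _
  simp only [h1, h3, List.length_map, EmbeddingLike.apply_eq_iff_eq]

end Lace

section Walks

variable {d : ℕ}

lemma wsawPos_zero {n : ℕ} (s : Fin n → Fin d × Bool) : wsawPos s 0 = 0 := by
  simp [wsawPos]

lemma wsawPos_cons {n : ℕ} (e : Fin d × Bool) (s : Fin n → Fin d × Bool) (k : ℕ) :
    wsawPos (Fin.cons e s : Fin (n + 1) → Fin d × Bool) (k + 1) = wsawStep d e + wsawPos s k := by
  simp only [wsawPos, Finset.sum_filter, Fin.sum_univ_succ]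
  simp

lemma endPt_ofFn (v : Fin d → ℤ) {n : ℕ} (s : Fin n → Fin d × Bool) :
    endPt (wsawStep d) v (List.ofFn s) = v + wsawPos s n := by
  induction n generalizing v with
  | zero => simp [endPt, wsawPos_zero]
  | succ n ih =>
    rw [← Fin.cons_self_tail s, List.ofFn_cons, wsawPos_cons, endPt, ih, add_assoc]

lemma obsWt_siteObs_ofFn {β : ℝ} (hβ : 0 ≤ β) (hβ' : β ≤ 1) (w v : Fin d → ℤ) {n : ℕ}
    (s : Fin n → Fin d × Bool) :
    obsWt (wsawStep d) (siteObs (ENNReal.ofReal β) w) v (List.ofFn s) =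
      ENNReal.ofReal (∏ k ∈ Finset.range n,
        (1 + β * (if w = v + wsawPos s (k + 1) then (-1 : ℝ) else 0))) := by
  induction n generalizing v with
  | zero => simp [obsWt]
  | succ n ih =>
    rw [← Fin.cons_self_tail s, List.ofFn_cons, Finset.prod_range_succ', obsWt, ih, mul_comm,
      ENNReal.ofReal_mul]
    · simp only [wsawPos_cons, ← add_assoc, wsawPos_zero, add_zero]
      congr 1
      unfold siteObs
      split_ifs
      · rw [← ENNReal.ofReal_one, ← ENNReal.ofReal_sub _ hβ]; congr 1; ring
      · simp
    · exact Finset.prod_nonneg fun k _ => by split_ifs <;> linarith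

lemma wsawWeight_cons (β : ℝ) {n : ℕ} (e : Fin d × Bool) (s : Fin n → Fin d × Bool) :
    wsawWeight β (n + 1) (Fin.cons e s) = (∏ k ∈ Finset.range (n + 1),
      (1 + β * (if 0 = wsawStep d e + wsawPos s k then (-1 : ℝ) else 0))) * wsawWeight β n s := by
  simp only [wsawWeight, Finset.prod_filter, Finset.prod_product]
  rw [Finset.prod_range_succ', mul_comm]
  congr 1
  · rw [Finset.prod_range_succ']
    simp [wsawPos_cons, wsawPos_zero]
  · refine Finset.prod_congr rfl fun i _ => ?_
    rw [Finset.prod_range_succ']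
    simp [wsawPos_cons]

lemma wsawWeight_nonneg {β : ℝ} (hβ' : β ≤ 1) (n : ℕ) (s : Fin n → Fin d × Bool) :
    0 ≤ wsawWeight β n s :=
  Finset.prod_nonneg fun k _ => by split_ifs <;> linarith

lemma selfWt_ofFn {β : ℝ} (hβ : 0 ≤ β) (hβ' : β ≤ 1) (v : Fin d → ℤ) {n : ℕ}
    (s : Fin n → Fin d × Bool) :
    selfWt (wsawStep d) (ENNReal.ofReal β) v (List.ofFn s) =
      ENNReal.ofReal (wsawWeight β n s) := by
  induction n generalizing v with
  | zero =>
    rw [wsawWeight, Finset.prod_eq_one]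
    · simp [selfWt]
    · rintro ⟨i, j⟩ hp; simp at hp; omega
  | succ n ih =>
    rw [← Fin.cons_self_tail s, List.ofFn_cons, selfWt, ih, ← List.ofFn_cons,
      obsWt_siteObs_ofFn hβ hβ', wsawWeight_cons, ENNReal.ofReal_mul]
    · simp only [wsawPos_cons, left_eq_add, eq_comm (a := (0 : Fin d → ℤ))]
    · exact Finset.prod_nonneg fun k _ => by split_ifs <;> linarith

/-- The two-point function as an extended nonnegative real. -/
noncomputable def greenE (d : ℕ) (b z : ℝ≥0∞) (x : Fin d → ℤ) : ℝ≥0∞ :=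
  listGreen (wsawStep d) b z 0 x

lemma tsum_list_eq (f : List (Fin d × Bool) → ℝ≥0∞) :
    ∑' l, f l = ∑' n, ∑ s : Fin n → Fin d × Bool, f (List.ofFn s) := by
  rw [← (List.equivSigmaTuple (α := Fin d × Bool)).symm.tsum_eq, ENNReal.tsum_sigma']
  simp [tsum_fintype, List.equivSigmaTuple]

variable {β z : ℝ}

lemma cZx_nonneg (hβ' : β ≤ 1) (n : ℕ) (x : Fin d → ℤ) : 0 ≤ cZx d β n x :=
  Finset.sum_nonneg fun s _ => wsawWeight_nonneg hβ' n s

lemma cZ_nonneg (hβ' : β ≤ 1) (n : ℕ) : 0 ≤ cZ d β n :=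
  Finset.sum_nonneg fun s _ => wsawWeight_nonneg hβ' n s

lemma greenE_eq_tsum (hβ : 0 ≤ β) (hβ' : β ≤ 1) (hz : 0 ≤ z) (x : Fin d → ℤ) :
    greenE d (ENNReal.ofReal β) (ENNReal.ofReal z) x =
      ∑' n, ENNReal.ofReal (cZx d β n x * z ^ n) := by
  rw [greenE, listGreen, tsum_list_eq]
  refine tsum_congr fun n => ?_
  rw [cZx, Finset.sum_mul, ENNReal.ofReal_sum_of_nonneg
    fun s _ => mul_nonneg (wsawWeight_nonneg hβ' n s) (pow_nonneg hz n), Finset.sum_filter]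
  refine Finset.sum_congr rfl fun s _ => ?_
  rw [endPt_ofFn, zero_add, selfWt_ofFn hβ hβ', List.length_ofFn,
    ENNReal.ofReal_mul (wsawWeight_nonneg hβ' n s), ENNReal.ofReal_pow hz, mul_comm]

lemma tsum_greenE_eq (hβ : 0 ≤ β) (hβ' : β ≤ 1) (hz : 0 ≤ z) :
    ∑' x, greenE d (ENNReal.ofReal β) (ENNReal.ofReal z) x =
      ∑' n, ENNReal.ofReal (cZ d β n * z ^ n) := by
  simp only [greenE, listGreen]
  rw [ENNReal.tsum_comm]
  have : ∀ (l : List (Fin d × Bool)) (c : ℝ≥0∞),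
      (∑' x, if endPt (wsawStep d) 0 l = x then c else 0) = c := fun l c => by
    rw [tsum_eq_single (endPt (wsawStep d) 0 l) fun p hp => if_neg hp.symm, if_pos rfl]
  simp only [this]
  rw [tsum_list_eq]
  refine tsum_congr fun n => ?_
  rw [cZ, Finset.sum_mul, ENNReal.ofReal_sum_of_nonneg
    fun s _ => mul_nonneg (wsawWeight_nonneg hβ' n s) (pow_nonneg hz n)]
  refine Finset.sum_congr rfl fun s _ => ?_
  rw [selfWt_ofFn hβ hβ', List.length_ofFn,
    ENNReal.ofReal_mul (wsawWeight_nonneg hβ' n s), ENNReal.ofReal_pow hz, mul_comm]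

lemma Gpt_eq (hβ : 0 ≤ β) (hβ' : β ≤ 1) (hz : 0 ≤ z) (x : Fin d → ℤ) :
    Gpt d β z x = (greenE d (ENNReal.ofReal β) (ENNReal.ofReal z) x).toReal := by
  rw [greenE_eq_tsum hβ hβ' hz, ENNReal.tsum_toReal_eq fun n => ENNReal.ofReal_ne_top, Gpt]
  exact tsum_congr fun n => (ENNReal.toReal_ofReal
    (mul_nonneg (cZx_nonneg hβ' n x) (pow_nonneg hz n))).symm

lemma chiR_eq (hβ : 0 ≤ β) (hβ' : β ≤ 1) (hz : 0 ≤ z) :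
    chiR d β z = (∑' x, greenE d (ENNReal.ofReal β) (ENNReal.ofReal z) x).toReal := by
  rw [tsum_greenE_eq hβ hβ' hz, ENNReal.tsum_toReal_eq fun n => ENNReal.ofReal_ne_top, chiR]
  exact tsum_congr fun n => (ENNReal.toReal_ofReal
    (mul_nonneg (cZ_nonneg hβ' n) (pow_nonneg hz n))).symm

lemma HasGrowthConst.tsum_ne_top (hβ : 0 ≤ β) (hβ' : β ≤ 1) {μ : ℝ} (hμ : HasGrowthConst d β μ)
    (hz : 0 < z) (hzμ : z < μ⁻¹) :
    ∑' x, greenE d (ENNReal.ofReal β) (ENNReal.ofReal z) x ≠ ∞ := by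
  have hμ0 : 0 < μ := inv_pos.1 (hz.trans hzμ)
  have h1 : μ < z⁻¹ := (lt_inv_comm₀ hz hμ0).1 hzμ
  obtain ⟨ν, hν, hν'⟩ := exists_between h1
  have hν0 : 0 < ν := hμ0.trans hν
  have hs : Summable fun n => cZ d β n * z ^ n := by
    have hθ : ν * z < 1 := by
      rw [lt_inv_comm₀ hν0 hz] at hν'
      calc ν * z < ν * ν⁻¹ := by gcongr
        _ = 1 := mul_inv_cancel₀ hν0.ne'
    refine summable_of_isBigO_nat (summable_geometric_of_lt_one (by positivity) hθ) ?_
    refine Asymptotics.IsBigO.of_bound 1 ?_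
    filter_upwards [hμ.eventually_lt_const hν, Filter.eventually_gt_atTop 0] with n hn hn0
    have hc := cZ_nonneg (d := d) hβ' n
    rw [Real.norm_of_nonneg (by positivity), Real.norm_of_nonneg (by positivity), one_mul, mul_pow]
    gcongr
    calc cZ d β n = ((cZ d β n) ^ ((n : ℝ)⁻¹)) ^ n :=
          (Real.rpow_inv_natCast_pow hc hn0.ne').symm
      _ ≤ ν ^ n := by gcongr
  rw [tsum_greenE_eq hβ hβ' hz.le]
  exact hs.tsum_ofReal_ne_top

lemma wsawStep_ne_zero (e : Fin d × Bool) : wsawStep d e ≠ 0 := fun h => by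
  have := congrFun h e.1
  simp only [wsawStep, if_true, Pi.zero_apply] at this
  split_ifs at this; omega

lemma greenE_neg (b z : ℝ≥0∞) (x : Fin d → ℤ) : greenE d b z (-x) = greenE d b z x := by
  have := listGreen_map (wsawStep d) b z (AddEquiv.neg (Fin d → ℤ))
    ((Equiv.refl (Fin d)).prodCongr Equiv.boolNot) (fun e => by
      ext i; rcases e with ⟨j, s⟩; cases s <;> (simp [wsawStep]; split_ifs <;> simp)) 0 x
  simpa [greenE] using this

/-- The reflection of one coordinate. -/
def coordFlip (i : Fin d) : (Fin d → ℤ) ≃+ (Fin d → ℤ) where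
  toFun x := fun j => if j = i then - x j else x j
  invFun x := fun j => if j = i then - x j else x j
  left_inv x := by ext j; dsimp; split_ifs <;> simp
  right_inv x := by ext j; dsimp; split_ifs <;> simp
  map_add' x y := by ext j; dsimp; split_ifs <;> ring

/-- The transposition of two coordinates. -/
def coordSwap (i k : Fin d) : (Fin d → ℤ) ≃+ (Fin d → ℤ) where
  toFun x := fun j => x (Equiv.swap i k j)
  invFun x := fun j => x (Equiv.swap i k j)
  left_inv x := by ext j; simp
  right_inv x := by ext j; simp
  map_add' x y := rfl

lemma greenE_flip (b z : ℝ≥0∞) (i : Fin d) (x : Fin d → ℤ) :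
    greenE d b z (coordFlip i x) = greenE d b z x := by
  let σ : Fin d × Bool → Fin d × Bool := fun e => if e.1 = i then (e.1, !e.2) else e
  have hσ : Function.Involutive σ := fun e => by
    rcases e with ⟨j, s⟩
    by_cases h : j = i <;> simp [σ, h]
  have := listGreen_map (wsawStep d) b z (coordFlip i) hσ.toPerm (fun e => by
      ext j; rcases e with ⟨k, s⟩
      simp only [wsawStep, coordFlip, Function.Involutive.coe_toPerm, σ, AddEquiv.coe_mk,
        Equiv.coe_fn_mk]
      by_cases hk : k = i <;> by_cases hj : j = i <;> cases s <;> simp [hk, hj] <;>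
        grind) 0 x
  simpa [greenE] using this

lemma greenE_swap (b z : ℝ≥0∞) (i k : Fin d) (x : Fin d → ℤ) :
    greenE d b z (coordSwap i k x) = greenE d b z x := by
  have := listGreen_map (wsawStep d) b z (coordSwap i k)
    ((Equiv.swap i k).prodCongr (Equiv.refl Bool)) (fun e => by
      ext j; rcases e with ⟨l, s⟩
      simp only [wsawStep, coordSwap, AddEquiv.coe_mk, Equiv.coe_fn_mk, Equiv.prodCongr_apply,
        Prod.map_apply, Equiv.refl_apply]
      congr 1
      simp only [eq_iff_iff]
      rw [Equiv.swap_apply_eq_iff]) 0 x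
  simpa [greenE] using this

end Walks

section LatticeSums

variable {d : ℕ}

/-- The decay factor `1 / (1 + ‖x‖)` on the lattice. -/
noncomputable def decay (x : Fin d → ℤ) : ℝ≥0 := (1 + ‖x‖₊)⁻¹

lemma pow_succ_le_add (y n : ℕ) : (y + 2) ^ n ≤ y ^ n + 2 * n * (y + 2) ^ (n - 1) := by
  induction n with
  | zero => simp
  | succ n ih =>
    rcases n with _ | n
    · simp
    · simp only [Nat.add_sub_cancel] at ih ⊢
      calc (y + 2) ^ (n + 1 + 1) = y * (y + 2) ^ (n + 1) + 2 * (y + 2) ^ (n + 1) := by ring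
        _ ≤ y * (y ^ (n + 1) + 2 * (n + 1) * (y + 2) ^ n) + 2 * (y + 2) ^ (n + 1) := by gcongr
        _ ≤ y * y ^ (n + 1) + 2 * (n + 1) * ((y + 2) * (y + 2) ^ n) + 2 * (y + 2) ^ (n + 1) := by
          rw [mul_add]; gcongr ?_ + ?_ + _
          · exact le_rfl
          · calc _ = 2 * (n + 1) * (y * (y + 2) ^ n) := by ring
              _ ≤ _ := by gcongr; omega
        _ = _ := by ring

lemma mem_box_iff (m : ℕ) (u : Fin d → ℤ) :
    u ∈ Finset.Icc (fun _ => -(m : ℤ)) (fun _ => (m : ℤ)) ↔ ‖u‖ ≤ m := by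
  rw [Finset.mem_Icc, pi_norm_le_iff_of_nonneg (by positivity)]
  simp only [Pi.le_def, ← forall_and, ← abs_le, Int.norm_eq_abs]
  exact forall_congr' fun i => by norm_cast

lemma card_box (m : ℕ) :
    (Finset.Icc (fun _ : Fin d => -(m : ℤ)) (fun _ => (m : ℤ))).card = (2 * m + 1) ^ d := by
  rw [Pi.card_Icc]
  simp only [Int.card_Icc, Finset.prod_const, Finset.card_univ, Fintype.card_fin]
  congr 1; omega

lemma norm_le_of_lt_add_one {m : ℕ} {u : Fin d → ℤ} (h : ‖u‖ < m + 1) : ‖u‖ ≤ m := by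
  rw [pi_norm_le_iff_of_nonneg (by positivity)]
  intro i
  have h1 := (norm_le_pi_norm u i).trans_lt h
  rw [Int.norm_eq_abs] at h1 ⊢
  norm_cast at h1 ⊢
  omega

lemma exists_shell (hd : 0 < d) (m : ℕ) : ∃ s : Finset (Fin d → ℤ),
    (∀ u : Fin d → ℤ, ⌊‖u‖⌋₊ = m → u ∈ s) ∧ s.card ≤ 2 ^ d * d * (m + 1) ^ (d - 1) := by
  rcases m with _ | m
  · refine ⟨Finset.Icc (fun _ : Fin d => -((0 : ℕ) : ℤ)) (fun _ => ((0 : ℕ) : ℤ)),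
      fun u hu => (mem_box_iff 0 u).2 (norm_le_of_lt_add_one ?_), ?_⟩
    · simpa [hu] using Nat.lt_floor_add_one ‖u‖
    · rw [card_box]
      simp; exact Nat.succ_le_of_lt (by positivity)
  · refine ⟨Finset.Icc (fun _ : Fin d => -((m + 1 : ℕ) : ℤ)) (fun _ => ((m + 1 : ℕ) : ℤ)) \
      Finset.Icc (fun _ : Fin d => -(m : ℤ)) (fun _ => (m : ℤ)),
      fun u hu => Finset.mem_sdiff.2 ⟨(mem_box_iff _ u).2 (norm_le_of_lt_add_one ?_), ?_⟩, ?_⟩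
    · simpa [hu] using Nat.lt_floor_add_one ‖u‖
    · rw [mem_box_iff, not_le]
      have := Nat.floor_le (norm_nonneg u)
      rw [hu] at this
      push_cast at this
      linarith
    · rw [Finset.card_sdiff_of_subset, card_box, card_box]
      · have h1 := pow_succ_le_add (2 * m + 1) d
        have h2 : (2 * m + 1 + 2) ^ (d - 1) ≤ 2 ^ (d - 1) * (m + 1 + 1) ^ (d - 1) := by
          rw [← mul_pow]; exact Nat.pow_le_pow_left (by omega) _
        have h3 : 2 * d * (2 * m + 1 + 2) ^ (d - 1) ≤ 2 ^ d * d * (m + 1 + 1) ^ (d - 1) := by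
          calc _ ≤ 2 * d * (2 ^ (d - 1) * (m + 1 + 1) ^ (d - 1)) := by gcongr
            _ = 2 ^ (d - 1 + 1) * d * (m + 1 + 1) ^ (d - 1) := by ring
            _ = _ := by rw [Nat.sub_add_cancel hd]
        have h4 : 2 * (m + 1) + 1 = 2 * m + 1 + 2 := by ring
        rw [h4]; omega
      · intro u
        rw [mem_box_iff, mem_box_iff]
        intro h; push_cast; linarith

lemma min_le_telescope (t : ℝ≥0) (ht : 0 < t) (m : ℕ) :
    min ((m : ℝ) + 1) (t ^ 3 / ((m : ℝ) + 1) ^ 2) ≤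
      4 * t ^ 2 * (((m + 1 : ℕ) : ℝ) / ((m + 1 : ℕ) + t) - (m : ℝ) / (m + t)) := by
  have ht' : (0 : ℝ) < t := ht
  have hm : (0 : ℝ) ≤ m := by positivity
  have h1 : ((m + 1 : ℕ) : ℝ) / ((m + 1 : ℕ) + t) - (m : ℝ) / (m + t) =
      t / ((m + 1 + t) * (m + t)) := by
    push_cast; field_simp; ring
  have h2 : (t : ℝ) / (m + 1 + t) ^ 2 ≤ t / ((m + 1 + t) * (m + t)) := by
    rw [sq]; gcongr; linarith
  rw [h1]
  refine le_trans ?_ (mul_le_mul_of_nonneg_left h2 (by positivity))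
  rcases le_total (t : ℝ) (m + 1) with h | h
  · refine (min_le_right _ _).trans ?_
    calc (t : ℝ) ^ 3 / (m + 1) ^ 2 = 4 * t ^ 2 * (t / (m + 1 + (m + 1)) ^ 2) := by
          field_simp; ring
      _ ≤ _ := by gcongr
  · refine (min_le_left _ _).trans ?_
    calc (m + 1 : ℝ) ≤ t := h
      _ = 4 * t ^ 2 * (t / (t + t) ^ 2) := by field_simp; ring
      _ ≤ _ := by gcongr

lemma exists_tsum_min_le (hd : 2 < d) : ∃ C : ℝ≥0, ∀ t : ℝ≥0,
    ∑' u : Fin d → ℤ, ((min (decay u ^ (d - 2)) (t ^ 3 * decay u ^ (d + 1)) : ℝ≥0) : ℝ≥0∞) ≤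
      C * t ^ 2 := by
  refine ⟨2 ^ d * d * 4, fun t => ?_⟩
  rcases eq_or_ne t 0 with rfl | ht0
  · simp
  have ht : 0 < t := pos_iff_ne_zero.2 ht0
  set f : (Fin d → ℤ) → ℝ≥0∞ := fun u =>
    ((min (decay u ^ (d - 2)) (t ^ 3 * decay u ^ (d + 1)) : ℝ≥0) : ℝ≥0∞) with hf
  set g : ℕ → ℝ≥0∞ := fun m => ENNReal.ofReal
    (((m + 1 : ℕ) : ℝ) / ((m + 1 : ℕ) + t) - (m : ℝ) / (m + t)) with hg
  have hmono : ∀ m : ℕ, 0 ≤ ((m + 1 : ℕ) : ℝ) / ((m + 1 : ℕ) + t) - (m : ℝ) / (m + t) := fun m => by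
    have := (le_min (by positivity) (by positivity)).trans (min_le_telescope t ht m)
    exact nonneg_of_mul_nonneg_right this (by positivity)
  have hgs : ∑' m, g m ≤ 1 := by
    refine ENNReal.tsum_le_of_sum_range_le fun n => ?_
    rw [hg, ← ENNReal.ofReal_sum_of_nonneg fun m _ => hmono m,
      Finset.sum_range_sub (fun m : ℕ => (m : ℝ) / (m + t)), ← ENNReal.ofReal_one]
    refine ENNReal.ofReal_le_ofReal ?_
    have : (n : ℝ) / (n + t) ≤ 1 := div_le_one_of_le₀ (by simp) (by positivity)
    simpa using this
  have hshell : ∀ m : ℕ, ∑' u, (if ⌊‖u‖⌋₊ = m then f u else 0) ≤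
      (2 ^ d * d * 4 : ℝ≥0) * t ^ 2 * g m := fun m => by
    obtain ⟨s, hs, hcard⟩ := exists_shell (d := d) (by omega) m
    rw [tsum_eq_sum (s := s) fun u hu => if_neg fun h => hu (hs u h)]
    have hn : ∀ u : Fin d → ℤ, ⌊‖u‖⌋₊ = m → decay u ≤ ((m : ℝ≥0) + 1)⁻¹ := fun u hu => by
      unfold decay
      rw [add_comm (m : ℝ≥0)]
      have h := Nat.floor_le (norm_nonneg u)
      rw [hu] at h
      gcongr
      exact h
    calc _ ≤ ∑ u ∈ s, ((min ((((m : ℝ≥0) + 1)⁻¹) ^ (d - 2))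
            (t ^ 3 * (((m : ℝ≥0) + 1)⁻¹) ^ (d + 1)) : ℝ≥0) : ℝ≥0∞) := by
          refine Finset.sum_le_sum fun u _ => ?_
          split_ifs with h
          · simp only [hf]
            have := hn u h
            gcongr
          · simp
      _ = ((s.card * min ((((m : ℝ≥0) + 1)⁻¹) ^ (d - 2))
            (t ^ 3 * (((m : ℝ≥0) + 1)⁻¹) ^ (d + 1)) : ℝ≥0) : ℝ≥0∞) := by
          rw [Finset.sum_const, nsmul_eq_mul]; push_cast; rfl
      _ ≤ ((2 ^ d * d * min ((m : ℝ≥0) + 1) (t ^ 3 / ((m : ℝ≥0) + 1) ^ 2) : ℝ≥0) : ℝ≥0∞) := by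
          rw [ENNReal.coe_le_coe]
          have hc : (s.card : ℝ≥0) ≤ 2 ^ d * d * ((m : ℝ≥0) + 1) ^ (d - 1) := by
            exact_mod_cast hcard
          calc _ ≤ 2 ^ d * d * ((m : ℝ≥0) + 1) ^ (d - 1) * min ((((m : ℝ≥0) + 1)⁻¹) ^ (d - 2))
                (t ^ 3 * (((m : ℝ≥0) + 1)⁻¹) ^ (d + 1)) := by gcongr
            _ = _ := by
              rw [mul_assoc, mul_min]
              congr 2
              · obtain ⟨k, rfl⟩ : ∃ k, d = k + 3 := ⟨d - 3, by omega⟩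
                rw [show k + 3 - 1 = k + 1 + 1 by omega, show k + 3 - 2 = k + 1 by omega, inv_pow]
                field_simp
                ring
              · obtain ⟨k, rfl⟩ : ∃ k, d = k + 3 := ⟨d - 3, by omega⟩
                rw [show k + 3 - 1 = k + 2 by omega, inv_pow]
                field_simp
                ring
      _ ≤ _ := by
          have h2 : min ((m : ℝ≥0) + 1) (t ^ 3 / ((m : ℝ≥0) + 1) ^ 2) ≤
              4 * t ^ 2 * Real.toNNReal (((m + 1 : ℕ) : ℝ) / ((m + 1 : ℕ) + t) -
                (m : ℝ) / (m + t)) := by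
            rw [← NNReal.coe_le_coe]
            push_cast
            have h3 := hmono m
            push_cast at h3
            rw [Real.coe_toNNReal _ h3]
            exact_mod_cast min_le_telescope t ht m
          calc _ ≤ ((2 ^ d * d * (4 * t ^ 2 * Real.toNNReal (((m + 1 : ℕ) : ℝ) /
                ((m + 1 : ℕ) + t) - (m : ℝ) / (m + t))) : ℝ≥0) : ℝ≥0∞) := by
                rw [ENNReal.coe_le_coe]; gcongr
            _ = _ := by simp only [hg, ENNReal.ofReal]; push_cast; ring
  calc ∑' u, f u = ∑' u, ∑' m : ℕ, (if ⌊‖u‖⌋₊ = m then f u else 0) := by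
        refine tsum_congr fun u => ?_
        rw [tsum_eq_single ⌊‖u‖⌋₊ fun m hm => if_neg hm.symm, if_pos rfl]
    _ = ∑' m : ℕ, ∑' u, (if ⌊‖u‖⌋₊ = m then f u else 0) := ENNReal.tsum_comm
    _ ≤ ∑' m : ℕ, (2 ^ d * d * 4 : ℝ≥0) * t ^ 2 * g m := ENNReal.tsum_le_tsum hshell
    _ = (2 ^ d * d * 4 : ℝ≥0) * t ^ 2 * ∑' m, g m := ENNReal.tsum_mul_left
    _ ≤ (2 ^ d * d * 4 : ℝ≥0) * t ^ 2 * 1 := by gcongr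
    _ = _ := by rw [mul_one]

lemma decay_le_one (x : Fin d → ℤ) : decay x ≤ 1 := by
  unfold decay
  exact inv_le_one_of_one_le₀ (by simp)

lemma decay_pos (x : Fin d → ℤ) : 0 < decay x := by
  unfold decay
  positivity

lemma decay_neg (x : Fin d → ℤ) : decay (-x) = decay x := by simp [decay]

lemma exists_tsum_decay_le (hd : 2 < d) : ∃ K : ℝ≥0, ∀ p : ℕ, d + 1 ≤ p →
    ∑' u : Fin d → ℤ, (decay u : ℝ≥0∞) ^ p ≤ K := by
  obtain ⟨C, hC⟩ := exists_tsum_min_le hd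
  refine ⟨C, fun p hp => le_trans (ENNReal.tsum_le_tsum fun u => ?_) ((hC 1).trans (by simp))⟩
  rw [← ENNReal.coe_pow, ENNReal.coe_le_coe, one_pow, one_mul]
  have h := decay_le_one u
  exact le_min (pow_le_pow_of_le_one (zero_le) h (by omega))
    (pow_le_pow_of_le_one (zero_le) h (by omega))

end LatticeSums

section Diagrams

variable {d : ℕ}

lemma decay_mul_le (x y : Fin d → ℤ) :
    decay x * decay y ≤ decay (x + y) * (decay x + decay y) := by
  have h : (1 + ‖x + y‖₊ : ℝ≥0) ≤ (1 + ‖x‖₊) + (1 + ‖y‖₊) := by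
    calc (1 + ‖x + y‖₊ : ℝ≥0) ≤ 1 + (‖x‖₊ + ‖y‖₊) := by gcongr; exact nnnorm_add_le x y
      _ ≤ 1 + (‖x‖₊ + ‖y‖₊) + 1 := le_self_add
      _ = _ := by ring
  have h2 : decay x + decay y = ((1 + ‖x‖₊) + (1 + ‖y‖₊)) * (decay x * decay y) := by
    unfold decay
    field_simp
    ring
  calc decay x * decay y = decay (x + y) * ((1 + ‖x + y‖₊) * (decay x * decay y)) := by
        rw [← mul_assoc, show decay (x + y) * (1 + ‖x + y‖₊) = 1 from
          inv_mul_cancel₀ (by positivity), one_mul]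
    _ ≤ decay (x + y) * (((1 + ‖x‖₊) + (1 + ‖y‖₊)) * (decay x * decay y)) := by gcongr
    _ = _ := by rw [← h2]

lemma decay_pow_mul_le (n : ℕ) (x y : Fin d → ℤ) :
    decay x ^ n * decay y ^ n ≤ 2 ^ n * decay (x + y) ^ n * (decay x ^ n + decay y ^ n) := by
  rw [← mul_pow]
  calc (decay x * decay y) ^ n ≤ (decay (x + y) * (2 * max (decay x) (decay y))) ^ n := by
        refine pow_le_pow_left₀ (zero_le) ((decay_mul_le x y).trans ?_) n
        gcongr
        rw [two_mul]
        exact add_le_add (le_max_left _ _) (le_max_right _ _)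
    _ = 2 ^ n * decay (x + y) ^ n * max (decay x) (decay y) ^ n := by ring
    _ ≤ _ := by
        gcongr
        rcases le_total (decay x) (decay y) with h | h
        · rw [max_eq_right h]; exact le_add_self
        · rw [max_eq_left h]; exact le_self_add

lemma exists_tsum_vertex_le (hd : 4 < d) : ∃ K : ℝ≥0, ∀ v p q : Fin d → ℤ,
    ∑' w, ((decay (w - v) ^ (d - 2) * decay (p - w) ^ (d - 2) *
      (decay (q - w) ^ (d - 2)) ^ 2 : ℝ≥0) : ℝ≥0∞) ≤
      (K * decay (q - v) ^ (d - 2) * decay (q - p) ^ (d - 2) : ℝ≥0) := by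
  obtain ⟨K, hK⟩ := exists_tsum_decay_le (d := d) (by omega)
  refine ⟨4 ^ (d - 2) * (7 * K), fun v p q => ?_⟩
  set n := d - 2
  have hpt : ∀ w, (decay (w - v) ^ n * decay (p - w) ^ n * (decay (q - w) ^ n) ^ 2 : ℝ≥0) ≤
      4 ^ n * decay (q - v) ^ n * decay (q - p) ^ n * (2 * decay (w - v) ^ (2 * n) +
        2 * decay (p - w) ^ (2 * n) + 3 * decay (q - w) ^ (2 * n)) := fun w => by
    have h1 := decay_pow_mul_le n (w - v) (q - w)
    have h2 := decay_pow_mul_le n (w - p) (q - w)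
    rw [show w - v + (q - w) = q - v by abel] at h1
    rw [show w - p + (q - w) = q - p by abel] at h2
    rw [← decay_neg (w - p), neg_sub] at h2
    have h4 : (4 : ℝ≥0) ^ n = 2 ^ n * 2 ^ n := by rw [← mul_pow]; norm_num
    simp only [mul_comm 2 n, pow_mul, h4]
    generalize decay (w - v) ^ n = A at *
    generalize decay (p - w) ^ n = B at *
    generalize decay (q - w) ^ n = D at *
    have h3 : (A + D) * (B + D) ≤ 2 * A ^ 2 + 2 * B ^ 2 + 3 * D ^ 2 := by
      rw [← NNReal.coe_le_coe]
      push_cast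
      nlinarith [sq_nonneg ((A : ℝ) - B), sq_nonneg ((A : ℝ) - D), sq_nonneg ((B : ℝ) - D)]
    calc A * B * D ^ 2 = (A * D) * (B * D) := by ring
      _ ≤ (2 ^ n * decay (q - v) ^ n * (A + D)) * (2 ^ n * decay (q - p) ^ n * (B + D)) :=
        mul_le_mul' h1 h2
      _ = 2 ^ n * 2 ^ n * decay (q - v) ^ n * decay (q - p) ^ n * ((A + D) * (B + D)) := by ring
      _ ≤ _ := by gcongr
  calc _ ≤ ∑' w, ((4 ^ n * decay (q - v) ^ n * decay (q - p) ^ n *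
        (2 * decay (w - v) ^ (2 * n) + 2 * decay (p - w) ^ (2 * n) +
          3 * decay (q - w) ^ (2 * n)) : ℝ≥0) : ℝ≥0∞) :=
        ENNReal.tsum_le_tsum fun w => ENNReal.coe_le_coe.2 (hpt w)
    _ = (4 ^ n * decay (q - v) ^ n * decay (q - p) ^ n : ℝ≥0) *
        (2 * ∑' w, (decay (w - v) : ℝ≥0∞) ^ (2 * n) + 2 * ∑' w, (decay (p - w) : ℝ≥0∞) ^ (2 * n) +
          3 * ∑' w, (decay (q - w) : ℝ≥0∞) ^ (2 * n)) := by
        simp only [← ENNReal.tsum_mul_left, ← ENNReal.tsum_add]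
        push_cast
        rfl
    _ ≤ (4 ^ n * decay (q - v) ^ n * decay (q - p) ^ n : ℝ≥0) * (2 * K + 2 * K + 3 * K) := by
        have hn : d + 1 ≤ 2 * n := by omega
        gcongr
        · exact ((Equiv.subRight v).tsum_eq fun w => (decay w : ℝ≥0∞) ^ (2 * n)).trans_le (hK _ hn)
        · exact ((Equiv.subLeft p).tsum_eq fun w => (decay w : ℝ≥0∞) ^ (2 * n)).trans_le (hK _ hn)
        · exact ((Equiv.subLeft q).tsum_eq fun w => (decay w : ℝ≥0∞) ^ (2 * n)).trans_le (hK _ hn)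
    _ = _ := by push_cast; ring

variable (b z : ℝ≥0∞)

lemma listGreen_eq_greenE (v x : Fin d → ℤ) :
    listGreen (wsawStep d) b z v x = greenE d b z (x - v) := by
  have := listGreen_translate (wsawStep d) b z 0 (x - v) v
  rwa [zero_add, sub_add_cancel] at this

/-- The coefficients of the lace expansion of order `k`. -/
noncomputable def laceCoeff (d : ℕ) (b z : ℝ≥0∞) (k : ℕ) (q : Fin d → ℤ) : ℝ≥0∞ :=
  z * ∑ e, laceIter (wsawStep d) b z (fun _ p => if p = q then 1 else 0) k (siteObs b 0)
    (wsawStep d e)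

lemma laceIter_succ_le {M c K : ℝ≥0} (hG : ∀ x, greenE d b z x ≤ M * (decay x : ℝ≥0∞) ^ (d - 2))
    (hK : ∀ v p q : Fin d → ℤ, ∑' w, ((decay (w - v) ^ (d - 2) * decay (p - w) ^ (d - 2) *
      (decay (q - w) ^ (d - 2)) ^ 2 : ℝ≥0) : ℝ≥0∞) ≤
      (K * decay (q - v) ^ (d - 2) * decay (q - p) ^ (d - 2) : ℝ≥0))
    (hc : b * (M ^ 2 * K : ℝ≥0) ≤ c) (q : Fin d → ℤ) (k : ℕ) (a : (Fin d → ℤ) → ℝ≥0∞)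
    (ha : ∀ w, a w ≤ 1) (v : Fin d → ℤ) :
    laceIter (wsawStep d) b z (fun _ p => if p = q then 1 else 0) (k + 1) a v ≤
      c ^ k * ∑' p, (1 - a p) *
        (M * decay (q - v) ^ (d - 2) * (decay (q - p) ^ (d - 2)) ^ 2 : ℝ≥0) := by
  induction k generalizing a v with
  | zero =>
    refine (laceOp_le (wsawStep d) b z _ a ha v).trans ?_
    rw [pow_zero, one_mul]
    refine ENNReal.tsum_le_tsum fun p => ?_
    gcongr
    simp only [laceIter]
    by_cases hp : p = q
    · subst hp
      simp only [if_true, mul_one, sub_self]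
      refine (listGreen_eq_greenE b z v p).trans_le ((hG _).trans_eq ?_)
      have : decay (0 : Fin d → ℤ) = 1 := by simp [decay]
      simp [this]
    · simp [hp]
  | succ k ih =>
    refine (laceOp_le (wsawStep d) b z _ a ha v).trans ?_
    rw [← ENNReal.tsum_mul_left]
    refine ENNReal.tsum_le_tsum fun p => ?_
    rw [mul_left_comm]
    gcongr
    set n := d - 2
    calc _ ≤ ∑' l : List (Fin d × Bool), ∑' w, c ^ k *
          (M * decay (q - p) ^ n * (decay (q - w) ^ n) ^ 2 : ℝ≥0) *
          (if endPt (wsawStep d) v l = p then z ^ l.length * selfWt (wsawStep d) b v l *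
            (1 - walkObs (wsawStep d) b v l w) else 0) := by
          refine ENNReal.tsum_le_tsum fun l => ?_
          split_ifs
          · refine (mul_le_mul_right (ih _ (walkObs_le_one _ b v l) p) _).trans_eq ?_
            rw [← mul_assoc, ← ENNReal.tsum_mul_left]
            exact tsum_congr fun w => by ring
          · simp
      _ ≤ ∑' w, c ^ k * (M * decay (q - p) ^ n * (decay (q - w) ^ n) ^ 2 : ℝ≥0) *
          (b * (greenE d b z (w - v) * greenE d b z (p - w))) := by
          rw [ENNReal.tsum_comm]
          refine ENNReal.tsum_le_tsum fun w => ?_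
          rw [ENNReal.tsum_mul_left]
          gcongr
          rw [← listGreen_eq_greenE, ← listGreen_eq_greenE]
          exact tsum_one_sub_walkObs_le (wsawStep d) b z v p w
      _ ≤ ∑' w, c ^ k * (M * decay (q - p) ^ n * (decay (q - w) ^ n) ^ 2 : ℝ≥0) *
          (b * ((M * (decay (w - v) : ℝ≥0∞) ^ n) * (M * (decay (p - w) : ℝ≥0∞) ^ n))) := by
          gcongr with w
          · exact hG _
          · exact hG _
      _ = c ^ k * (M ^ 3 * b * (decay (q - p) : ℝ≥0∞) ^ n) *
          ∑' w, ((decay (w - v) ^ n * decay (p - w) ^ n *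
            (decay (q - w) ^ n) ^ 2 : ℝ≥0) : ℝ≥0∞) := by
          rw [← ENNReal.tsum_mul_left]
          refine tsum_congr fun w => ?_
          push_cast
          ring
      _ ≤ c ^ k * (M ^ 3 * b * (decay (q - p) : ℝ≥0∞) ^ n) *
          (K * decay (q - v) ^ n * decay (q - p) ^ n : ℝ≥0) := by gcongr; exact hK v p q
      _ = c ^ k * (b * (M ^ 2 * K : ℝ≥0)) *
          (M * decay (q - v) ^ n * (decay (q - p) ^ n) ^ 2 : ℝ≥0) := by push_cast; ring
      _ ≤ _ := by rw [pow_succ]; exact mul_le_mul_left (mul_le_mul_right hc _) _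

end Diagrams

section Kernel

variable {d : ℕ} (b z : ℝ≥0∞)

lemma decay_sub_step_le (q : Fin d → ℤ) (e : Fin d × Bool) :
    decay (q - wsawStep d e) ≤ 2 * decay q := by
  have h1 : ‖wsawStep d e‖₊ ≤ 1 := by
    rw [pi_nnnorm_le_iff]
    intro i
    unfold wsawStep
    split_ifs <;> simp
  have h2 : ‖q‖₊ ≤ ‖q - wsawStep d e‖₊ + 1 := by
    calc ‖q‖₊ = ‖(q - wsawStep d e) + wsawStep d e‖₊ := by rw [sub_add_cancel]
      _ ≤ _ := (nnnorm_add_le _ _).trans (by gcongr)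
  unfold decay
  rw [inv_le_iff_one_le_mul₀ (by positivity)]
  calc (1 : ℝ≥0) = (1 + ‖q‖₊)⁻¹ * (1 + ‖q‖₊) := (inv_mul_cancel₀ (by positivity)).symm
    _ ≤ (1 + ‖q‖₊)⁻¹ * (1 + (‖q - wsawStep d e‖₊ + 1)) := by gcongr
    _ ≤ (1 + ‖q‖₊)⁻¹ * (2 * (1 + ‖q - wsawStep d e‖₊)) := by
      gcongr
      rw [mul_add, mul_one, ← one_add_one_eq_two, add_mul, one_mul]
      calc 1 + (‖q - wsawStep d e‖₊ + 1) ≤ 1 + (‖q - wsawStep d e‖₊ + 1) +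
            ‖q - wsawStep d e‖₊ := le_self_add
        _ = _ := by ring
    _ = _ := by ring

lemma laceCoeff_succ_le {M c K : ℝ≥0}
    (hG : ∀ x, greenE d b z x ≤ M * (decay x : ℝ≥0∞) ^ (d - 2))
    (hK : ∀ v p q : Fin d → ℤ, ∑' w, ((decay (w - v) ^ (d - 2) * decay (p - w) ^ (d - 2) *
      (decay (q - w) ^ (d - 2)) ^ 2 : ℝ≥0) : ℝ≥0∞) ≤
      (K * decay (q - v) ^ (d - 2) * decay (q - p) ^ (d - 2) : ℝ≥0))
    (hc : b * (M ^ 2 * K : ℝ≥0) ≤ c) (hb : b ≤ 1) (k : ℕ) (q : Fin d → ℤ) :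
    laceCoeff d b z (k + 1) q ≤
      z * b * (2 * d * M * 2 ^ (d - 2) : ℝ≥0) * (decay q : ℝ≥0∞) ^ (3 * (d - 2)) * c ^ k := by
  set n := d - 2
  have h : ∀ e : Fin d × Bool, laceIter (wsawStep d) b z (fun _ p => if p = q then 1 else 0)
      (k + 1) (siteObs b 0) (wsawStep d e) ≤
      c ^ k * (b * (M * 2 ^ n * decay q ^ (3 * n) : ℝ≥0)) := fun e => by
    refine (laceIter_succ_le b z hG hK hc q k _ (siteObs_le_one b 0) _).trans ?_
    rw [tsum_eq_single 0 fun p hp => by simp [siteObs, hp.symm]]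
    have h1 : 1 - siteObs b 0 (0 : Fin d → ℤ) = b := by
      simp only [siteObs, if_true]
      rw [ENNReal.sub_sub_cancel ENNReal.one_ne_top hb]
    rw [h1]
    refine mul_le_mul_right (mul_le_mul_right (ENNReal.coe_le_coe.2 ?_) _) _
    calc M * decay (q - wsawStep d e) ^ n * (decay (q - 0) ^ n) ^ 2
        ≤ M * (2 * decay q) ^ n * (decay (q - 0) ^ n) ^ 2 := by
          have := decay_sub_step_le q e
          gcongr
      _ = _ := by rw [sub_zero]; ring
  calc laceCoeff d b z (k + 1) q ≤ z * ∑ e : Fin d × Bool,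
        c ^ k * (b * (M * 2 ^ n * decay q ^ (3 * n) : ℝ≥0)) := by
        unfold laceCoeff; gcongr with e; exact h e
    _ = _ := by
        rw [Finset.sum_const, nsmul_eq_mul]
        simp only [Finset.card_univ, Fintype.card_prod, Fintype.card_fin, Fintype.card_bool]
        push_cast
        ring

lemma greenE_add_tsum_odd (x : Fin d → ℤ) :
    greenE d b z x + ∑' q, (∑' j, laceCoeff d b z (2 * j + 1) q) * greenE d b z (x - q) =
      (if (0 : Fin d → ℤ) = x then 1 else 0) +
        ∑' q, (∑' j, laceCoeff d b z (2 * j) q) * greenE d b z (x - q) := by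
  set U : ℕ → ℝ≥0∞ := fun k => z * ∑ e, laceIter (wsawStep d) b z
    (fun a p => obsGreen (wsawStep d) b z a p x) k (siteObs b 0) (wsawStep d e) with hU
  have hV : ∀ k, ∑' q, laceCoeff d b z k q * greenE d b z (x - q) = U k + U (k + 1) := fun k => by
    simp only [hU, laceCoeff, ← mul_add, ← Finset.sum_add_distrib, mul_assoc]
    rw [ENNReal.tsum_mul_left]
    congr 1
    simp only [Finset.sum_mul]
    rw [Summable.tsum_finsetSum fun _ _ => ENNReal.summable]
    refine Finset.sum_congr rfl fun e _ => ?_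
    rw [← laceIter_green _ _ _ _ _ _ (siteObs_le_one b 0), laceIter_green_eq_tsum]
    simp only [listGreen_eq_greenE]
  have h0 : greenE d b z x = (if (0 : Fin d → ℤ) = x then 1 else 0) + U 0 := by
    rw [greenE, listGreen_zero _ _ _ wsawStep_ne_zero, tsum_fintype]
    rfl
  simp only [← ENNReal.tsum_mul_right]
  rw [ENNReal.tsum_comm, ENNReal.tsum_comm (β := ℕ)]
  simp only [hV, ENNReal.tsum_add]
  rw [tsum_even_add_odd (f := U) ENNReal.summable ENNReal.summable, h0,
    add_assoc]
  congr 1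
  rw [tsum_eq_zero_add' (f := U) ENNReal.summable,
    ← tsum_even_add_odd (f := fun n => U (n + 1)) ENNReal.summable ENNReal.summable]

/-- The number of unit steps equal to a given vector. -/
noncomputable def stepCount (d : ℕ) (q : Fin d → ℤ) : ℝ≥0 :=
  ∑ e : Fin d × Bool, if wsawStep d e = q then 1 else 0

lemma exists_kernel (hd : 4 < d) (M : ℝ≥0) : ∃ β₁ C : ℝ≥0, 0 < β₁ ∧ β₁ ≤ 1 ∧
    ∀ b z : ℝ≥0, b ≤ β₁ → (∀ x, greenE d b z x ≤ M * (decay x : ℝ≥0∞) ^ (d - 2)) →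
      ∑' x, greenE d b z x ≠ ∞ → ∃ J : (Fin d → ℤ) → ℝ,
        (∀ q, |J q - z * stepCount d q| ≤ b * z * C * (decay q : ℝ) ^ (d + 4)) ∧
        ∀ x, (greenE d b z x).toReal = (if (0 : Fin d → ℤ) = x then 1 else 0) +
          ∑' w, J w * (greenE d b z (x - w)).toReal := by
  obtain ⟨K, hK⟩ := exists_tsum_vertex_le hd
  refine ⟨(2 * (M ^ 2 * K + 1))⁻¹, 2 * (2 * d * M * 2 ^ (d - 2)), by positivity,
    inv_le_one_of_one_le₀ ?_, fun b z hb hG hχ => ?_⟩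
  · calc (1 : ℝ≥0) ≤ 2 * 1 := by norm_num
      _ ≤ _ := by gcongr; exact le_add_self
  have hb1 : (b : ℝ≥0∞) ≤ 1 := by
    rw [← ENNReal.coe_one, ENNReal.coe_le_coe]
    refine hb.trans (inv_le_one_of_one_le₀ ?_)
    calc (1 : ℝ≥0) ≤ 2 * 1 := by norm_num
      _ ≤ _ := by gcongr; exact le_add_self
  have hc : (b : ℝ≥0∞) * (M ^ 2 * K : ℝ≥0) ≤ (2⁻¹ : ℝ≥0) := by
    rw [← ENNReal.coe_mul, ENNReal.coe_le_coe]
    calc b * (M ^ 2 * K) ≤ (2 * (M ^ 2 * K + 1))⁻¹ * (M ^ 2 * K + 1) := by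
          gcongr; exact le_self_add
      _ = 2⁻¹ := by field_simp
  set D : ℝ≥0 := 2 * d * M * 2 ^ (d - 2) with hD
  have hlace := fun k q => laceCoeff_succ_le (b : ℝ≥0∞) z hG hK hc hb1 k q
  set Jp : (Fin d → ℤ) → ℝ≥0∞ := fun q => ∑' j, laceCoeff d b z (2 * j) q with hJp
  set Jm : (Fin d → ℤ) → ℝ≥0∞ := fun q => ∑' j, laceCoeff d b z (2 * j + 1) q with hJm
  set Jr : (Fin d → ℤ) → ℝ≥0∞ := fun q => ∑' j, laceCoeff d b z (2 * (j + 1)) q with hJr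
  set B : (Fin d → ℤ) → ℝ≥0 := fun q => b * z * (2 * D) * decay q ^ (d + 4) with hB
  have hgeom : ∀ q, ∑' k, laceCoeff d b z (k + 1) q ≤ B q := fun q => by
    calc ∑' k, laceCoeff d b z (k + 1) q ≤ ∑' k, z * b * (D : ℝ≥0) *
          (decay q : ℝ≥0∞) ^ (3 * (d - 2)) * ((2⁻¹ : ℝ≥0) : ℝ≥0∞) ^ k :=
          ENNReal.tsum_le_tsum fun k => hlace k q
      _ = z * b * (D : ℝ≥0) * (decay q : ℝ≥0∞) ^ (3 * (d - 2)) * 2 := by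
          rw [ENNReal.tsum_mul_left, ENNReal.tsum_geometric]
          congr 1
          rw [ENNReal.coe_inv two_ne_zero]
          simp [ENNReal.one_sub_inv_two]
      _ ≤ z * b * (D : ℝ≥0) * (decay q : ℝ≥0∞) ^ (d + 4) * 2 := by
          refine mul_le_mul_left (mul_le_mul_right ?_ _) _
          exact pow_le_pow_of_le_one (zero_le)
            (by exact_mod_cast decay_le_one q) (by omega)
      _ = _ := by simp only [hB]; push_cast; ring
  have hmB : ∀ q, Jm q ≤ B q := fun q => by
    refine le_trans ?_ (hgeom q)
    exact ENNReal.tsum_comp_le_tsum_of_injective (f := fun j : ℕ => 2 * j)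
      (fun _ _ h => by simpa using h) fun k => laceCoeff d b z (k + 1) q
  have hrB : ∀ q, Jr q ≤ B q := fun q => by
    refine le_trans ?_ (hgeom q)
    exact ENNReal.tsum_comp_le_tsum_of_injective (f := fun j : ℕ => 2 * j + 1)
      (fun _ _ h => by simpa using h) fun k => laceCoeff d b z (k + 1) q
  have hp : ∀ q, Jp q = (z * stepCount d q : ℝ≥0) + Jr q := fun q => by
    simp only [hJp, hJr]
    rw [tsum_eq_zero_add' ENNReal.summable]
    congr 1
    simp only [laceCoeff, laceIter, stepCount]
    push_cast
    congr 1
    exact Finset.sum_congr rfl fun e _ => by split_ifs <;> simp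
  have hBle : ∀ q, B q ≤ b * z * (2 * D) := fun q =>
    mul_le_of_le_one_right' (pow_le_one' (decay_le_one q) _)
  have hNle : ∀ q, stepCount d q ≤ Fintype.card (Fin d × Bool) := fun q => by
    unfold stepCount
    refine (Finset.sum_le_card_nsmul _ _ 1 fun e _ => ?_).trans (by simp)
    split_ifs <;> simp
  set G : (Fin d → ℤ) → ℝ≥0∞ := fun x => greenE d b z x with hGdef
  have hGtop : ∀ x, G x ≠ ∞ := fun x => ENNReal.ne_top_of_tsum_ne_top hχ x
  have hconv : ∀ (F : (Fin d → ℤ) → ℝ≥0∞) (C : ℝ≥0), (∀ q, F q ≤ C) → ∀ x,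
      ∑' q, F q * G (x - q) ≠ ∞ := fun F C hF x => by
    refine ne_top_of_le_ne_top (ENNReal.mul_ne_top (ENNReal.coe_ne_top (r := C)) hχ) ?_
    rw [← ENNReal.tsum_mul_left, ← (Equiv.subLeft x).tsum_eq]
    refine ENNReal.tsum_le_tsum fun q => ?_
    simp only [Equiv.subLeft_apply, sub_sub_cancel]
    exact mul_le_mul_left (hF _) _
  have hpfin := hconv Jp (z * Fintype.card (Fin d × Bool) + b * z * (2 * D)) fun q => by
    rw [hp, ENNReal.coe_add]
    refine add_le_add ?_ ((hrB q).trans (ENNReal.coe_le_coe.2 (hBle q)))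
    rw [ENNReal.coe_le_coe]
    gcongr
    exact hNle q
  have hmfin := hconv Jm (b * z * (2 * D)) fun q => (hmB q).trans (ENNReal.coe_le_coe.2 (hBle q))
  have hmt : ∀ q, Jm q ≠ ∞ := fun q => ne_top_of_le_ne_top ENNReal.coe_ne_top (hmB q)
  have hrt : ∀ q, Jr q ≠ ∞ := fun q => ne_top_of_le_ne_top ENNReal.coe_ne_top (hrB q)
  have hpt : ∀ q, Jp q ≠ ∞ := fun q => by
    rw [hp]; exact ENNReal.add_ne_top.2 ⟨ENNReal.coe_ne_top, hrt q⟩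
  refine ⟨fun q => (Jp q).toReal - (Jm q).toReal, fun q => ?_, fun x => ?_⟩
  · have h1 : (Jp q).toReal = z * stepCount d q + (Jr q).toReal := by
      rw [hp, ENNReal.toReal_add ENNReal.coe_ne_top (hrt q)]
      simp
    have h2 : (Jr q).toReal ≤ B q := ENNReal.toReal_le_coe_of_le_coe (hrB q)
    have h3 : (Jm q).toReal ≤ B q := ENNReal.toReal_le_coe_of_le_coe (hmB q)
    have h4 := ENNReal.toReal_nonneg (a := Jr q)
    have h5 := ENNReal.toReal_nonneg (a := Jm q)
    have h6 : (B q : ℝ) = b * z * (2 * D) * (decay q : ℝ) ^ (d + 4) := by simp [hB]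
    rw [abs_le]
    push_cast at h6 ⊢
    rw [← h6]
    constructor <;> linarith
  · have h := congrArg ENNReal.toReal (greenE_add_tsum_odd (b : ℝ≥0∞) z x)
    rw [ENNReal.toReal_add (hGtop x) (hmfin x), ENNReal.toReal_add (by split_ifs <;> simp)
      (hpfin x), ENNReal.tsum_toReal_eq (ENNReal.ne_top_of_tsum_ne_top (hmfin x)),
      ENNReal.tsum_toReal_eq (ENNReal.ne_top_of_tsum_ne_top (hpfin x))] at h
    simp only [ENNReal.toReal_mul] at h
    simp only [sub_mul]
    rw [Summable.tsum_sub]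
    · have : ((if (0 : Fin d → ℤ) = x then 1 else 0 : ℝ≥0∞)).toReal =
        if (0 : Fin d → ℤ) = x then 1 else 0 := by split_ifs <;> simp
      rw [this] at h
      simp only [hGdef] at h ⊢
      linarith
    · simpa only [ENNReal.toReal_mul] using ENNReal.summable_toReal (hpfin x)
    · simpa only [ENNReal.toReal_mul] using ENNReal.summable_toReal (hmfin x)

end Kernel

section Profile

/-- The profile `u ^ (-p) * (u + ℓ) ^ (-q)`. -/
noncomputable def prof (ℓ p q u : ℝ) : ℝ := u ^ (-p) * (u + ℓ) ^ (-q)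

/-- The first derivative of the profile. -/
noncomputable def prof₁ (ℓ p q u : ℝ) : ℝ := -p * prof ℓ (p + 1) q u - q * prof ℓ p (q + 1) u

/-- The second derivative of the profile. -/
noncomputable def prof₂ (ℓ p q u : ℝ) : ℝ := -p * prof₁ ℓ (p + 1) q u - q * prof₁ ℓ p (q + 1) u

/-- The third derivative of the profile. -/
noncomputable def prof₃ (ℓ p q u : ℝ) : ℝ := -p * prof₂ ℓ (p + 1) q u - q * prof₂ ℓ p (q + 1) u

variable {ℓ p q u : ℝ}

lemma prof_pos (hℓ : 0 < ℓ) (hu : 0 < u) : 0 < prof ℓ p q u := by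
  unfold prof; positivity

lemma hasDerivAt_prof (hℓ : 0 < ℓ) (hu : 0 < u) : HasDerivAt (prof ℓ p q) (prof₁ ℓ p q u) u := by
  have h1 : HasDerivAt (fun v : ℝ => v ^ (-p)) (-p * u ^ (-p - 1)) u :=
    Real.hasDerivAt_rpow_const (Or.inl hu.ne')
  have h2 : HasDerivAt (fun v : ℝ => (v + ℓ) ^ (-q)) (1 * -q * (u + ℓ) ^ (-q - 1)) u :=
    ((hasDerivAt_id u).add_const ℓ).rpow_const (Or.inl (by simp; positivity))
  refine (h1.mul h2).congr_deriv ?_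
  unfold prof₁ prof
  rw [neg_add' p, neg_add' q]
  ring

lemma hasDerivAt_prof₁ (hℓ : 0 < ℓ) (hu : 0 < u) :
    HasDerivAt (prof₁ ℓ p q) (prof₂ ℓ p q u) u :=
  ((hasDerivAt_prof hℓ hu).const_mul (-p)).sub ((hasDerivAt_prof hℓ hu).const_mul q)

lemma hasDerivAt_prof₂ (hℓ : 0 < ℓ) (hu : 0 < u) :
    HasDerivAt (prof₂ ℓ p q) (prof₃ ℓ p q u) u :=
  ((hasDerivAt_prof₁ hℓ hu).const_mul (-p)).sub ((hasDerivAt_prof₁ hℓ hu).const_mul q)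

lemma prof_add_left (hu : 0 < u) (r : ℝ) : prof ℓ (p + r) q u = u ^ (-r) * prof ℓ p q u := by
  unfold prof
  rw [neg_add, Real.rpow_add hu]
  ring

lemma prof_succ_left (hu : 0 < u) : prof ℓ (p + 1) q u = u⁻¹ * prof ℓ p q u := by
  rw [prof_add_left hu, Real.rpow_neg_one]

lemma prof_succ_right (hℓ : 0 < ℓ) (hu : 0 < u) :
    prof ℓ p (q + 1) u = (u + ℓ)⁻¹ * prof ℓ p q u := by
  unfold prof
  rw [neg_add, Real.rpow_add (by positivity), Real.rpow_neg_one]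
  ring

lemma prof_succ_right_le (hℓ : 0 < ℓ) (hu : 0 < u) :
    prof ℓ p (q + 1) u ≤ u⁻¹ * prof ℓ p q u := by
  rw [prof_succ_right hℓ hu]
  have := prof_pos (p := p) (q := q) hℓ hu
  gcongr
  linarith

lemma abs_prof₁_le (hℓ : 0 < ℓ) (hu : 0 < u) (hp : 0 ≤ p) (hq : 0 ≤ q) :
    |prof₁ ℓ p q u| ≤ (p + q) * u⁻¹ * prof ℓ p q u := by
  have h1 := prof_pos (p := p + 1) (q := q) hℓ hu
  have h2 := prof_pos (p := p) (q := q + 1) hℓ hu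
  have h3 := prof_succ_left (ℓ := ℓ) (p := p) (q := q) hu
  have h4 := prof_succ_right_le (p := p) (q := q) hℓ hu
  have h5 : |prof₁ ℓ p q u| = p * prof ℓ (p + 1) q u + q * prof ℓ p (q + 1) u := by
    rw [prof₁, abs_of_nonpos (by nlinarith [mul_nonneg hp h1.le, mul_nonneg hq h2.le])]; ring
  rw [h5]
  calc _ ≤ p * (u⁻¹ * prof ℓ p q u) + q * (u⁻¹ * prof ℓ p q u) := by
        rw [h3]; gcongr
    _ = _ := by ring

lemma abs_prof₂_le (hℓ : 0 < ℓ) (hu : 0 < u) (hp : 0 ≤ p) (hq : 0 ≤ q) :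
    |prof₂ ℓ p q u| ≤ (p + q) * (p + q + 1) * (u⁻¹) ^ 2 * prof ℓ p q u := by
  have h3 := prof_succ_left (ℓ := ℓ) (p := p) (q := q) hu
  have h4 := prof_succ_right_le (p := p) (q := q) hℓ hu
  have h5 := abs_prof₁_le hℓ hu (p := p + 1) (q := q) (by positivity) hq
  have h6 := abs_prof₁_le hℓ hu (p := p) (q := q + 1) hp (by positivity)
  calc |prof₂ ℓ p q u| ≤ |-p * prof₁ ℓ (p + 1) q u| + |q * prof₁ ℓ p (q + 1) u| := abs_sub _ _
    _ = p * |prof₁ ℓ (p + 1) q u| + q * |prof₁ ℓ p (q + 1) u| := by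
      rw [abs_mul, abs_mul, abs_neg, abs_of_nonneg hp, abs_of_nonneg hq]
    _ ≤ p * ((p + 1 + q) * u⁻¹ * prof ℓ (p + 1) q u) +
        q * ((p + (q + 1)) * u⁻¹ * prof ℓ p (q + 1) u) := by gcongr
    _ ≤ p * ((p + 1 + q) * u⁻¹ * (u⁻¹ * prof ℓ p q u)) +
        q * ((p + (q + 1)) * u⁻¹ * (u⁻¹ * prof ℓ p q u)) := by rw [h3]; gcongr
    _ = _ := by ring

lemma abs_prof₃_le (hℓ : 0 < ℓ) (hu : 0 < u) (hp : 0 ≤ p) (hq : 0 ≤ q) :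
    |prof₃ ℓ p q u| ≤ (p + q) * (p + q + 1) * (p + q + 2) * (u⁻¹) ^ 3 * prof ℓ p q u := by
  have h3 := prof_succ_left (ℓ := ℓ) (p := p) (q := q) hu
  have h4 := prof_succ_right_le (p := p) (q := q) hℓ hu
  have h5 := abs_prof₂_le hℓ hu (p := p + 1) (q := q) (by positivity) hq
  have h6 := abs_prof₂_le hℓ hu (p := p) (q := q + 1) hp (by positivity)
  calc |prof₃ ℓ p q u| ≤ |-p * prof₂ ℓ (p + 1) q u| + |q * prof₂ ℓ p (q + 1) u| := abs_sub _ _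
    _ = p * |prof₂ ℓ (p + 1) q u| + q * |prof₂ ℓ p (q + 1) u| := by
      rw [abs_mul, abs_mul, abs_neg, abs_of_nonneg hp, abs_of_nonneg hq]
    _ ≤ p * ((p + 1 + q) * (p + 1 + q + 1) * u⁻¹ ^ 2 * prof ℓ (p + 1) q u) +
        q * ((p + (q + 1)) * (p + (q + 1) + 1) * u⁻¹ ^ 2 * prof ℓ p (q + 1) u) := by gcongr
    _ ≤ p * ((p + 1 + q) * (p + 1 + q + 1) * u⁻¹ ^ 2 * (u⁻¹ * prof ℓ p q u)) +
        q * ((p + (q + 1)) * (p + (q + 1) + 1) * u⁻¹ ^ 2 * (u⁻¹ * prof ℓ p q u)) := by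
      rw [h3]; gcongr
    _ = _ := by ring

lemma prof_le_of_quarter_le {v : ℝ} (hℓ : 0 < ℓ) (hu : 0 < u) (hp : 0 ≤ p) (hq : 0 ≤ q)
    (h : u / 4 ≤ v) : prof ℓ p q v ≤ 4 ^ (p + q) * prof ℓ p q u := by
  have h1 : v ^ (-p) ≤ 4 ^ p * u ^ (-p) := by
    calc v ^ (-p) ≤ (u / 4) ^ (-p) :=
          Real.rpow_le_rpow_of_nonpos (by positivity) h (by linarith)
      _ = _ := by
          rw [Real.div_rpow hu.le (by norm_num), Real.rpow_neg (by norm_num : (0 : ℝ) ≤ 4)]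
          field_simp
  have h2 : (v + ℓ) ^ (-q) ≤ 4 ^ q * (u + ℓ) ^ (-q) := by
    calc (v + ℓ) ^ (-q) ≤ ((u + ℓ) / 4) ^ (-q) :=
          Real.rpow_le_rpow_of_nonpos (by positivity) (by linarith) (by linarith)
      _ = _ := by
          rw [Real.div_rpow (by positivity) (by norm_num),
            Real.rpow_neg (by norm_num : (0 : ℝ) ≤ 4)]
          field_simp
  unfold prof
  rw [Real.rpow_add (by norm_num)]
  have : 0 < v := by linarith
  calc v ^ (-p) * (v + ℓ) ^ (-q) ≤ (4 ^ p * u ^ (-p)) * (4 ^ q * (u + ℓ) ^ (-q)) := by gcongr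
    _ = _ := by ring

/-- A crude second-order Taylor estimate on the unit interval. -/
lemma abs_taylor_two_le {k k₁ k₂ k₃ : ℝ → ℝ} {B : ℝ}
    (h₀ : ∀ t ∈ Set.Icc (0 : ℝ) 1, HasDerivAt k (k₁ t) t)
    (h₁ : ∀ t ∈ Set.Icc (0 : ℝ) 1, HasDerivAt k₁ (k₂ t) t)
    (h₂ : ∀ t ∈ Set.Icc (0 : ℝ) 1, HasDerivAt k₂ (k₃ t) t)
    (hB : ∀ t ∈ Set.Icc (0 : ℝ) 1, |k₃ t| ≤ B) :
    |k 1 - k 0 - k₁ 0 - k₂ 0 / 2| ≤ B := by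
  have hB0 : 0 ≤ B := (abs_nonneg _).trans (hB 0 (by simp))
  have step : ∀ {f f' : ℝ → ℝ}, (∀ t ∈ Set.Icc (0 : ℝ) 1, HasDerivAt f (f' t) t) →
      (∀ t ∈ Set.Icc (0 : ℝ) 1, |f' t| ≤ B) → ∀ t ∈ Set.Icc (0 : ℝ) 1, |f t - f 0| ≤ B := by
    intro f f' hf hf' t ht
    have := norm_image_sub_le_of_norm_deriv_le_segment' (f := f) (f' := f') (C := B)
      (fun x hx => (hf x hx).hasDerivWithinAt) (fun x hx => hf' x ⟨hx.1, hx.2.le⟩) t ht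
    rw [Real.norm_eq_abs] at this
    refine this.trans ?_
    nlinarith [ht.1, ht.2]
  have s2 := step h₂ hB
  have s1 := step (f := fun t => k₁ t - k₂ 0 * t) (f' := fun t => k₂ t - k₂ 0)
    (fun t ht => by
      refine ((h₁ t ht).sub ((hasDerivAt_id t).const_mul (k₂ 0))).congr_deriv ?_
      simp) s2
  have s0 := step (f := fun t => k t - k₁ 0 * t - k₂ 0 / 2 * t ^ 2)
    (f' := fun t => k₁ t - k₂ 0 * t - k₁ 0)
    (fun t ht => by
      refine (((h₀ t ht).sub ((hasDerivAt_id t).const_mul (k₁ 0))).sub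
        ((hasDerivAt_pow 2 t).const_mul (k₂ 0 / 2))).congr_deriv ?_
      simp; ring) (fun t ht => by simpa using s1 t ht) 1 (by simp)
  simpa [sub_sub, add_assoc, add_comm, add_left_comm] using s0

lemma prof_taylor_far {B S s β : ℝ} (hB0 : 0 ≤ B) (hℓ : 0 < ℓ) (hS : 0 < S) (hs : 0 ≤ s)
    (hβ : |β| ≤ s * S) (hM : 0 < S ^ 2 + 2 * β + s ^ 2) (hfar : S < 2 * s)
    (b1 : ∀ u : ℝ, 0 < u → |prof₁ ℓ p q u| ≤ B * u⁻¹ * prof ℓ p q u)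
    (b2 : ∀ u : ℝ, 0 < u → |prof₂ ℓ p q u| ≤ B * u⁻¹ ^ 2 * prof ℓ p q u) :
    |prof ℓ p q (S ^ 2 + 2 * β + s ^ 2) - prof ℓ p q (S ^ 2) - 2 * β * prof₁ ℓ p q (S ^ 2) -
      (2 * β ^ 2 * prof₂ ℓ p q (S ^ 2) + s ^ 2 * prof₁ ℓ p q (S ^ 2))| ≤
      (8 + 14 * B) * (s / S) ^ 3 * prof ℓ p q (S ^ 2) + prof ℓ p q (S ^ 2 + 2 * β + s ^ 2) := by
  have hβ2 : β ^ 2 ≤ s ^ 2 * S ^ 2 := by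
    rw [← mul_pow, ← sq_abs]; gcongr
  have hr : 1 / 2 < s / S := by rw [lt_div_iff₀ hS]; linarith
  have hP := prof_pos (p := p) (q := q) hℓ (u := S ^ 2) (by positivity)
  set P := prof ℓ p q (S ^ 2)
  set r := s / S with hrdef
  have hsr : s = r * S := by rw [hrdef]; field_simp
  have hPM := prof_pos (p := p) (q := q) hℓ hM
  have c1 := b1 (S ^ 2) (by positivity)
  have c2 := b2 (S ^ 2) (by positivity)
  have t1 : |2 * β * prof₁ ℓ p q (S ^ 2)| ≤ 2 * B * r * P := by
    rw [abs_mul, abs_mul, abs_two]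
    calc _ ≤ 2 * (s * S) * (B * (S ^ 2)⁻¹ * P) := by gcongr
      _ = _ := by rw [hsr]; field_simp
  have t2 : |2 * β ^ 2 * prof₂ ℓ p q (S ^ 2)| ≤ 2 * B * r ^ 2 * P := by
    rw [abs_mul, abs_mul, abs_two, abs_of_nonneg (sq_nonneg β)]
    calc _ ≤ 2 * (s ^ 2 * S ^ 2) * (B * (S ^ 2)⁻¹ ^ 2 * P) := by gcongr
      _ = _ := by rw [hsr]; field_simp
  have t3 : |s ^ 2 * prof₁ ℓ p q (S ^ 2)| ≤ B * r ^ 2 * P := by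
    rw [abs_mul, abs_of_nonneg (sq_nonneg s)]
    calc _ ≤ s ^ 2 * (B * (S ^ 2)⁻¹ * P) := by gcongr
      _ = _ := by rw [hsr]; field_simp
  have r1 : 1 ≤ 8 * r ^ 3 := by nlinarith [sq_nonneg (r - 1 / 2), sq_nonneg r]
  have r2 : r ≤ 4 * r ^ 3 := by nlinarith [sq_nonneg (r - 1 / 2), sq_nonneg r]
  have r3 : r ^ 2 ≤ 2 * r ^ 3 := by nlinarith [sq_nonneg r]
  have k1 : P ≤ 8 * r ^ 3 * P := le_mul_of_one_le_left hP.le r1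
  have k2 : 2 * B * r * P ≤ 2 * B * (4 * r ^ 3) * P := by gcongr
  have k3 : 2 * B * r ^ 2 * P ≤ 2 * B * (2 * r ^ 3) * P := by gcongr
  have k4 : B * r ^ 2 * P ≤ B * (2 * r ^ 3) * P := by gcongr
  have k5 : (8 + 14 * B) * r ^ 3 * P = 8 * r ^ 3 * P + 2 * B * (4 * r ^ 3) * P +
      2 * B * (2 * r ^ 3) * P + B * (2 * r ^ 3) * P := by ring
  rw [k5]
  rw [abs_le] at t1 t2 t3 ⊢
  constructor <;> linarith [t1.1, t1.2, t2.1, t2.2, t3.1, t3.2]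

lemma prof_taylor_near {B S s β : ℝ} (hp : 0 ≤ p) (hq : 0 ≤ q) (hB0 : 0 ≤ B) (hℓ : 0 < ℓ)
    (hS : 0 < S) (hs : 0 ≤ s) (hβ : |β| ≤ s * S) (hfar : ¬ S < 2 * s)
    (b2 : ∀ u : ℝ, 0 < u → |prof₂ ℓ p q u| ≤ B * u⁻¹ ^ 2 * prof ℓ p q u)
    (b3 : ∀ u : ℝ, 0 < u → |prof₃ ℓ p q u| ≤ B * u⁻¹ ^ 3 * prof ℓ p q u) :
    |prof ℓ p q (S ^ 2 + 2 * β + s ^ 2) - prof ℓ p q (S ^ 2) - 2 * β * prof₁ ℓ p q (S ^ 2) -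
      (2 * β ^ 2 * prof₂ ℓ p q (S ^ 2) + s ^ 2 * prof₁ ℓ p q (S ^ 2))| ≤
      160 * B * 4 ^ (p + q) * (s / S) ^ 3 * prof ℓ p q (S ^ 2) := by
  push Not at hfar
  have hu : ∀ t ∈ Set.Icc (0 : ℝ) 1, S ^ 2 / 4 ≤ S ^ 2 + 2 * t * β + t ^ 2 * s ^ 2 := by
    intro t ht
    have h1 : -(s * S) ≤ β := (abs_le.1 hβ).1
    have h2 : S / 2 ≤ S - t * s := by nlinarith [ht.1, ht.2]
    nlinarith [ht.1, ht.2, mul_le_mul_of_nonneg_left h1 ht.1]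
  have hu' : ∀ t ∈ Set.Icc (0 : ℝ) 1, 0 < S ^ 2 + 2 * t * β + t ^ 2 * s ^ 2 := fun t ht =>
    lt_of_lt_of_le (by positivity) (hu t ht)
  have hd : ∀ t : ℝ, HasDerivAt (fun t : ℝ => S ^ 2 + 2 * t * β + t ^ 2 * s ^ 2)
      (2 * β + 2 * t * s ^ 2) t := fun t => by
    refine (((((hasDerivAt_id t).const_mul 2).mul_const β).const_add (S ^ 2)).add
      ((hasDerivAt_pow 2 t).mul_const (s ^ 2))).congr_deriv ?_
    simp
  have hd' : ∀ t : ℝ, HasDerivAt (fun t : ℝ => 2 * β + 2 * t * s ^ 2) (2 * s ^ 2) t :=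
      fun t => by
    refine ((((hasDerivAt_id t).const_mul 2).mul_const (s ^ 2)).const_add
      (2 * β)).congr_deriv ?_
    simp
  have hc : ∀ f f' : ℝ → ℝ, (∀ v, 0 < v → HasDerivAt f (f' v) v) → ∀ t ∈ Set.Icc (0 : ℝ) 1,
      HasDerivAt (fun t => f (S ^ 2 + 2 * t * β + t ^ 2 * s ^ 2))
        (f' (S ^ 2 + 2 * t * β + t ^ 2 * s ^ 2) * (2 * β + 2 * t * s ^ 2)) t :=
    fun f f' hf t ht => (hf _ (hu' t ht)).comp t (hd t)
  have hβ2 : β ^ 2 ≤ s ^ 2 * S ^ 2 := by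
    rw [← mul_pow, ← sq_abs]; gcongr
  have key := abs_taylor_two_le
    (k := fun t => prof ℓ p q (S ^ 2 + 2 * t * β + t ^ 2 * s ^ 2))
    (k₁ := fun t => prof₁ ℓ p q (S ^ 2 + 2 * t * β + t ^ 2 * s ^ 2) * (2 * β + 2 * t * s ^ 2))
    (k₂ := fun t => prof₂ ℓ p q (S ^ 2 + 2 * t * β + t ^ 2 * s ^ 2) *
      (2 * β + 2 * t * s ^ 2) * (2 * β + 2 * t * s ^ 2) +
      prof₁ ℓ p q (S ^ 2 + 2 * t * β + t ^ 2 * s ^ 2) * (2 * s ^ 2))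
    (k₃ := fun t => (prof₃ ℓ p q (S ^ 2 + 2 * t * β + t ^ 2 * s ^ 2) *
      (2 * β + 2 * t * s ^ 2) * (2 * β + 2 * t * s ^ 2) +
        prof₂ ℓ p q (S ^ 2 + 2 * t * β + t ^ 2 * s ^ 2) * (2 * s ^ 2)) *
        (2 * β + 2 * t * s ^ 2) + prof₂ ℓ p q (S ^ 2 + 2 * t * β + t ^ 2 * s ^ 2) *
      (2 * β + 2 * t * s ^ 2) * (2 * s ^ 2) +
      prof₂ ℓ p q (S ^ 2 + 2 * t * β + t ^ 2 * s ^ 2) * (2 * β + 2 * t * s ^ 2) *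
        (2 * s ^ 2)) (B := 160 * B * 4 ^ (p + q) * (s / S) ^ 3 * prof ℓ p q (S ^ 2))
    (hc _ _ fun v hv => hasDerivAt_prof hℓ hv)
    (fun t ht => (hc _ _ (fun v hv => hasDerivAt_prof₁ hℓ hv) t ht).mul (hd' t))
    (fun t ht => (((hc _ _ (fun v hv => hasDerivAt_prof₂ hℓ hv) t ht).mul (hd' t)).mul
      (hd' t)).add ((hc _ _ (fun v hv => hasDerivAt_prof₁ hℓ hv) t ht).mul_const (2 * s ^ 2)))
    (fun t ht => by
      have hut := hu t ht
      have hut' := hu' t ht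
      set v := S ^ 2 + 2 * t * β + t ^ 2 * s ^ 2 with hv
      have e1 : (2 * β + 2 * t * s ^ 2) ^ 2 ≤ 4 * s ^ 2 * v := by rw [hv]; nlinarith
      generalize 2 * β + 2 * t * s ^ 2 = y at e1 ⊢
      clear_value v
      set V := √v with hV
      have hVv : v = V ^ 2 := (Real.sq_sqrt hut'.le).symm
      have hV0 : 0 < V := Real.sqrt_pos.2 hut'
      have e2 : |y| ≤ 2 * s * V := abs_le_of_sq_le_sq (by rw [hVv] at e1; nlinarith)
        (by positivity)
      have e3 : S ≤ 2 * V := by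
        refine abs_le_of_sq_le_sq' (a := S) ?_ (by positivity) |>.2
        rw [hVv] at hut; nlinarith
      have e4 : |prof₃ ℓ p q v| ≤ B * v⁻¹ ^ 3 * prof ℓ p q v := b3 v hut'
      have e5 : |prof₂ ℓ p q v| ≤ B * v⁻¹ ^ 2 * prof ℓ p q v := b2 v hut'
      have e6 := prof_le_of_quarter_le hℓ (by positivity) hp hq hut
      have e7 := prof_pos (p := p) (q := q) hℓ hut'
      have e8 : V⁻¹ ≤ 2 * S⁻¹ := by
        rw [inv_le_iff_one_le_mul₀ hV0]
        calc (1 : ℝ) = S⁻¹ * S := (inv_mul_cancel₀ hS.ne').symm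
          _ ≤ S⁻¹ * (2 * V) := by gcongr
          _ = _ := by ring
      have e9 : (prof₃ ℓ p q v * y * y + prof₂ ℓ p q v * (2 * s ^ 2)) * y +
          prof₂ ℓ p q v * y * (2 * s ^ 2) + prof₂ ℓ p q v * y * (2 * s ^ 2) =
          prof₃ ℓ p q v * y ^ 3 + prof₂ ℓ p q v * (6 * s ^ 2 * y) := by ring
      rw [e9]
      calc _ ≤ |prof₃ ℓ p q v * y ^ 3| + |prof₂ ℓ p q v * (6 * s ^ 2 * y)| := abs_add_le _ _
        _ = |prof₃ ℓ p q v| * |y| ^ 3 + |prof₂ ℓ p q v| * (6 * s ^ 2 * |y|) := by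
          rw [abs_mul, abs_mul, abs_pow, abs_mul (6 * s ^ 2), abs_of_nonneg (by positivity :
            0 ≤ 6 * s ^ 2)]
        _ ≤ (B * v⁻¹ ^ 3 * prof ℓ p q v) * (2 * s * V) ^ 3 +
            (B * v⁻¹ ^ 2 * prof ℓ p q v) * (6 * s ^ 2 * (2 * s * V)) := by gcongr
        _ = 20 * B * s ^ 3 * V⁻¹ ^ 3 * prof ℓ p q v := by
          nth_rewrite 1 [hVv]; nth_rewrite 2 [hVv]; field_simp; ring
        _ ≤ 20 * B * s ^ 3 * (2 * S⁻¹) ^ 3 * (4 ^ (p + q) * prof ℓ p q (S ^ 2)) := by gcongr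
        _ = _ := by rw [div_pow]; field_simp; ring)
  refine le_trans (le_of_eq ?_) key
  congr 1
  simp only [mul_one, mul_zero, zero_mul, add_zero, one_pow, one_mul, ne_eq, OfNat.ofNat_ne_zero,
    not_false_eq_true, zero_pow]
  ring

lemma exists_prof_taylor (hp : 0 ≤ p) (hq : 0 ≤ q) : ∃ C : ℝ, 0 ≤ C ∧
    ∀ ℓ S s β : ℝ, 0 < ℓ → 0 < S → 0 ≤ s → |β| ≤ s * S → 0 < S ^ 2 + 2 * β + s ^ 2 →
      |prof ℓ p q (S ^ 2 + 2 * β + s ^ 2) - prof ℓ p q (S ^ 2) - 2 * β * prof₁ ℓ p q (S ^ 2) -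
        (2 * β ^ 2 * prof₂ ℓ p q (S ^ 2) + s ^ 2 * prof₁ ℓ p q (S ^ 2))| ≤
      C * (s / S) ^ 3 * prof ℓ p q (S ^ 2) +
        if S < 2 * s then prof ℓ p q (S ^ 2 + 2 * β + s ^ 2) else 0 := by
  set B := (p + q + 1) * (p + q + 1) * (p + q + 2) with hB
  have hB0 : 0 ≤ B := by positivity
  refine ⟨160 * B * 4 ^ (p + q) + 8 + 14 * B, by positivity, ?_⟩
  intro ℓ S s β hℓ hS hs hβ hM
  have hP := prof_pos (p := p) (q := q) hℓ (u := S ^ 2) (by positivity)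
  have b1 : ∀ u : ℝ, 0 < u → |prof₁ ℓ p q u| ≤ B * u⁻¹ * prof ℓ p q u := fun u hu => by
    refine (abs_prof₁_le hℓ hu hp hq).trans ?_
    have := prof_pos (p := p) (q := q) hℓ hu
    gcongr
    rw [hB]; nlinarith [mul_nonneg (add_nonneg hp hq) (add_nonneg hp hq), add_nonneg hp hq]
  have b2 : ∀ u : ℝ, 0 < u → |prof₂ ℓ p q u| ≤ B * u⁻¹ ^ 2 * prof ℓ p q u := fun u hu => by
    refine (abs_prof₂_le hℓ hu hp hq).trans ?_
    have := prof_pos (p := p) (q := q) hℓ hu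
    have h0 := add_nonneg hp hq
    gcongr
    rw [hB]
    generalize p + q = x at h0
    nlinarith [mul_nonneg h0 h0, mul_nonneg (mul_nonneg h0 h0) h0]
  have b3 : ∀ u : ℝ, 0 < u → |prof₃ ℓ p q u| ≤ B * u⁻¹ ^ 3 * prof ℓ p q u := fun u hu => by
    refine (abs_prof₃_le hℓ hu hp hq).trans ?_
    have := prof_pos (p := p) (q := q) hℓ hu
    have h0 := add_nonneg hp hq
    gcongr
    rw [hB]
    generalize p + q = x at h0
    nlinarith [mul_nonneg h0 h0, mul_nonneg (mul_nonneg h0 h0) h0]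
  clear_value B
  have hr3 : 0 ≤ (s / S) ^ 3 * prof ℓ p q (S ^ 2) := by positivity
  have e4 : (0 : ℝ) ≤ 160 * B * 4 ^ (p + q) := by positivity
  split_ifs with hfar
  · refine (prof_taylor_far hB0 hℓ hS hs hβ hM hfar b1 b2).trans ?_
    gcongr
    linarith
  · rw [add_zero]
    refine (prof_taylor_near hp hq hB0 hℓ hS hs hβ hfar b2 b3).trans ?_
    gcongr
    linarith

end Profile

section Moments

variable {d : ℕ}

/-- The squared Euclidean norm on the lattice. -/
def sqNorm (x : Fin d → ℤ) : ℝ := ∑ i, (x i : ℝ) ^ 2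

lemma sqNorm_nonneg (x : Fin d → ℤ) : 0 ≤ sqNorm x := Finset.sum_nonneg fun _ _ => sq_nonneg _

lemma abs_coord_le_norm (x : Fin d → ℤ) (i : Fin d) : |(x i : ℝ)| ≤ ‖x‖ := by
  simpa [Int.norm_eq_abs] using norm_le_pi_norm x i

lemma coe_decay (x : Fin d → ℤ) : (decay x : ℝ) = (1 + ‖x‖)⁻¹ := by simp [decay]

lemma abs_coord_mul_decay_le (x : Fin d → ℤ) (i : Fin d) : |(x i : ℝ)| * decay x ≤ 1 := by
  rw [coe_decay, ← div_eq_mul_inv, div_le_one (by positivity)]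
  linarith [abs_coord_le_norm x i]

lemma sq_norm_le_sqNorm (x : Fin d → ℤ) : ‖x‖ ^ 2 ≤ sqNorm x := by
  have h : ‖x‖ ≤ √(sqNorm x) := by
    rw [pi_norm_le_iff_of_nonneg (Real.sqrt_nonneg _)]
    intro i
    rw [Int.norm_eq_abs]
    exact Real.abs_le_sqrt (Finset.single_le_sum (f := fun i => (x i : ℝ) ^ 2)
      (fun i _ => sq_nonneg _) (Finset.mem_univ i))
  calc ‖x‖ ^ 2 ≤ √(sqNorm x) ^ 2 := by gcongr
    _ = _ := Real.sq_sqrt (sqNorm_nonneg x)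

lemma sqNorm_le (x : Fin d → ℤ) : sqNorm x ≤ d * ‖x‖ ^ 2 := by
  calc sqNorm x ≤ ∑ _i : Fin d, ‖x‖ ^ 2 := Finset.sum_le_sum fun i _ => by
        rw [← sq_abs]; gcongr; exact abs_coord_le_norm x i
    _ = _ := by simp

lemma sqrt_sqNorm_le (x : Fin d → ℤ) : √(sqNorm x) ≤ d * ‖x‖ := by
  rcases Nat.eq_zero_or_pos d with rfl | hd
  · simp [sqNorm]
  refine Real.sqrt_le_iff.2 ⟨by positivity, (sqNorm_le x).trans ?_⟩
  rw [mul_pow]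
  gcongr
  exact le_self_pow₀ (by exact_mod_cast hd) two_ne_zero

lemma sqrt_sqNorm_mul_decay_le (x : Fin d → ℤ) : √(sqNorm x) * decay x ≤ d := by
  rw [coe_decay, ← div_eq_mul_inv, div_le_iff₀ (by positivity)]
  have : (0 : ℝ) ≤ d := by positivity
  nlinarith [sqrt_sqNorm_le x]

lemma sqNorm_sub (x w : Fin d → ℤ) :
    sqNorm (x - w) = sqNorm x + 2 * (-∑ i, (x i : ℝ) * w i) + sqNorm w := by
  simp only [sqNorm, Pi.sub_apply, Int.cast_sub, ← Finset.sum_neg_distrib, Finset.mul_sum,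
    ← Finset.sum_add_distrib]
  exact Finset.sum_congr rfl fun i _ => by ring

lemma sq_inner_le (x w : Fin d → ℤ) :
    (∑ i, (x i : ℝ) * w i) ^ 2 ≤ sqNorm x * sqNorm w :=
  Finset.sum_mul_sq_le_sq_mul_sq _ _ _

lemma exists_summable_decay (hd : 2 < d) : ∃ K : ℝ, 0 ≤ K ∧ ∀ p : ℕ, d + 1 ≤ p →
    Summable (fun u : Fin d → ℤ => (decay u : ℝ) ^ p) ∧
      ∑' u : Fin d → ℤ, (decay u : ℝ) ^ p ≤ K := by
  obtain ⟨K, hK⟩ := exists_tsum_decay_le hd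
  refine ⟨K, K.2, fun p hp => ?_⟩
  have h := hK p hp
  simp_rw [← ENNReal.coe_pow] at h
  have h' : Summable (fun u : Fin d → ℤ => decay u ^ p) :=
    ENNReal.tsum_coe_ne_top_iff_summable.1 (ne_top_of_le_ne_top ENNReal.coe_ne_top h)
  rw [← ENNReal.coe_tsum h', ENNReal.coe_le_coe] at h
  refine ⟨by exact_mod_cast NNReal.summable_coe.2 h', ?_⟩
  calc _ = ((∑' u : Fin d → ℤ, decay u ^ p : ℝ≥0) : ℝ) := by push_cast; rfl
    _ ≤ K := by exact_mod_cast h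

variable {J : (Fin d → ℤ) → ℝ} {J₀ : ℝ}

lemma summable_of_decay_bound (hd : 2 < d) {f : (Fin d → ℤ) → ℝ} {c : ℝ} {p : ℕ} (hp : d + 1 ≤ p)
    (hf : ∀ w, |f w| ≤ c * (decay w : ℝ) ^ p) : Summable f := by
  obtain ⟨K, -, hK⟩ := exists_summable_decay hd
  exact ((hK p hp).1.mul_left c).of_norm_bounded hf

lemma abs_mul_coord_le (hJ : ∀ w, |J w| ≤ J₀ * (decay w : ℝ) ^ (d + 4)) (i : Fin d)
    (w : Fin d → ℤ) : |J w * w i| ≤ J₀ * (decay w : ℝ) ^ (d + 3) := by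
  have hJ₀ : 0 ≤ J₀ * (decay w : ℝ) ^ (d + 4) := (abs_nonneg _).trans (hJ w)
  have hw : (0 : ℝ) < decay w := by exact_mod_cast decay_pos w
  have hJ1 : 0 ≤ J₀ := nonneg_of_mul_nonneg_left hJ₀ (by positivity)
  rw [abs_mul]
  calc _ ≤ J₀ * (decay w : ℝ) ^ (d + 4) * |(w i : ℝ)| := by gcongr; exact hJ w
    _ = J₀ * (decay w : ℝ) ^ (d + 3) * (|(w i : ℝ)| * decay w) := by ring
    _ ≤ J₀ * (decay w : ℝ) ^ (d + 3) * 1 := by gcongr; exact abs_coord_mul_decay_le w i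
    _ = _ := mul_one _

lemma abs_mul_coord_mul_le (hJ : ∀ w, |J w| ≤ J₀ * (decay w : ℝ) ^ (d + 4)) (i k : Fin d)
    (w : Fin d → ℤ) : |J w * (w i * w k)| ≤ J₀ * (decay w : ℝ) ^ (d + 2) := by
  have h := abs_mul_coord_le hJ i w
  have hw : (0 : ℝ) < decay w := by exact_mod_cast decay_pos w
  have hJ₀ : 0 ≤ J₀ * (decay w : ℝ) ^ (d + 3) := (abs_nonneg _).trans h
  have hJ1 : 0 ≤ J₀ := nonneg_of_mul_nonneg_left hJ₀ (by positivity)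
  rw [← mul_assoc, abs_mul]
  calc _ ≤ J₀ * (decay w : ℝ) ^ (d + 3) * |(w k : ℝ)| := by gcongr
    _ = J₀ * (decay w : ℝ) ^ (d + 2) * (|(w k : ℝ)| * decay w) := by ring
    _ ≤ J₀ * (decay w : ℝ) ^ (d + 2) * 1 := by gcongr; exact abs_coord_mul_decay_le w k
    _ = _ := mul_one _

lemma abs_mul_sqNorm_le (hJ : ∀ w, |J w| ≤ J₀ * (decay w : ℝ) ^ (d + 4)) (w : Fin d → ℤ) :
    |J w * sqNorm w| ≤ J₀ * d * (decay w : ℝ) ^ (d + 2) := by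
  rw [sqNorm, Finset.mul_sum]
  calc _ ≤ ∑ i, |J w * (w i : ℝ) ^ 2| := Finset.abs_sum_le_sum_abs _ _
    _ ≤ ∑ _i : Fin d, J₀ * (decay w : ℝ) ^ (d + 2) := Finset.sum_le_sum fun i _ => by
      rw [sq]; exact abs_mul_coord_mul_le hJ i i w
    _ = _ := by simp; ring

lemma tsum_mul_inner_eq_zero (hneg : ∀ w, J (-w) = J w) (x : Fin d → ℤ) :
    ∑' w, J w * ∑ i, (x i : ℝ) * w i = 0 := by
  have h : ∑' w, J w * ∑ i, (x i : ℝ) * w i = -∑' w, J w * ∑ i, (x i : ℝ) * w i := by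
    rw [← tsum_neg, ← (Equiv.neg (Fin d → ℤ)).tsum_eq]
    exact tsum_congr fun w => by simp [hneg]
  linarith

lemma tsum_mul_coord_mul_eq_zero (hflip : ∀ i w, J (coordFlip i w) = J w) {i k : Fin d}
    (hik : i ≠ k) : ∑' w : Fin d → ℤ, J w * (w i * w k : ℝ) = 0 := by
  have h : ∑' w : Fin d → ℤ, J w * (w i * w k : ℝ) = -∑' w : Fin d → ℤ, J w * (w i * w k : ℝ) := by
    rw [← tsum_neg, ← (coordFlip i).toEquiv.tsum_eq]
    refine tsum_congr fun w => ?_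
    have h1 : coordFlip i w i = -w i := by simp [coordFlip]
    have h2 : coordFlip i w k = w k := by simp [coordFlip, hik.symm]
    simp only [AddEquiv.toEquiv_eq_coe, EquivLike.coe_coe, hflip, h1, h2]
    push_cast; ring
  linarith

lemma tsum_mul_sqNorm_eq (hd : 2 < d) (hJ : ∀ w, |J w| ≤ J₀ * (decay w : ℝ) ^ (d + 4))
    (hswap : ∀ i k w, J (coordSwap i k w) = J w) (i : Fin d) :
    ∑' w : Fin d → ℤ, J w * (w i * w i : ℝ) = (∑' w, J w * sqNorm w) / d := by
  have hs : ∀ i : Fin d, Summable fun w : Fin d → ℤ => J w * (w i * w i : ℝ) := fun i =>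
    summable_of_decay_bound hd (by omega) (abs_mul_coord_mul_le hJ i i)
  have h1 : ∀ k : Fin d, ∑' w : Fin d → ℤ, J w * (w k * w k : ℝ) =
      ∑' w : Fin d → ℤ, J w * (w i * w i : ℝ) := fun k => by
    rw [← (coordSwap i k).toEquiv.tsum_eq]
    refine tsum_congr fun w => ?_
    have h1 : coordSwap i k w k = w i := by simp [coordSwap]
    simp only [AddEquiv.toEquiv_eq_coe, EquivLike.coe_coe, hswap, h1]
  have h2 : ∑' w, J w * sqNorm w = ∑ _k : Fin d, ∑' w : Fin d → ℤ, J w * (w i * w i : ℝ) := by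
    rw [← Finset.sum_congr rfl fun k _ => h1 k, ← Summable.tsum_finsetSum fun k _ => hs k]
    refine tsum_congr fun w => ?_
    rw [sqNorm, Finset.mul_sum]
    exact Finset.sum_congr rfl fun k _ => by ring
  rw [h2]
  have : (d : ℝ) ≠ 0 := by positivity
  simp only [Finset.sum_const, Finset.card_univ, Fintype.card_fin, nsmul_eq_mul]
  field_simp

lemma summable_mul_inner (hd : 2 < d) (hJ : ∀ w, |J w| ≤ J₀ * (decay w : ℝ) ^ (d + 4))
    (x : Fin d → ℤ) : Summable fun w : Fin d → ℤ => J w * ∑ i, (x i : ℝ) * w i := by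
  have h : ∀ w : Fin d → ℤ, J w * ∑ i, (x i : ℝ) * w i = ∑ i, (x i : ℝ) * (J w * w i) :=
    fun w => by rw [Finset.mul_sum]; exact Finset.sum_congr rfl fun i _ => by ring
  simp_rw [h]
  exact summable_sum fun i _ =>
    (summable_of_decay_bound hd (by omega) (abs_mul_coord_le hJ i)).mul_left _

lemma hasSum_mul_sq_inner (hd : 2 < d) (hJ : ∀ w, |J w| ≤ J₀ * (decay w : ℝ) ^ (d + 4))
    (hflip : ∀ i w, J (coordFlip i w) = J w) (hswap : ∀ i k w, J (coordSwap i k w) = J w)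
    (x : Fin d → ℤ) :
    HasSum (fun w : Fin d → ℤ => J w * (∑ i, (x i : ℝ) * w i) ^ 2)
      (sqNorm x * (∑' w, J w * sqNorm w) / d) := by
  have h : ∀ w : Fin d → ℤ, J w * (∑ i, (x i : ℝ) * w i) ^ 2 =
      ∑ i, ∑ k, (x i * x k : ℝ) * (J w * (w i * w k)) := fun w => by
    rw [sq, Finset.sum_mul_sum, Finset.mul_sum]
    refine Finset.sum_congr rfl fun i _ => ?_
    rw [Finset.mul_sum]
    exact Finset.sum_congr rfl fun k _ => by ring
  have hs : ∀ i k : Fin d, Summable fun w : Fin d → ℤ => J w * (w i * w k : ℝ) := fun i k =>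
    summable_of_decay_bound hd (by omega) (abs_mul_coord_mul_le hJ i k)
  simp_rw [h]
  have h2 : sqNorm x * (∑' w, J w * sqNorm w) / d =
      ∑ i, ∑ k, (x i * x k : ℝ) * ∑' w : Fin d → ℤ, J w * (w i * w k : ℝ) := by
    rw [mul_div_assoc, sqNorm, Finset.sum_mul]
    refine Finset.sum_congr rfl fun i _ => ?_
    rw [Finset.sum_eq_single i, tsum_mul_sqNorm_eq hd hJ hswap, sq]
    · intro k _ hk
      rw [tsum_mul_coord_mul_eq_zero hflip hk.symm, mul_zero]
    · simp
  rw [h2]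
  exact hasSum_sum fun i _ => hasSum_sum fun k _ => (hs i k).hasSum.mul_left _

end Moments

section Radial

variable {ℓ p q u S a c : ℝ}

lemma neg_radial_prof (hℓ : 0 < ℓ) (hu : 0 < u) (d : ℝ) :
    -(4 * (u - a ^ 2) * prof₂ ℓ p q u + 2 * d * prof₁ ℓ p q u) =
      4 * a ^ 2 * prof₂ ℓ p q u + 2 * p * (d - 2 - 2 * p) * (u⁻¹ * prof ℓ p q u) +
        (2 * d * q - 8 * p * q) * ((u + ℓ)⁻¹ * prof ℓ p q u) -
        4 * q * (q + 1) * (u * (u + ℓ)⁻¹ ^ 2 * prof ℓ p q u) := by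
  have : 0 < u + ℓ := by positivity
  simp only [prof₂, prof₁, prof_succ_left hu, prof_succ_right hℓ hu]
  field_simp
  ring

lemma le_prof₂ (hℓ : 0 < ℓ) (hu : 0 < u) (hp : 0 ≤ p) (hq : 0 ≤ q) :
    p * (p + 1) * (u⁻¹ ^ 2 * prof ℓ p q u) ≤ prof₂ ℓ p q u := by
  have hP := prof_pos (p := p) (q := q) hℓ hu
  have : prof₂ ℓ p q u = p * (p + 1) * (u⁻¹ ^ 2 * prof ℓ p q u) +
      (2 * p * q * (u⁻¹ * (u + ℓ)⁻¹ * prof ℓ p q u) +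
        q * (q + 1) * ((u + ℓ)⁻¹ ^ 2 * prof ℓ p q u)) := by
    simp only [prof₂, prof₁, prof_succ_left hu, prof_succ_right hℓ hu]
    ring
  rw [this]
  have : 0 < u + ℓ := by positivity
  have : 0 ≤ 2 * p * q * (u⁻¹ * (u + ℓ)⁻¹ * prof ℓ p q u) +
        q * (q + 1) * ((u + ℓ)⁻¹ ^ 2 * prof ℓ p q u) := by positivity
  linarith

lemma prof_add_half (hS : 0 < S) : prof ℓ (p + 1 / 2) q (S ^ 2) = S⁻¹ * prof ℓ p q (S ^ 2) := by
  rw [prof_add_left (by positivity), ← Real.rpow_natCast, ← Real.rpow_mul hS.le]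
  norm_num [Real.rpow_neg_one]

lemma le_neg_radial {d : ℝ} (hd : 2 ≤ d) (hp : 2 * p = d - 2) (hq : 0 ≤ q) (hℓ : 0 < ℓ)
    (ha : 0 < a) (haS : a ≤ S) (hc : 0 ≤ c) (hc1 : c ≤ 1)
    (hcp : c * ((p + 1 / 2 + q) * (p + 1 / 2 + q + 1)) ≤ p * (p + 1)) :
    (d - 1) * c * a * (S⁻¹ ^ 3 * prof ℓ p q (S ^ 2)) -
        (4 * q * (q + 1) + 8 * p * q + 2 * d * q) * (ℓ⁻¹ * prof ℓ p q (S ^ 2)) ≤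
      -(4 * (S ^ 2 - a ^ 2) * (prof₂ ℓ p q (S ^ 2) - c * a * prof₂ ℓ (p + 1 / 2) q (S ^ 2)) +
        2 * d * (prof₁ ℓ p q (S ^ 2) - c * a * prof₁ ℓ (p + 1 / 2) q (S ^ 2))) := by
  have hS : 0 < S := ha.trans_le haS
  have hS2 : 0 < S ^ 2 := by positivity
  have hp0 : 0 ≤ p := by linarith
  have h1 := neg_radial_prof (p := p) (q := q) (a := a) hℓ hS2 d
  have h2 := neg_radial_prof (p := p + 1 / 2) (q := q) (a := a) hℓ hS2 d
  have h3 := le_prof₂ hℓ hS2 hp0 hq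
  have h4 := (le_abs_self _).trans (abs_prof₂_le hℓ hS2 (p := p + 1 / 2) (by positivity) hq)
  rw [prof_add_half hS] at h2 h4
  have hP := prof_pos (p := p) (q := q) hℓ hS2
  set P := prof ℓ p q (S ^ 2)
  have hSℓ : 0 < S ^ 2 + ℓ := by positivity
  have k1 : (S ^ 2 + ℓ)⁻¹ * P ≤ ℓ⁻¹ * P := by gcongr; linarith
  have k2 : S ^ 2 * (S ^ 2 + ℓ)⁻¹ ^ 2 * P ≤ ℓ⁻¹ * P := by
    refine le_trans ?_ k1
    gcongr
    rw [sq (S ^ 2 + ℓ)⁻¹, ← mul_assoc]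
    refine mul_le_of_le_one_left (by positivity) ?_
    rw [← div_eq_mul_inv, div_le_one hSℓ]; linarith
  have k3 : a * S⁻¹ ≤ 1 := by rw [← div_eq_mul_inv, div_le_one hS]; exact haS
  have k4 : c * a * prof₂ ℓ (p + 1 / 2) q (S ^ 2) ≤ p * (p + 1) * ((S ^ 2)⁻¹ ^ 2 * P) := by
    calc _ ≤ c * a * ((p + 1 / 2 + q) * (p + 1 / 2 + q + 1) * (S ^ 2)⁻¹ ^ 2 * (S⁻¹ * P)) := by
          gcongr
      _ = c * ((p + 1 / 2 + q) * (p + 1 / 2 + q + 1)) * (a * S⁻¹) * ((S ^ 2)⁻¹ ^ 2 * P) := by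
          ring
      _ ≤ (p * (p + 1)) * 1 * ((S ^ 2)⁻¹ ^ 2 * P) := by gcongr
      _ = _ := by ring
  have k5 : 0 ≤ 4 * a ^ 2 * (prof₂ ℓ p q (S ^ 2) - c * a * prof₂ ℓ (p + 1 / 2) q (S ^ 2)) :=
    mul_nonneg (by positivity) (by linarith)
  have k6 : 8 * p * q * ((S ^ 2 + ℓ)⁻¹ * P) ≤ 8 * p * q * (ℓ⁻¹ * P) := by gcongr
  have k7 : 4 * q * (q + 1) * (S ^ 2 * (S ^ 2 + ℓ)⁻¹ ^ 2 * P) ≤ 4 * q * (q + 1) * (ℓ⁻¹ * P) := by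
    gcongr
  have k8 : c * a * (2 * d * q * ((S ^ 2 + ℓ)⁻¹ * (S⁻¹ * P))) ≤ 2 * d * q * (ℓ⁻¹ * P) := by
    calc _ = c * (a * S⁻¹) * (2 * d * q * ((S ^ 2 + ℓ)⁻¹ * P)) := by ring
      _ ≤ 1 * 1 * (2 * d * q * (ℓ⁻¹ * P)) := by gcongr
      _ = _ := by ring
  have k9 : 0 ≤ 2 * d * q * ((S ^ 2 + ℓ)⁻¹ * P) := by positivity
  have k10 : 0 ≤ c * a * (8 * (p + 1 / 2) * q * ((S ^ 2 + ℓ)⁻¹ * (S⁻¹ * P))) := by positivity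
  have k11 : 0 ≤ c * a * (4 * q * (q + 1) * (S ^ 2 * (S ^ 2 + ℓ)⁻¹ ^ 2 * (S⁻¹ * P))) := by
    positivity
  have k12 : c * a * (2 * (p + 1 / 2) * (d - 2 - 2 * (p + 1 / 2)) * ((S ^ 2)⁻¹ * (S⁻¹ * P))) =
      -((d - 1) * c * a * (S⁻¹ ^ 3 * P)) := by
    rw [show 2 * (p + 1 / 2) = d - 1 by linarith, show d - 2 - (d - 1) = -1 by ring, inv_pow]
    field_simp
  have k13 : 2 * p * (d - 2 - 2 * p) * ((S ^ 2)⁻¹ * P) = 0 := by rw [hp]; ring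
  rw [k13] at h1
  generalize prof₂ ℓ p q (S ^ 2) = A at *
  generalize prof₂ ℓ (p + 1 / 2) q (S ^ 2) = B at *
  generalize prof₁ ℓ p q (S ^ 2) = A' at *
  generalize prof₁ ℓ (p + 1 / 2) q (S ^ 2) = B' at *
  have k14 : -(4 * (S ^ 2 - a ^ 2) * (A - c * a * B) + 2 * d * (A' - c * a * B')) =
    -(4 * (S ^ 2 - a ^ 2) * A + 2 * d * A') -
      c * a * -(4 * (S ^ 2 - a ^ 2) * B + 2 * d * B') := by ring
  rw [k14, h1, h2]
  linarith

end Radial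

section Far

variable {d : ℕ} {ℓ S : ℝ}

lemma prof_sq_eq (hd : 2 ≤ d) (hℓ : 0 < ℓ) (hS : 0 < S) :
    prof ℓ (d / 2 - 1) (3 / 2) (S ^ 2) = S⁻¹ ^ (d - 2) * (√(S ^ 2 + ℓ))⁻¹ ^ 3 := by
  unfold prof
  congr 1
  · rw [← Real.rpow_natCast S 2, ← Real.rpow_mul hS.le, inv_pow, ← Real.rpow_natCast S (d - 2),
      ← Real.rpow_neg hS.le]
    push_cast [hd]
    ring_nf
  · rw [Real.sqrt_eq_rpow, inv_pow, ← Real.rpow_natCast (_ ^ _) 3, ← Real.rpow_mul (by positivity),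
      ← Real.rpow_neg (by positivity)]
    norm_num

lemma inv_le_two_mul_decay {a : ℝ} (ha : 1 ≤ a) (y : Fin d → ℤ) :
    (√(sqNorm y + a ^ 2))⁻¹ ≤ 2 * decay y := by
  rw [coe_decay, ← div_eq_mul_inv, inv_eq_one_div, div_le_div_iff₀ _ (by positivity), one_mul]
  · have h1 : ‖y‖ ≤ √(sqNorm y + a ^ 2) := Real.le_sqrt_of_sq_le (by
      nlinarith [sq_norm_le_sqNorm y])
    have h2 : a ≤ √(sqNorm y + a ^ 2) := Real.le_sqrt_of_sq_le (by
      nlinarith [sqNorm_nonneg y])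
    linarith
  · have := sqNorm_nonneg y
    positivity

lemma decay_pow_mul_prof_le (hd : 2 ≤ d) {a : ℝ} (ha : 1 ≤ a) (hℓ : 0 < ℓ) (x w : Fin d → ℤ)
    (h : √(sqNorm x + a ^ 2) < 2 * √(sqNorm w)) :
    (decay w : ℝ) ^ (d + 4) * prof ℓ (d / 2 - 1) (3 / 2) (sqNorm (x - w) + a ^ 2) ≤
      (2 * d) ^ (d + 4) * 2 ^ (d + 3) * ((√(sqNorm x + a ^ 2))⁻¹ ^ 3 *
        prof ℓ (d / 2 - 1) (3 / 2) (sqNorm x + a ^ 2)) *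
        ((decay w : ℝ) ^ (d + 1) + (decay (x - w) : ℝ) ^ (d + 1)) := by
  have hx := sqNorm_nonneg x
  have hy := sqNorm_nonneg (x - w)
  have hT := inv_le_two_mul_decay ha (x - w)
  set S := √(sqNorm x + a ^ 2) with hSdef
  set T := √(sqNorm (x - w) + a ^ 2) with hTdef
  have hS2 : sqNorm x + a ^ 2 = S ^ 2 := (Real.sq_sqrt (by positivity)).symm
  have hT2 : sqNorm (x - w) + a ^ 2 = T ^ 2 := (Real.sq_sqrt (by positivity)).symm
  have hS : 0 < S := Real.sqrt_pos.2 (by positivity)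
  have hT0 : 0 < T := Real.sqrt_pos.2 (by positivity)
  have hdec : (decay w : ℝ) ≤ 2 * d * S⁻¹ := by
    rw [← div_eq_mul_inv, le_div_iff₀ hS]
    have := sqrt_sqNorm_mul_decay_le w
    have hw : (0 : ℝ) < decay w := by exact_mod_cast decay_pos w
    nlinarith
  rw [hS2, hT2, prof_sq_eq hd hℓ hS, prof_sq_eq hd hℓ hT0]
  have hw0 : (0 : ℝ) ≤ decay w := (decay w).2
  have hy0 : (0 : ℝ) ≤ decay (x - w) := (decay (x - w)).2
  generalize (decay w : ℝ) = α at *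
  generalize (decay (x - w) : ℝ) = γ at *
  have hd1 : (1 : ℝ) ≤ 2 * d := by
    have : (2 : ℝ) ≤ d := by exact_mod_cast hd
    linarith
  obtain ⟨k, rfl⟩ := Nat.exists_eq_add_of_le hd
  rw [show 2 + k - 2 = k by omega]
  have hR : ∀ v : ℝ, 0 < v → S ^ 2 + ℓ ≤ 2 * v ^ 2 → v⁻¹ ^ 3 ≤ 4 * (√(S ^ 2 + ℓ))⁻¹ ^ 3 := by
    intro v hv h
    have h1 : √(S ^ 2 + ℓ) ≤ 3 / 2 * v := Real.sqrt_le_iff.2 ⟨by positivity, by nlinarith⟩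
    have h2 : 0 < √(S ^ 2 + ℓ) := Real.sqrt_pos.2 (by positivity)
    have h3 : v⁻¹ ≤ 3 / 2 * (√(S ^ 2 + ℓ))⁻¹ := by
      rw [inv_le_iff_one_le_mul₀ hv]
      calc (1 : ℝ) = (√(S ^ 2 + ℓ))⁻¹ * √(S ^ 2 + ℓ) := (inv_mul_cancel₀ h2.ne').symm
        _ ≤ (√(S ^ 2 + ℓ))⁻¹ * (3 / 2 * v) := by gcongr
        _ = _ := by ring
    calc v⁻¹ ^ 3 ≤ (3 / 2 * (√(S ^ 2 + ℓ))⁻¹) ^ 3 := by gcongr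
      _ = 27 / 8 * (√(S ^ 2 + ℓ))⁻¹ ^ 3 := by ring
      _ ≤ _ := by gcongr; norm_num
  have hRpos : 0 < √(S ^ 2 + ℓ) := Real.sqrt_pos.2 (by positivity)
  set D : ℝ := 2 * ((2 + k : ℕ) : ℝ)
  rcases le_total (S ^ 2) ℓ with hcase | hcase
  · have h1 : (√(T ^ 2 + ℓ))⁻¹ ^ 3 ≤ (√ℓ)⁻¹ ^ 3 := by
      have : 0 < √ℓ := Real.sqrt_pos.2 hℓ
      gcongr
      nlinarith [sq_nonneg T]
    have h2 := hR (√ℓ) (Real.sqrt_pos.2 hℓ) (by rw [Real.sq_sqrt hℓ.le]; linarith)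
    have h3 : α ^ 3 * γ ^ k ≤ α ^ (k + 3) + γ ^ (k + 3) := by
      rcases le_total α γ with h | h
      · calc α ^ 3 * γ ^ k ≤ γ ^ 3 * γ ^ k := by gcongr
          _ = γ ^ (k + 3) := by ring
          _ ≤ _ := by linarith [pow_nonneg hw0 (k + 3)]
      · calc α ^ 3 * γ ^ k ≤ α ^ 3 * α ^ k := by gcongr
          _ = α ^ (k + 3) := by ring
          _ ≤ _ := by linarith [pow_nonneg hy0 (k + 3)]
    calc α ^ (2 + k + 4) * (T⁻¹ ^ k * (√(T ^ 2 + ℓ))⁻¹ ^ 3)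
        ≤ α ^ 3 * (D * S⁻¹) ^ (k + 3) * ((2 * γ) ^ k * (4 * (√(S ^ 2 + ℓ))⁻¹ ^ 3)) := by
          rw [show 2 + k + 4 = 3 + (k + 3) by omega, pow_add]
          gcongr
          exact h1.trans h2
      _ = D ^ (k + 3) * 2 ^ (k + 2) * (S⁻¹ ^ 3 * (S⁻¹ ^ k * (√(S ^ 2 + ℓ))⁻¹ ^ 3)) *
          (α ^ 3 * γ ^ k) := by ring
      _ ≤ D ^ (2 + k + 4) * 2 ^ (2 + k + 3) * (S⁻¹ ^ 3 * (S⁻¹ ^ k * (√(S ^ 2 + ℓ))⁻¹ ^ 3)) *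
          (α ^ (2 + k + 1) + γ ^ (2 + k + 1)) := by
          rw [show 2 + k + 1 = k + 3 by omega]
          gcongr <;> first | omega | norm_num
  · have h1 : (√(T ^ 2 + ℓ))⁻¹ ^ 3 ≤ T⁻¹ ^ 3 := by
      have : T ≤ √(T ^ 2 + ℓ) := Real.le_sqrt_of_sq_le (by linarith)
      gcongr
    have h2 := hR S hS (by linarith)
    calc α ^ (2 + k + 4) * (T⁻¹ ^ k * (√(T ^ 2 + ℓ))⁻¹ ^ 3)
        ≤ (D * S⁻¹) ^ (2 + k + 4) * (T⁻¹ ^ k * T⁻¹ ^ 3) := by gcongr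
      _ = (D * S⁻¹) ^ (2 + k + 4) * T⁻¹ ^ (2 + k + 1) := by ring
      _ ≤ (D * S⁻¹) ^ (2 + k + 4) * (2 * γ) ^ (2 + k + 1) := by gcongr
      _ = D ^ (2 + k + 4) * 2 ^ (2 + k + 1) * (S⁻¹ ^ 3 * (S⁻¹ ^ k * S⁻¹ ^ 3)) *
          γ ^ (2 + k + 1) := by ring
      _ ≤ D ^ (2 + k + 4) * 2 ^ (2 + k + 1) *
          (S⁻¹ ^ 3 * (S⁻¹ ^ k * (4 * (√(S ^ 2 + ℓ))⁻¹ ^ 3))) *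
          (α ^ (2 + k + 1) + γ ^ (2 + k + 1)) := by
          gcongr
          linarith [pow_nonneg hw0 (2 + k + 1)]
      _ = _ := by ring

end Far

section Supersolution

lemma exists_corrected_taylor {p q : ℝ} (hp : 0 ≤ p) (hq : 0 ≤ q) : ∃ C : ℝ, 0 ≤ C ∧
    ∀ ℓ S s β κ : ℝ, 0 < ℓ → 0 < S → 0 ≤ s → |β| ≤ s * S → 0 ≤ κ → 0 < S ^ 2 + 2 * β + s ^ 2 →
      κ ≤ S → κ ^ 2 ≤ S ^ 2 + 2 * β + s ^ 2 →
      |(prof ℓ p q (S ^ 2 + 2 * β + s ^ 2) - κ * prof ℓ (p + 1 / 2) q (S ^ 2 + 2 * β + s ^ 2)) -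
        (prof ℓ p q (S ^ 2) - κ * prof ℓ (p + 1 / 2) q (S ^ 2)) -
        2 * β * (prof₁ ℓ p q (S ^ 2) - κ * prof₁ ℓ (p + 1 / 2) q (S ^ 2)) -
        (2 * β ^ 2 * (prof₂ ℓ p q (S ^ 2) - κ * prof₂ ℓ (p + 1 / 2) q (S ^ 2)) +
          s ^ 2 * (prof₁ ℓ p q (S ^ 2) - κ * prof₁ ℓ (p + 1 / 2) q (S ^ 2)))| ≤
      C * (s / S) ^ 3 * prof ℓ p q (S ^ 2) +
        if S < 2 * s then 2 * prof ℓ p q (S ^ 2 + 2 * β + s ^ 2) else 0 := by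
  obtain ⟨C₁, h₁, H₁⟩ := exists_prof_taylor hp hq
  obtain ⟨C₂, h₂, H₂⟩ := exists_prof_taylor (p := p + 1 / 2) (by positivity) hq
  refine ⟨C₁ + C₂, by positivity, fun ℓ S s β κ hℓ hS hs hβ hκ hM hκS hκM => ?_⟩
  have a₁ := H₁ ℓ S s β hℓ hS hs hβ hM
  have a₂ := H₂ ℓ S s β hℓ hS hs hβ hM
  have hT0 := Real.sqrt_pos.2 hM
  have hκT : κ ≤ √(S ^ 2 + 2 * β + s ^ 2) := Real.le_sqrt_of_sq_le hκM
  have hTM := Real.sq_sqrt hM.le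
  set T := √(S ^ 2 + 2 * β + s ^ 2)
  rw [← hTM] at a₁ a₂ ⊢
  have hP := prof_pos (p := p) (q := q) hℓ (u := S ^ 2) (by positivity)
  have hQ := prof_pos (p := p) (q := q) hℓ (u := T ^ 2) (by positivity)
  rw [prof_add_half hT0, prof_add_half hS] at a₂ ⊢
  set P := prof ℓ p q (S ^ 2)
  set Q := prof ℓ p q (T ^ 2)
  have k₁ : κ * S⁻¹ ≤ 1 := by rw [← div_eq_mul_inv, div_le_one hS]; exact hκS
  have k₂ : κ * T⁻¹ ≤ 1 := by rw [← div_eq_mul_inv, div_le_one hT0]; exact hκT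
  have a₃ := mul_le_mul_of_nonneg_left a₂ hκ
  have e₁ : κ * (C₂ * (s / S) ^ 3 * (S⁻¹ * P)) ≤ C₂ * (s / S) ^ 3 * P := by
    calc _ = (κ * S⁻¹) * (C₂ * (s / S) ^ 3 * P) := by ring
      _ ≤ 1 * (C₂ * (s / S) ^ 3 * P) := by gcongr
      _ = _ := one_mul _
  have e₂ : κ * (T⁻¹ * Q) ≤ Q := by
    rw [← mul_assoc]; exact mul_le_of_le_one_left hQ.le k₂
  rw [← abs_of_nonneg hκ, ← abs_mul, abs_of_nonneg hκ] at a₃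
  generalize prof₁ ℓ p q (S ^ 2) = A₁ at *
  generalize prof₂ ℓ p q (S ^ 2) = A₂ at *
  generalize prof₁ ℓ (p + 1 / 2) q (S ^ 2) = B₁ at *
  generalize prof₂ ℓ (p + 1 / 2) q (S ^ 2) = B₂ at *
  have key := abs_sub (Q - P - 2 * β * A₁ - (2 * β ^ 2 * A₂ + s ^ 2 * A₁))
    (κ * (T⁻¹ * Q - S⁻¹ * P - 2 * β * B₁ - (2 * β ^ 2 * B₂ + s ^ 2 * B₁)))
  rw [show Q - κ * (T⁻¹ * Q) - (P - κ * (S⁻¹ * P)) - 2 * β * (A₁ - κ * B₁) -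
    (2 * β ^ 2 * (A₂ - κ * B₂) + s ^ 2 * (A₁ - κ * B₁)) =
    (Q - P - 2 * β * A₁ - (2 * β ^ 2 * A₂ + s ^ 2 * A₁)) -
    (κ * (T⁻¹ * Q - S⁻¹ * P - 2 * β * B₁ - (2 * β ^ 2 * B₂ + s ^ 2 * B₁))) by ring]
  refine key.trans ((add_le_add a₁ a₃).trans ?_)
  split_ifs
  · rw [mul_add]; linarith
  · rw [mul_add]; linarith

variable {d : ℕ}

lemma exists_remainder_le (hd : 4 < d) {J₀ : ℝ} (hJ₀ : 0 ≤ J₀) : ∃ C : ℝ, 0 ≤ C ∧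
    ∀ (a ℓ κ : ℝ) (J : (Fin d → ℤ) → ℝ), 1 ≤ a → 0 < ℓ → 0 ≤ κ → κ ≤ a →
      (∀ w, |J w| ≤ J₀ * (decay w : ℝ) ^ (d + 4)) → (∀ w, J (-w) = J w) →
      (∀ i w, J (coordFlip i w) = J w) → (∀ i k w, J (coordSwap i k w) = J w) →
      ∀ x : Fin d → ℤ, ∀ S, S = √(sqNorm x + a ^ 2) →
        |∑' w, J w * (prof ℓ (d / 2 - 1) (3 / 2) (sqNorm (x - w) + a ^ 2) -
            κ * prof ℓ (d / 2 - 1 + 1 / 2) (3 / 2) (sqNorm (x - w) + a ^ 2)) -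
          (∑' w, J w) * (prof ℓ (d / 2 - 1) (3 / 2) (S ^ 2) -
            κ * prof ℓ (d / 2 - 1 + 1 / 2) (3 / 2) (S ^ 2)) -
          (∑' w, J w * sqNorm w) / (2 * d) *
            (4 * (S ^ 2 - a ^ 2) * (prof₂ ℓ (d / 2 - 1) (3 / 2) (S ^ 2) -
              κ * prof₂ ℓ (d / 2 - 1 + 1 / 2) (3 / 2) (S ^ 2)) +
            2 * d * (prof₁ ℓ (d / 2 - 1) (3 / 2) (S ^ 2) -
              κ * prof₁ ℓ (d / 2 - 1 + 1 / 2) (3 / 2) (S ^ 2)))| ≤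
          C * (S⁻¹ ^ 3 * prof ℓ (d / 2 - 1) (3 / 2) (S ^ 2)) := by
  have hdR : (5 : ℝ) ≤ d := by exact_mod_cast hd
  obtain ⟨C₁, hC₁, H₁⟩ := exists_corrected_taylor (p := (d : ℝ) / 2 - 1) (q := 3 / 2) (by linarith)
    (by norm_num)
  obtain ⟨K, hK, HK⟩ := exists_summable_decay (d := d) (by omega)
  set D : ℝ := (2 * d) ^ (d + 4) * 2 ^ (d + 3) with hD
  have hD0 : 0 ≤ D := by positivity
  refine ⟨J₀ * (C₁ * d ^ 3 + 2 * D) * K + J₀ * (2 * D) * K, by positivity, ?_⟩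
  intro a ℓ κ J ha hℓ hκ hκa hJ hneg hflip hswap x S hS
  have hx := sqNorm_nonneg x
  have hS2 : sqNorm x + a ^ 2 = S ^ 2 := by rw [hS]; exact (Real.sq_sqrt (by positivity)).symm
  have hS0 : 0 < S := by rw [hS]; exact Real.sqrt_pos.2 (by positivity)
  have haS : a ≤ S := by rw [hS]; exact Real.le_sqrt_of_sq_le (by linarith)
  have hP := prof_pos (p := (d : ℝ) / 2 - 1) (q := 3 / 2) hℓ (u := S ^ 2) (by positivity)
  obtain ⟨hs1, hK1⟩ := HK (d + 1) le_rfl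
  set P := prof ℓ (d / 2 - 1) (3 / 2) (S ^ 2) with hPdef
  set P₁ := prof₁ ℓ (d / 2 - 1) (3 / 2) (S ^ 2) - κ * prof₁ ℓ (d / 2 - 1 + 1 / 2) (3 / 2) (S ^ 2)
  set P₂ := prof₂ ℓ (d / 2 - 1) (3 / 2) (S ^ 2) - κ * prof₂ ℓ (d / 2 - 1 + 1 / 2) (3 / 2) (S ^ 2)
  set P₀ := P - κ * prof ℓ (d / 2 - 1 + 1 / 2) (3 / 2) (S ^ 2) with hP₀
  set A : (Fin d → ℤ) → ℝ := fun y => prof ℓ (d / 2 - 1) (3 / 2) (sqNorm y + a ^ 2) -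
            κ * prof ℓ (d / 2 - 1 + 1 / 2) (3 / 2) (sqNorm y + a ^ 2) with hA
  set R : (Fin d → ℤ) → ℝ := fun w => A (x - w) - P₀ - 2 * (-∑ i, (x i : ℝ) * w i) * P₁ -
    (2 * (-∑ i, (x i : ℝ) * w i) ^ 2 * P₂ + sqNorm w * P₁) with hR
  have hRle : ∀ w, |J w * R w| ≤ J₀ * (S⁻¹ ^ 3 * P) *
      ((C₁ * d ^ 3 + 2 * D) * (decay w : ℝ) ^ (d + 1) +
        2 * D * (decay (x - w) : ℝ) ^ (d + 1)) := by
    intro w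
    have hw := sqNorm_nonneg w
    have hs := Real.sq_sqrt hw
    have hdw : (0 : ℝ) ≤ decay w := (decay w).2
    have hdy : (0 : ℝ) ≤ decay (x - w) := (decay (x - w)).2
    have hM : sqNorm (x - w) + a ^ 2 = S ^ 2 + 2 * (-∑ i, (x i : ℝ) * w i) + √(sqNorm w) ^ 2 := by
      rw [sqNorm_sub, hs, ← hS2]; ring
    have hM0 : 0 < sqNorm (x - w) + a ^ 2 := by have := sqNorm_nonneg (x - w); positivity
    have hβ : |-∑ i, (x i : ℝ) * w i| ≤ √(sqNorm w) * S := by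
      refine abs_le_of_sq_le_sq ?_ (by positivity)
      rw [neg_sq, mul_pow, hs, ← hS2]
      nlinarith [sq_inner_le x w, mul_nonneg hw (sq_nonneg a)]
    have hfar := decay_pow_mul_prof_le (by omega) ha hℓ x w
    have hT := H₁ ℓ S (√(sqNorm w)) _ κ hℓ hS0 (Real.sqrt_nonneg _) hβ hκ (hM ▸ hM0)
      (hκa.trans haS) (by
        rw [← hM]; nlinarith [sqNorm_nonneg (x - w)])
    rw [← hM, hs] at hT
    have hT' : |R w| ≤ _ := hT
    rw [← hS, hS2, ← hPdef, ← hD] at hfar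
    have hnear : (decay w : ℝ) ^ (d + 4) * (C₁ * (√(sqNorm w) / S) ^ 3 * P) ≤
        (S⁻¹ ^ 3 * P) * (C₁ * d ^ 3 * (decay w : ℝ) ^ (d + 1)) := by
      calc _ = (S⁻¹ ^ 3 * P) * (C₁ * (√(sqNorm w) * decay w) ^ 3 * (decay w : ℝ) ^ (d + 1)) := by
            ring
        _ ≤ _ := by gcongr; exact sqrt_sqNorm_mul_decay_le w
    have hfar' : (decay w : ℝ) ^ (d + 4) * (if S < 2 * √(sqNorm w) then
        2 * prof ℓ (d / 2 - 1) (3 / 2) (sqNorm (x - w) + a ^ 2) else 0) ≤ (S⁻¹ ^ 3 * P) *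
          (2 * D * ((decay w : ℝ) ^ (d + 1) + (decay (x - w) : ℝ) ^ (d + 1))) := by
      split_ifs with h
      · linarith [hfar h]
      · rw [mul_zero]; positivity
    rw [abs_mul]
    calc |J w| * |R w| ≤ (J₀ * (decay w : ℝ) ^ (d + 4)) * _ :=
          mul_le_mul (hJ w) hT' (abs_nonneg _) (by positivity)
      _ = J₀ * ((decay w : ℝ) ^ (d + 4) * (C₁ * (√(sqNorm w) / S) ^ 3 * P) +
          (decay w : ℝ) ^ (d + 4) * (if S < 2 * √(sqNorm w) then
            2 * prof ℓ (d / 2 - 1) (3 / 2) (sqNorm (x - w) + a ^ 2) else 0)) := by ring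
      _ ≤ J₀ * ((S⁻¹ ^ 3 * P) * (C₁ * d ^ 3 * (decay w : ℝ) ^ (d + 1)) + (S⁻¹ ^ 3 * P) *
          (2 * D * ((decay w : ℝ) ^ (d + 1) + (decay (x - w) : ℝ) ^ (d + 1)))) := by gcongr
      _ = _ := by ring
  have hsx : HasSum (fun w : Fin d → ℤ => (decay (x - w) : ℝ) ^ (d + 1))
      (∑' w : Fin d → ℤ, (decay w : ℝ) ^ (d + 1)) :=
    (Equiv.subLeft x).hasSum_iff (f := fun w : Fin d → ℤ => (decay w : ℝ) ^ (d + 1)) |>.2 hs1.hasSum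
  have hB := ((hs1.hasSum.mul_left (C₁ * d ^ 3 + 2 * D)).add (hsx.mul_left (2 * D))).mul_left
    (J₀ * (S⁻¹ ^ 3 * P))
  have hJs : Summable J := summable_of_decay_bound (by omega) (by omega) hJ
  have hJR : Summable fun w => J w * R w := hB.summable.of_norm_bounded hRle
  have hJq := hasSum_mul_sq_inner (by omega) hJ hflip hswap x
  have hJi := (summable_mul_inner (by omega) hJ x).hasSum
  rw [tsum_mul_inner_eq_zero hneg] at hJi
  have hJσ : Summable fun w => J w * sqNorm w := by
    have h : ∀ w : Fin d → ℤ, J w * sqNorm w = ∑ i, J w * (w i * w i : ℝ) := fun w => by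
      rw [sqNorm, Finset.mul_sum]; exact Finset.sum_congr rfl fun i _ => by ring
    simp_rw [h]
    exact summable_sum fun i _ =>
      summable_of_decay_bound (by omega) (by omega) (abs_mul_coord_mul_le hJ i i)
  have hsum := (((hJs.hasSum.mul_right P₀).add (hJi.mul_right (-2 * P₁))).add
    ((hJq.mul_right (2 * P₂)).add (hJσ.hasSum.mul_right P₁))).add hJR.hasSum
  have hJA := (tsum_congr (fun w => show J w * A (x - w) = _ by simp only [hR]; ring)).trans
    hsum.tsum_eq
  rw [hJA]
  have hbound : |∑' w, J w * R w| ≤ (J₀ * (C₁ * d ^ 3 + 2 * D) * K + J₀ * (2 * D) * K) *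
      (S⁻¹ ^ 3 * P) := by
    calc _ ≤ J₀ * (S⁻¹ ^ 3 * P) * ((C₁ * d ^ 3 + 2 * D) *
        ∑' w : Fin d → ℤ, (decay w : ℝ) ^ (d + 1) +
          2 * D * ∑' w : Fin d → ℤ, (decay w : ℝ) ^ (d + 1)) :=
          (Real.norm_eq_abs _).symm.le.trans (tsum_of_norm_bounded hB hRle)
      _ ≤ J₀ * (S⁻¹ ^ 3 * P) * ((C₁ * d ^ 3 + 2 * D) * K + 2 * D * K) := by gcongr
      _ = (J₀ * (C₁ * d ^ 3 + 2 * D) * K + J₀ * (2 * D) * K) * (S⁻¹ ^ 3 * P) := by ring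
  refine le_trans (le_of_eq ?_) hbound
  congr 1
  have hSx : S ^ 2 - a ^ 2 = sqNorm x := by linarith
  rw [hSx]
  have : (d : ℝ) ≠ 0 := by linarith
  field_simp
  ring

theorem exists_supersolution (hd : 4 < d) {J₀ σ₀ : ℝ} (hJ₀ : 0 ≤ J₀) (hσ₀ : 0 < σ₀) :
    ∃ a L : ℝ, 1 ≤ a ∧ 1 ≤ L ∧ ∀ J : (Fin d → ℤ) → ℝ,
      (∀ w, |J w| ≤ J₀ * (decay w : ℝ) ^ (d + 4)) → (∀ w, J (-w) = J w) →
      (∀ i w, J (coordFlip i w) = J w) → (∀ i k w, J (coordSwap i k w) = J w) →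
      σ₀ ≤ ∑' w, J w * sqNorm w → ∀ ε, ε = 1 - ∑' w, J w → 0 < ε →
      ∃ A : (Fin d → ℤ) → ℝ,
        (∀ x, 0 ≤ A x ∧ A x ≤ prof (L / ε) (d / 2 - 1) (3 / 2) (sqNorm x + a ^ 2)) ∧
        ∀ x, (√(sqNorm x + a ^ 2))⁻¹ ^ 3 * prof (L / ε) (d / 2 - 1) (3 / 2) (sqNorm x + a ^ 2) ≤
          A x - ∑' w, J w * A (x - w) := by
  have hdR : (5 : ℝ) ≤ d := by exact_mod_cast hd
  obtain ⟨C, hC, HC⟩ := exists_remainder_le hd hJ₀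
  obtain ⟨K, hK, HK⟩ := exists_summable_decay (d := d) (by omega)
  set p : ℝ := d / 2 - 1 with hp
  have hp0 : 0 < p := by linarith
  set k : ℝ := (p + 1 / 2 + 3 / 2) * (p + 1 / 2 + 3 / 2 + 1)
  have hk : 0 < k := by positivity
  set c : ℝ := min (1 / 2) (p * (p + 1) / k) with hcdef
  have hc : 0 < c := lt_min (by norm_num) (by positivity)
  have hc1 : c ≤ 1 / 2 := min_le_left _ _
  have hck : c * k ≤ p * (p + 1) := by
    calc c * k ≤ p * (p + 1) / k * k := by gcongr; exact min_le_right _ _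
      _ = _ := by field_simp
  set B : ℝ := 4 * (3 / 2) * (3 / 2 + 1) + 8 * p * (3 / 2) + 2 * d * (3 / 2)
  have hB : 0 ≤ B := by positivity
  have hd1 : (0 : ℝ) < d - 1 := by linarith
  set a : ℝ := 1 + (1 + C) / (σ₀ / (2 * d) * ((d - 1) * c)) with ha
  have ha1 : 1 ≤ a := by
    rw [ha]; linarith [show 0 ≤ (1 + C) / (σ₀ / (2 * d) * ((d - 1) * c)) by positivity]
  have haC : 1 + C ≤ σ₀ / (2 * d) * ((d - 1) * c * a) := by
    have : (1 + C) = σ₀ / (2 * d) * ((d - 1) * c) * ((1 + C) / (σ₀ / (2 * d) * ((d - 1) * c))) := by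
      rw [mul_div_cancel₀ _ (by positivity)]
    have hY : 0 < σ₀ / (2 * d) * ((d - 1) * c) := by positivity
    calc 1 + C ≤ σ₀ / (2 * d) * ((d - 1) * c) +
          σ₀ / (2 * d) * ((d - 1) * c) * ((1 + C) / (σ₀ / (2 * d) * ((d - 1) * c))) := by
          rw [← this]; linarith
      _ = _ := by rw [ha]; ring
  set σ₁ : ℝ := J₀ * d * K
  refine ⟨a, 1 + 2 * (σ₁ / (2 * d) * B), ha1, by
    have : 0 ≤ σ₁ / (2 * d) * B := by positivity
    linarith, ?_⟩
  intro J hJ hneg hflip hswap hσ ε hε hε0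
  set L := 1 + 2 * (σ₁ / (2 * d) * B) with hL
  have hL1 : 1 ≤ L := by
    have : 0 ≤ σ₁ / (2 * d) * B := by positivity
    linarith
  set ℓ := L / ε with hℓ
  have hℓ0 : 0 < ℓ := by positivity
  have hσ₁ : ∑' w, J w * sqNorm w ≤ σ₁ := by
    obtain ⟨hs, hs'⟩ := HK (d + 2) (by omega)
    refine (Real.le_norm_self _).trans ((tsum_of_norm_bounded
      (hs.hasSum.mul_left _) (abs_mul_sqNorm_le hJ)).trans ?_)
    show _ ≤ J₀ * d * K
    gcongr
  set σ := ∑' w, J w * sqNorm w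
  refine ⟨fun y => prof ℓ p (3 / 2) (sqNorm y + a ^ 2) -
    c * a * prof ℓ (p + 1 / 2) (3 / 2) (sqNorm y + a ^ 2), ?_⟩
  have hhalf : ∀ x : Fin d → ℤ, 0 ≤ c * a * prof ℓ (p + 1 / 2) (3 / 2) (sqNorm x + a ^ 2) ∧
      c * a * prof ℓ (p + 1 / 2) (3 / 2) (sqNorm x + a ^ 2) ≤
        1 / 2 * prof ℓ p (3 / 2) (sqNorm x + a ^ 2) := fun x => by
    have hx := sqNorm_nonneg x
    have hS2 := Real.sq_sqrt (show 0 ≤ sqNorm x + a ^ 2 by positivity)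
    have hS0 : 0 < √(sqNorm x + a ^ 2) := Real.sqrt_pos.2 (by positivity)
    have haS : a ≤ √(sqNorm x + a ^ 2) := Real.le_sqrt_of_sq_le (by linarith)
    rw [← hS2]
    set S := √(sqNorm x + a ^ 2)
    rw [prof_add_half hS0]
    have hP := prof_pos (p := p) (q := 3 / 2) hℓ0 (u := S ^ 2) (by positivity)
    refine ⟨by positivity, ?_⟩
    have k₁ : a * S⁻¹ ≤ 1 := by rw [← div_eq_mul_inv, div_le_one hS0]; exact haS
    calc _ = c * (a * S⁻¹) * prof ℓ p (3 / 2) (S ^ 2) := by ring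
      _ ≤ 1 / 2 * 1 * prof ℓ p (3 / 2) (S ^ 2) := by gcongr
      _ = _ := by ring
  have hpos : ∀ x : Fin d → ℤ, 0 < prof ℓ p (3 / 2) (sqNorm x + a ^ 2) := fun x =>
    prof_pos hℓ0 (by have := sqNorm_nonneg x; positivity)
  refine ⟨fun x => ⟨by linarith [(hhalf x).2, hpos x], by linarith [(hhalf x).1]⟩, fun x => ?_⟩
  have hx := sqNorm_nonneg x
  have hrem := HC a ℓ (c * a) J ha1 hℓ0 (by positivity)
    (mul_le_of_le_one_left (by positivity) (by linarith)) hJ hneg hflip hswap x _ rfl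
  have hS2 := Real.sq_sqrt (show 0 ≤ sqNorm x + a ^ 2 by positivity)
  have hS0 : 0 < √(sqNorm x + a ^ 2) := Real.sqrt_pos.2 (by positivity)
  have haS : a ≤ √(sqNorm x + a ^ 2) := Real.le_sqrt_of_sq_le (by linarith)
  have hh := hhalf x
  have hP := hpos x
  set S := √(sqNorm x + a ^ 2)
  beta_reduce
  rw [← hS2] at hh hP ⊢
  have hrad := le_neg_radial (d := d) (by linarith) (by rw [hp]; ring) (q := 3 / 2) (by norm_num)
    hℓ0 (by positivity) haS hc.le (by linarith) hck
  set P := prof ℓ p (3 / 2) (S ^ 2)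
  generalize prof ℓ (p + 1 / 2) (3 / 2) (S ^ 2) = Q at *
  generalize (4 * (S ^ 2 - a ^ 2) *
        (prof₂ ℓ p (3 / 2) (S ^ 2) - c * a * prof₂ ℓ (p + 1 / 2) (3 / 2) (S ^ 2)) +
        2 * d * (prof₁ ℓ p (3 / 2) (S ^ 2) -
          c * a * prof₁ ℓ (p + 1 / 2) (3 / 2) (S ^ 2))) = Lap at *
  rw [show ∑' w, J w = 1 - ε by linarith] at hrem
  have h1 := (abs_le.1 hrem).2
  have hσ0 : 0 < σ := hσ₀.trans_le hσ
  have h2 := mul_le_mul_of_nonneg_left hrad (show 0 ≤ σ / (2 * d) by positivity)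
  have h3 : (1 + C) * (S⁻¹ ^ 3 * P) ≤ σ / (2 * d) * ((d - 1) * c * a * (S⁻¹ ^ 3 * P)) := by
    calc _ ≤ σ₀ / (2 * d) * ((d - 1) * c * a) * (S⁻¹ ^ 3 * P) := by gcongr
      _ ≤ σ / (2 * d) * ((d - 1) * c * a) * (S⁻¹ ^ 3 * P) := by gcongr
      _ = _ := by ring
  have h4 : σ / (2 * d) * (B * (ℓ⁻¹ * P)) ≤ ε / 2 * P := by
    have : σ / (2 * d) * B ≤ L / 2 := by
      calc σ / (2 * d) * B ≤ σ₁ / (2 * d) * B := by gcongr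
        _ ≤ _ := by rw [hL]; linarith
    calc _ = (σ / (2 * d) * B) * (ℓ⁻¹ * P) := by ring
      _ ≤ L / 2 * (ℓ⁻¹ * P) := by gcongr
      _ = _ := by rw [hℓ]; field_simp
  have h5 : ε / 2 * P ≤ ε * (P - c * a * Q) := by
    have := mul_le_mul_of_nonneg_left hh.2 hε0.le
    linarith
  have h6 : σ / (2 * d) * Lap = -(σ / (2 * d) * -Lap) := by ring
  rw [mul_sub] at h2
  change _ - σ / (2 * d) * (B * (ℓ⁻¹ * P)) ≤ _ at h2
  change _ - _ - σ / (2 * d) * Lap ≤ _ at h1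
  linarith

end Supersolution

section Deconvolution

variable {X : Type*} [AddCommGroup X] {J G A : X → ℝ}

theorem summable_mul_mul_sub (hJ : Summable J) (hG : Summable G) {c : ℝ} (hA : ∀ x, |A x| ≤ c)
    (x : X) : Summable (Function.uncurry fun w y => J w * G y * A (x - y - w)) := by
  have h := (hJ.norm.mul_of_nonneg hG.norm (fun _ => norm_nonneg _) fun _ =>
    norm_nonneg _).mul_right c
  refine h.of_norm_bounded fun p => ?_
  rw [Function.uncurry, norm_mul, norm_mul]
  exact mul_le_mul_of_nonneg_left (hA _) (by positivity)

theorem summable_mul_sub (hG : Summable G) {c : ℝ} (hA : ∀ x, |A x| ≤ c) (x : X) :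
    Summable fun y => G y * A (x - y) := by
  refine (hG.norm.mul_right c).of_norm_bounded fun y => ?_
  rw [norm_mul]
  exact mul_le_mul_of_nonneg_left (hA _) (norm_nonneg _)

theorem hasSum_mul_sub_conv [DecidableEq X] (hJ : Summable J) (hG : Summable G) {c : ℝ}
    (hA : ∀ x, |A x| ≤ c)
    (h : ∀ x, G x = (if 0 = x then 1 else 0) + ∑' w, J w * G (x - w)) (x : X) :
    HasSum (fun y => G y * (A (x - y) - ∑' w, J w * A (x - y - w))) (A x) := by
  have hF := summable_mul_mul_sub hJ hG hA x
  have e : ∀ y, G y * (A (x - y) - ∑' w, J w * A (x - y - w)) =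
      G y * A (x - y) - ∑' w, J w * G y * A (x - y - w) := fun y => by
    rw [mul_sub, ← tsum_mul_left]
    congr 1
    exact tsum_congr fun w => by ring
  have hS : Summable fun y => ∑' w, J w * G y * A (x - y - w) := hF.prod_symm.prod
  have hGA := summable_mul_sub hG hA x
  have hF' : Summable (Function.uncurry fun w v => J w * G (v - w) * A (x - v)) := by
    let e : X × X ≃ X × X := Equiv.prodShear (Equiv.refl X) fun w => Equiv.subRight w
    refine (e.summable_iff.2 hF).congr fun p => ?_
    simp [e, Function.uncurry, show x - (p.2 - p.1) - p.1 = x - p.2 by abel]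
  have hv : ∀ v, ∑' w, J w * G (v - w) * A (x - v) =
      G v * A (x - v) - if 0 = v then A x else 0 := by
    intro v
    rw [tsum_mul_right]
    have := h v
    rw [show ∑' w, J w * G (v - w) = G v - if 0 = v then 1 else 0 by linarith]
    split_ifs with h0
    · subst h0; simp; ring
    · ring
  have hdouble : ∑' y, ∑' w, J w * G y * A (x - y - w) = ∑' y, G y * A (x - y) - A x := by
    rw [hF.tsum_comm]
    calc ∑' w, ∑' y, J w * G y * A (x - y - w) = ∑' w, ∑' v, J w * G (v - w) * A (x - v) := by
          refine tsum_congr fun w => ?_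
          rw [← (Equiv.subRight w).tsum_eq]
          exact tsum_congr fun v => by simp [show x - (v - w) - w = x - v by abel]
      _ = ∑' v, ∑' w, J w * G (v - w) * A (x - v) := hF'.tsum_comm.symm
      _ = ∑' v, (G v * A (x - v) - if 0 = v then A x else 0) := tsum_congr hv
      _ = _ := by
          rw [hGA.tsum_sub (summable_of_hasFiniteSupport (by
            refine (Set.finite_singleton (0 : X)).subset fun v hv => ?_
            by_contra hne
            exact hv (if_neg (Ne.symm hne)))), tsum_ite_eq' ]
  simp_rw [e]
  have := hGA.hasSum.sub hS.hasSum
  rwa [hdouble, sub_sub_cancel] at this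

theorem kernel_symm [DecidableEq X] (hJ : Summable J) (hG : Summable G)
    (h : ∀ x, G x = (if 0 = x then 1 else 0) + ∑' w, J w * G (x - w)) (τ : X ≃+ X)
    (hτ : ∀ x, G (τ x) = G x) (x : X) : J (τ x) = J x := by
  have hJτ : Summable fun w => J (τ w) := τ.toEquiv.summable_iff.2 hJ
  obtain ⟨c, hc⟩ : ∃ c, ∀ x, |J (τ x) - J x| ≤ c :=
    ⟨∑' x, |J (τ x) - J x|, fun x => (hJτ.sub hJ).abs.le_tsum x fun _ _ => abs_nonneg _⟩
  have hGb : ∀ x, |G x| ≤ ∑' x, |G x| := fun x => hG.abs.le_tsum x fun _ _ => abs_nonneg _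
  have hzero : ∀ x, ∑' y, G y * (J (τ (x - y)) - J (x - y)) = 0 := by
    intro x
    rw [← (Equiv.subLeft x).tsum_eq]
    simp only [Equiv.subLeft_apply, sub_sub_cancel]
    have h1 := summable_mul_sub hJ hGb x
    have h2 := summable_mul_sub hJτ hGb x
    have e1 : ∑' w, J (τ w) * G (x - w) = ∑' w, J w * G (τ x - w) := by
      rw [← τ.toEquiv.tsum_eq (fun w => J w * G (τ x - w))]
      exact tsum_congr fun w => by
        show _ = J (τ w) * G (τ x - τ w)
        rw [← map_sub, hτ]
    have e2 : ∑' w, J w * G (τ x - w) = ∑' w, J w * G (x - w) := by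
      have h3 := h (τ x)
      rw [hτ, h x] at h3
      have : (0 = τ x) ↔ 0 = x := by rw [eq_comm, map_eq_zero_iff τ τ.injective, eq_comm]
      simp only [this] at h3
      linarith
    calc _ = ∑' w, (J (τ w) * G (x - w) - J w * G (x - w)) := tsum_congr fun w => by ring
      _ = 0 := by rw [h2.tsum_sub h1, e1, e2, sub_self]
  have hmain := (hasSum_mul_sub_conv hJ hG hc h x).tsum_eq
  have hF := summable_mul_mul_sub hJ hG hc x
  have e : ∀ y, G y * ((J (τ (x - y)) - J (x - y)) -
      ∑' w, J w * (J (τ (x - y - w)) - J (x - y - w))) =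
      G y * (J (τ (x - y)) - J (x - y)) -
        ∑' w, J w * G y * (J (τ (x - y - w)) - J (x - y - w)) := fun y => by
    rw [mul_sub, ← tsum_mul_left]
    congr 1
    exact tsum_congr fun w => by ring
  simp_rw [e] at hmain
  have hS : Summable fun y => ∑' w, J w * G y * (J (τ (x - y - w)) - J (x - y - w)) :=
    hF.prod_symm.prod
  rw [(summable_mul_sub hG hc x).tsum_sub hS, hzero] at hmain
  have hdouble : ∑' y, ∑' w, J w * G y * (J (τ (x - y - w)) - J (x - y - w)) = 0 := by
    rw [hF.tsum_comm]
    refine (tsum_congr fun w => ?_).trans tsum_zero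
    calc _ = ∑' y, J w * (G y * (J (τ (x - w - y)) - J (x - w - y))) :=
          tsum_congr fun y => by rw [sub_right_comm]; ring
      _ = _ := by rw [tsum_mul_left, hzero, mul_zero]
  rw [hdouble] at hmain
  linarith

end Deconvolution

section

variable {d : ℕ}

theorem prof_le_decay (hd : 2 ≤ d) {a ℓ : ℝ} (ha : 1 ≤ a) (hℓ : 0 < ℓ) (x : Fin d → ℤ) :
    prof ℓ (d / 2 - 1) (3 / 2) (sqNorm x + a ^ 2) ≤ (2 * decay x) ^ (d - 2) * (√ℓ)⁻¹ ^ 3 ∧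
      prof ℓ (d / 2 - 1) (3 / 2) (sqNorm x + a ^ 2) ≤ (2 * (decay x : ℝ)) ^ (d + 1) := by
  have hx := sqNorm_nonneg x
  have hS2 := Real.sq_sqrt (show 0 ≤ sqNorm x + a ^ 2 by positivity)
  have hS0 : 0 < √(sqNorm x + a ^ 2) := Real.sqrt_pos.2 (by positivity)
  have hdec := inv_le_two_mul_decay ha x
  rw [← hS2]
  generalize √(sqNorm x + a ^ 2) = S at *
  rw [prof_sq_eq hd hℓ hS0]
  have hd0 : (0 : ℝ) ≤ decay x := (decay x).2
  constructor
  · gcongr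
    nlinarith
  · rw [show d + 1 = (d - 2) + 3 by omega, pow_add]
    gcongr
    refine le_trans ?_ hdec
    gcongr
    exact Real.le_sqrt_of_sq_le (by linarith)

theorem exists_deconvolution (hd : 4 < d) {J₀ σ₀ : ℝ} (hJ₀ : 0 ≤ J₀) (hσ₀ : 0 < σ₀) :
    ∃ M : ℝ, 0 ≤ M ∧ ∀ J G : (Fin d → ℤ) → ℝ,
      (∀ w, |J w| ≤ J₀ * (decay w : ℝ) ^ (d + 4)) → (∀ x, 0 ≤ G x) → Summable G →
      (∀ x, G (-x) = G x) → (∀ i x, G (coordFlip i x) = G x) →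
      (∀ i k x, G (coordSwap i k x) = G x) →
      (∀ x, G x = (if 0 = x then 1 else 0) + ∑' w, J w * G (x - w)) →
      σ₀ ≤ ∑' w, J w * sqNorm w → 1 ≤ ∑' x, G x →
      ∀ x, G x ≤ M * (decay x : ℝ) ^ (d - 2) ∧
        G x ≤ M * √(∑' x, G x) ^ 3 * (decay x : ℝ) ^ (d + 1) := by
  obtain ⟨a, L, ha, hL, H⟩ := exists_supersolution hd hJ₀ hσ₀
  refine ⟨2 ^ (d + 1) * (a ^ (d + 1) * (2 * a) ^ 3) * √L ^ 3, by positivity, ?_⟩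
  intro J G hJ hG hGs hneg hflip hswap h hσ hχ x
  have hJs : Summable J := summable_of_decay_bound (by omega) (by omega) hJ
  set χ := ∑' x, G x with hχdef
  have hε : χ * (1 - ∑' w, J w) = 1 := by
    have := (hasSum_mul_sub_conv (A := fun _ => 1) (c := 1) hJs hGs (by simp) h 0).tsum_eq
    simpa [tsum_mul_right] using this
  have hχ0 : 0 < χ := by linarith
  have hε' : 1 - ∑' w, J w = χ⁻¹ := eq_inv_of_mul_eq_one_right hε
  obtain ⟨A, hA, hA'⟩ := H J hJ (kernel_symm hJs hGs h (AddEquiv.neg _) hneg)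
    (fun i => kernel_symm hJs hGs h (coordFlip i) (hflip i))
    (fun i k => kernel_symm hJs hGs h (coordSwap i k) (hswap i k)) hσ _ rfl
    (by rw [hε']; positivity)
  rw [hε', div_inv_eq_mul] at hA hA'
  set ℓ := L * χ with hℓ
  have hℓ1 : 1 ≤ ℓ := one_le_mul_of_one_le_of_one_le hL hχ
  have hℓ0 : 0 < ℓ := by linarith
  have hdec : ∀ x : Fin d → ℤ, (decay x : ℝ) ≤ 1 := fun x => by exact_mod_cast decay_le_one x
  have hAb : ∀ x, |A x| ≤ 2 ^ (d + 1) := fun x => by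
    rw [abs_of_nonneg (hA x).1]
    refine ((hA x).2.trans (prof_le_decay (by omega) ha hℓ0 x).2).trans ?_
    have : (0 : ℝ) ≤ decay x := (decay x).2
    gcongr
    linarith [hdec x]
  have hsum := hasSum_mul_sub_conv hJs hGs hAb h x
  have hnn : ∀ y, 0 ≤ G y * (A (x - y) - ∑' w, J w * A (x - y - w)) := fun y =>
    mul_nonneg (hG y) (le_trans (mul_nonneg (by positivity)
      (prof_pos hℓ0 (by have := sqNorm_nonneg (x - y); positivity)).le) (hA' (x - y)))
  have hGA := le_hasSum hsum x fun y _ => hnn y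
  rw [sub_self] at hGA
  have h0 : (a ^ (d + 1) * (2 * a) ^ 3)⁻¹ * (√ℓ)⁻¹ ^ 3 ≤ A 0 - ∑' w, J w * A (0 - w) := by
    refine le_trans ?_ (hA' 0)
    have hs0 : sqNorm (0 : Fin d → ℤ) = 0 := by simp [sqNorm]
    rw [hs0, zero_add, Real.sqrt_sq (by linarith), prof_sq_eq (by omega) hℓ0 (by linarith)]
    have hle : √(a ^ 2 + ℓ) ≤ 2 * a * √ℓ := by
      rw [Real.sqrt_le_left (by positivity), mul_pow, Real.sq_sqrt hℓ0.le]
      nlinarith [mul_nonneg (sq_nonneg a) (sub_nonneg.2 hℓ1),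
        mul_nonneg hℓ0.le (sub_nonneg.2 (one_le_pow₀ ha (n := 2)))]
    have hpos : 0 < √(a ^ 2 + ℓ) := Real.sqrt_pos.2 (by positivity)
    calc _ = a⁻¹ ^ 3 * (a⁻¹ ^ (d - 2) * (2 * a * √ℓ)⁻¹ ^ 3) := by
          rw [show d + 1 = d - 2 + 3 by omega]
          simp only [mul_pow, mul_inv, inv_pow, pow_add]; ring
      _ ≤ _ := by gcongr
  have hmain : G x ≤ (a ^ (d + 1) * (2 * a) ^ 3) * √ℓ ^ 3 * A x := by
    have h1 := (mul_le_mul_of_nonneg_left h0 (hG x)).trans hGA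
    have hℓs : 0 < √ℓ := Real.sqrt_pos.2 hℓ0
    have hK : 0 < a ^ (d + 1) * (2 * a) ^ 3 := by positivity
    calc G x = (a ^ (d + 1) * (2 * a) ^ 3) * √ℓ ^ 3 *
          (G x * ((a ^ (d + 1) * (2 * a) ^ 3)⁻¹ * (√ℓ)⁻¹ ^ 3)) := by
          field_simp
      _ ≤ _ := by gcongr
  have hℓs : 0 < √ℓ := Real.sqrt_pos.2 hℓ0
  have hd0 : (0 : ℝ) ≤ decay x := (decay x).2
  have hL' : 1 ≤ √L ^ 3 := one_le_pow₀ (Real.one_le_sqrt.2 hL)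
  have hcan : √ℓ ^ 3 * (√ℓ)⁻¹ ^ 3 = 1 := by rw [← mul_pow, mul_inv_cancel₀ hℓs.ne', one_pow]
  obtain ⟨p1, p2⟩ := prof_le_decay (by omega) ha hℓ0 x
  constructor
  · calc G x ≤ (a ^ (d + 1) * (2 * a) ^ 3) * √ℓ ^ 3 * ((2 * decay x) ^ (d - 2) * (√ℓ)⁻¹ ^ 3) :=
          hmain.trans (by gcongr; exact (hA x).2.trans p1)
      _ = 2 ^ (d - 2) * (a ^ (d + 1) * (2 * a) ^ 3) * 1 * (decay x : ℝ) ^ (d - 2) := by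
          rw [mul_pow]
          linear_combination
            (2 ^ (d - 2) * (a ^ (d + 1) * (2 * a) ^ 3) * (decay x : ℝ) ^ (d - 2)) * hcan
      _ ≤ _ := by gcongr <;> first | omega | norm_num
  · calc G x ≤ (a ^ (d + 1) * (2 * a) ^ 3) * √ℓ ^ 3 * (2 * (decay x : ℝ)) ^ (d + 1) :=
          hmain.trans (by gcongr; exact (hA x).2.trans p2)
      _ = _ := by
          rw [hℓ, Real.sqrt_mul (by linarith), mul_pow, mul_pow]; ring

end

section Improvement

variable {d : ℕ}

theorem one_le_greenE_zero (b z : ℝ≥0∞) : 1 ≤ greenE d b z 0 := by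
  refine le_trans ?_ (ENNReal.le_tsum ([] : List (Fin d × Bool)))
  simp [endPt, selfWt]

theorem hasSum_stepCount_mul (f : (Fin d → ℤ) → ℝ) :
    HasSum (fun q => (stepCount d q : ℝ) * f q) (∑ e, f (wsawStep d e)) := by
  have h : ∀ q, (stepCount d q : ℝ) * f q =
      ∑ e, if q = wsawStep d e then f (wsawStep d e) else 0 := fun q => by
    simp only [stepCount, NNReal.coe_sum, Finset.sum_mul]
    refine Finset.sum_congr rfl fun e _ => ?_
    by_cases he : wsawStep d e = q
    · subst he; simp
    · simp [he, Ne.symm he]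
  simp_rw [h]
  exact hasSum_sum fun e _ => hasSum_ite_eq _ _

theorem norm_wsawStep (e : Fin d × Bool) : ‖wsawStep d e‖ = 1 := by
  refine le_antisymm ((pi_norm_le_iff_of_nonneg zero_le_one).2 fun i => ?_) ?_
  · unfold wsawStep; split_ifs <;> simp
  · refine le_trans ?_ (norm_le_pi_norm (wsawStep d e) e.1)
    simp only [wsawStep, if_true]; split_ifs <;> simp

theorem sqNorm_wsawStep (e : Fin d × Bool) : sqNorm (wsawStep d e) = 1 := by
  rw [sqNorm, Finset.sum_eq_single e.1]
  · simp only [wsawStep, if_true]; split_ifs <;> simp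
  · intro i _ hi; simp [wsawStep, hi]
  · simp

theorem stepCount_le (p : ℕ) (q : Fin d → ℤ) :
    (stepCount d q : ℝ) ≤ 2 * d * 2 ^ p * (decay q : ℝ) ^ p := by
  have hterm : ∀ e : Fin d × Bool, ((if wsawStep d e = q then 1 else 0 : ℝ≥0) : ℝ) ≤
      2 ^ p * (decay q : ℝ) ^ p := fun e => by
    split_ifs with he
    · rw [← he, coe_decay, norm_wsawStep, ← mul_pow]; norm_num
    · have : (0 : ℝ) ≤ decay q := (decay q).2
      simp only [NNReal.coe_zero]; positivity
  simp only [stepCount, NNReal.coe_sum]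
  refine (Finset.sum_le_sum fun e _ => hterm e).trans (le_of_eq ?_)
  simp; ring

theorem le_tsum_of_abs_sub_le {f g h : (Fin d → ℤ) → ℝ} {S T : ℝ} (hg : HasSum g S)
    (hh : HasSum h T) (hfg : ∀ x, |f x - g x| ≤ h x) : S - T ≤ ∑' x, f x := by
  have hsub : Summable fun x => f x - g x := hh.summable.of_norm_bounded hfg
  have hf : Summable f := (hsub.add hg.summable).congr fun x => by ring
  rw [← hg.tsum_eq, ← hh.tsum_eq, ← hg.summable.tsum_sub hh.summable]
  exact (hg.summable.sub hh.summable).tsum_le_tsum (fun x => by linarith [(abs_le.1 (hfg x)).1]) hf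

theorem exists_improved_bound (hd : 4 < d) : ∃ M₁ : ℝ, 0 ≤ M₁ ∧ ∀ M : ℝ≥0, ∃ β₁ : ℝ≥0,
    0 < β₁ ∧ β₁ ≤ 1 ∧ ∀ b z : ℝ≥0, b ≤ β₁ → 1 / (4 * d) ≤ (z : ℝ) →
      (∀ x, greenE d b z x ≤ M * (decay x : ℝ≥0∞) ^ (d - 2)) → ∑' x, greenE d b z x ≠ ∞ →
      ∀ x, (greenE d b z x).toReal ≤ M₁ * (decay x : ℝ) ^ (d - 2) ∧
        (greenE d b z x).toReal ≤
          M₁ * √(∑' x, greenE d b z x).toReal ^ 3 * (decay x : ℝ) ^ (d + 1) := by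
  have hdR : (5 : ℝ) ≤ d := by exact_mod_cast hd
  obtain ⟨M₁, hM₁, HM⟩ := exists_deconvolution (d := d) hd (J₀ := 2 * d * 2 ^ (d + 4) + 1)
    (σ₀ := 1 / 4) (by positivity) (by norm_num)
  refine ⟨M₁, hM₁, fun M => ?_⟩
  obtain ⟨β₂, C, hβ₂, hβ₂1, HK⟩ := exists_kernel hd M
  obtain ⟨K, hK, HS⟩ := exists_summable_decay (d := d) (by omega)
  refine ⟨min β₂ (C * (1 + K.toNNReal) + 1)⁻¹, by positivity, (min_le_left _ _).trans hβ₂1, ?_⟩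
  intro b z hb hz hG hfin
  have hbC : (b : ℝ) * (C * (1 + K)) ≤ 1 := by
    have h1 : (b : ℝ) ≤ (C * (1 + K) + 1)⁻¹ := by
      have := hb.trans (min_le_right _ _)
      have := NNReal.coe_le_coe.2 this
      simpa [Real.coe_toNNReal K hK] using this
    have hC : (0 : ℝ) ≤ C * (1 + K) := by positivity
    calc (b : ℝ) * (C * (1 + K)) ≤ (C * (1 + K) + 1)⁻¹ * (C * (1 + K) + 1) := by
          gcongr; linarith
      _ = 1 := inv_mul_cancel₀ (by positivity)
  have hbC0 : (0 : ℝ) ≤ b * C := by positivity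
  have hbC1 : (b : ℝ) * C ≤ 1 := by nlinarith [mul_nonneg hbC0 hK]
  have hbCK : (b : ℝ) * C * K ≤ 1 := by nlinarith [mul_nonneg hbC0 hK]
  obtain ⟨J, hJ, hconv⟩ := HK b z (hb.trans (min_le_left _ _)) hG hfin
  have hz0 : (0 : ℝ) < z := lt_of_lt_of_le (by positivity) hz
  have hne : ∀ x, greenE d b z x ≠ ∞ := fun x => ne_top_of_le_ne_top hfin (ENNReal.le_tsum x)
  have hχeq := ENNReal.tsum_toReal_eq hne
  have hGs : Summable fun x => (greenE d b z x).toReal := ENNReal.summable_toReal hfin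
  have hχ1 : 1 ≤ ∑' x, (greenE d b z x).toReal := by
    rw [← hχeq, ← ENNReal.toReal_one]
    exact ENNReal.toReal_mono hfin ((one_le_greenE_zero _ _).trans (ENNReal.le_tsum 0))
  obtain ⟨hs4, hs4'⟩ := HS (d + 4) (by omega)
  obtain ⟨hs2, hs2'⟩ := HS (d + 2) (by omega)
  have hcard : ∑ _e : Fin d × Bool, (1 : ℝ) = 2 * d := by simp; ring
  have hJs : Summable J := by
    have h1 : Summable fun q => J q - z * stepCount d q :=
      summable_of_decay_bound (p := d + 4) (by omega) (by omega) hJ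
    have h2 := ((hasSum_stepCount_mul (d := d) fun _ => 1).mul_left (z : ℝ)).summable
    exact (h1.add h2).congr fun q => by ring
  have hJsum : z * (2 * d) - b * z * C * ∑' u : Fin d → ℤ, (decay u : ℝ) ^ (d + 4) ≤ ∑' q, J q := by
    refine le_tsum_of_abs_sub_le ?_ (hs4.hasSum.mul_left _) hJ
    simpa [hcard] using (hasSum_stepCount_mul (d := d) fun _ => 1).mul_left (z : ℝ)
  have hε : (∑' x, (greenE d b z x).toReal) * (1 - ∑' w, J w) = 1 := by
    have := (hasSum_mul_sub_conv (A := fun _ => 1) (c := 1) hJs hGs (by simp) hconv 0).tsum_eq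
    simpa [tsum_mul_right] using this
  have hJ1 : ∑' w, J w ≤ 1 := by
    by_contra hlt
    nlinarith
  have hz1 : (z : ℝ) ≤ 1 := by
    have h1 : (b : ℝ) * z * C * ∑' u : Fin d → ℤ, (decay u : ℝ) ^ (d + 4) ≤ z * 1 := by
      calc _ ≤ (b : ℝ) * z * C * K := by gcongr
        _ = z * (b * C * K) := by ring
        _ ≤ z * 1 := by gcongr
    nlinarith
  have hJ' : ∀ w, |J w| ≤ (2 * d * 2 ^ (d + 4) + 1) * (decay w : ℝ) ^ (d + 4) := fun w => by
    have h1 := hJ w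
    have hw : (0 : ℝ) ≤ (decay w : ℝ) ^ (d + 4) := by positivity
    have h2 : (b : ℝ) * z * C * (decay w : ℝ) ^ (d + 4) ≤ 1 * (decay w : ℝ) ^ (d + 4) := by
      gcongr
      calc (b : ℝ) * z * C = b * C * z := by ring
        _ ≤ 1 * 1 := by gcongr
        _ = 1 := one_mul 1
    have h3 : (z : ℝ) * stepCount d w ≤ 1 * (2 * d * 2 ^ (d + 4) * (decay w : ℝ) ^ (d + 4)) := by
      gcongr; exact stepCount_le (d + 4) w
    have h4 : 0 ≤ (z : ℝ) * stepCount d w := by positivity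
    rw [abs_le] at h1 ⊢
    constructor <;> nlinarith
  have hσ : 1 / 4 ≤ ∑' w, J w * sqNorm w := by
    have h1 := le_tsum_of_abs_sub_le (f := fun w => J w * sqNorm w)
      ((hasSum_stepCount_mul (d := d) sqNorm).mul_left (z : ℝ))
      (hs2.hasSum.mul_left ((b : ℝ) * z * C * d)) fun w => by
        have := abs_mul_sqNorm_le (J := fun w => J w - z * stepCount d w) hJ w
        rwa [sub_mul, mul_assoc (z : ℝ)] at this
    simp only [sqNorm_wsawStep, hcard] at h1
    have h2 : (b : ℝ) * z * C * d * ∑' u : Fin d → ℤ, (decay u : ℝ) ^ (d + 2) ≤ z * d := by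
      calc _ ≤ (b : ℝ) * z * C * d * K := by gcongr
        _ = z * d * (b * C * K) := by ring
        _ ≤ z * d * 1 := by gcongr
        _ = _ := mul_one _
    have h3 : 1 / 4 ≤ (z : ℝ) * d := by
      rw [div_le_iff₀ (by positivity)] at hz; linarith
    linarith
  have hmain := HM J (fun x => (greenE d b z x).toReal) hJ' (fun x => ENNReal.toReal_nonneg) hGs
    (fun x => by simp only [greenE_neg]) (fun i x => by simp only [greenE_flip])
    (fun i k x => by simp only [greenE_swap]) hconv hσ hχ1
  rwa [← hχeq] at hmain

end Improvement

section Bootstrap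

variable {d : ℕ} {β μ z : ℝ}

theorem wsawWeight_le_one (hβ : 0 ≤ β) (hβ' : β ≤ 1) (n : ℕ) (s : Fin n → Fin d × Bool) :
    wsawWeight β n s ≤ 1 :=
  Finset.prod_le_one (fun k _ => by split_ifs <;> linarith) fun k _ => by split_ifs <;> linarith

theorem cZ_le (hβ : 0 ≤ β) (hβ' : β ≤ 1) (n : ℕ) : cZ d β n ≤ (2 * d) ^ n := by
  refine (Finset.sum_le_sum fun s _ => wsawWeight_le_one hβ hβ' n s).trans (le_of_eq ?_)
  simp [mul_comm]

theorem norm_wsawPos_le {n : ℕ} (s : Fin n → Fin d × Bool) (k : ℕ) : ‖wsawPos s k‖ ≤ n := by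
  refine (norm_sum_le _ _).trans ?_
  simp only [norm_wsawStep, Finset.sum_const, nsmul_eq_mul, mul_one]
  exact_mod_cast (Finset.card_filter_le _ _).trans (by simp)

theorem cZx_le_cZ (hβ' : β ≤ 1) (n : ℕ) (x : Fin d → ℤ) : cZx d β n x ≤ cZ d β n :=
  Finset.sum_le_sum_of_subset_of_nonneg (Finset.filter_subset _ _)
    fun s _ _ => wsawWeight_nonneg hβ' n s

theorem cZx_le_mul_decay_pow (hβ' : β ≤ 1) (n p : ℕ) (x : Fin d → ℤ) :
    cZx d β n x ≤ cZ d β n * ((1 + n) ^ p * (decay x : ℝ) ^ p) := by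
  have hd0 : (0 : ℝ) ≤ decay x := (decay x).2
  rcases le_or_gt ‖x‖ n with hx | hx
  · have h : (1 : ℝ) ≤ (1 + n) * decay x := by
      rw [coe_decay, ← div_eq_mul_inv, one_le_div (by positivity)]
      linarith
    rw [← mul_pow]
    exact (cZx_le_cZ hβ' n x).trans (le_mul_of_one_le_right (cZ_nonneg hβ' n) (one_le_pow₀ h))
  · have h0 : cZx d β n x = 0 := Finset.sum_eq_zero fun s hs => by
      rw [← (Finset.mem_filter.1 hs).2] at hx
      exact absurd (norm_wsawPos_le s n) hx.not_ge
    have := cZ_nonneg (d := d) hβ' n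
    rw [h0]
    positivity

theorem summable_one_add_pow_mul_geometric (p : ℕ) {ρ : ℝ} (hρ : 0 ≤ ρ) (hρ' : ρ < 1) :
    Summable fun n : ℕ => (1 + n : ℝ) ^ p * ρ ^ n := by
  rcases hρ.eq_or_lt with rfl | hρ0
  · exact summable_of_ne_finset_zero (s := {0}) fun n hn => by
      rw [zero_pow (by simpa using hn), mul_zero]
  have h := (summable_nat_add_iff 1).2
    (summable_pow_mul_geometric_of_norm_lt_one p (r := ρ) (by rwa [Real.norm_of_nonneg hρ]))
  refine (h.mul_left ρ⁻¹).congr fun n => ?_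
  push_cast
  rw [pow_succ]
  field_simp
  ring

theorem Gpt_le_of_le (hd : 0 < d) (hβ : 0 ≤ β) (hβ' : β ≤ 1) (hz : 0 ≤ z) (hz' : z ≤ 1 / (4 * d))
    (p : ℕ) (x : Fin d → ℤ) :
    Gpt d β z x ≤ (∑' n : ℕ, (1 + n : ℝ) ^ p * (1 / 2) ^ n) * (decay x : ℝ) ^ p := by
  have hs := (summable_one_add_pow_mul_geometric p (ρ := 1 / 2) (by norm_num)
    (by norm_num)).mul_right
    ((decay x : ℝ) ^ p)
  have hle : ∀ n, cZx d β n x * z ^ n ≤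
      (1 + n : ℝ) ^ p * (1 / 2) ^ n * (decay x : ℝ) ^ p := fun n => by
    have hd0 : (0 : ℝ) ≤ decay x := (decay x).2
    have h1 : cZ d β n * z ^ n ≤ (1 / 2) ^ n := by
      calc _ ≤ (2 * d : ℝ) ^ n * (1 / (4 * d)) ^ n := by
            gcongr; exact cZ_le hβ hβ' n
        _ = _ := by
            rw [← mul_pow]; congr 1
            have : (d : ℝ) ≠ 0 := by exact_mod_cast hd.ne'
            field_simp; norm_num
    calc _ ≤ cZ d β n * ((1 + n) ^ p * (decay x : ℝ) ^ p) * z ^ n := by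
          gcongr; exact cZx_le_mul_decay_pow hβ' n p x
      _ = (cZ d β n * z ^ n) * ((1 + n) ^ p * (decay x : ℝ) ^ p) := by ring
      _ ≤ (1 / 2) ^ n * ((1 + n) ^ p * (decay x : ℝ) ^ p) := by gcongr
      _ = _ := by ring
  rw [← tsum_mul_right]
  refine Summable.tsum_le_tsum hle (hs.of_nonneg_of_le (fun n => ?_) hle) hs
  exact mul_nonneg (cZx_nonneg hβ' n x) (pow_nonneg hz n)

theorem HasGrowthConst.summable (hβ : 0 ≤ β) (hβ' : β ≤ 1) (hμ : HasGrowthConst d β μ)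
    (hz : 0 < z) (hzμ : z < μ⁻¹) : Summable fun n => cZ d β n * z ^ n := by
  have h := hμ.tsum_ne_top hβ hβ' hz hzμ
  rw [tsum_greenE_eq hβ hβ' hz.le] at h
  exact (ENNReal.summable_toReal h).congr fun n =>
    ENNReal.toReal_ofReal (mul_nonneg (cZ_nonneg hβ' n) (pow_nonneg hz.le n))

theorem summable_cZx (hβ' : β ≤ 1) (hz : 0 ≤ z) (h : Summable fun n => cZ d β n * z ^ n)
    (x : Fin d → ℤ) : Summable fun n => cZx d β n x * z ^ n :=
  h.of_nonneg_of_le (fun n => mul_nonneg (cZx_nonneg hβ' n x) (pow_nonneg hz n)) fun n =>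
    mul_le_mul_of_nonneg_right (cZx_le_cZ hβ' n x) (pow_nonneg hz n)

theorem pow_sub_pow_le_mul {a b : ℝ} (ha : 0 ≤ a) (_hab : a ≤ b) (hb : 0 < b) (n : ℕ) :
    b ^ n ≤ a ^ n + (b - a) * (n / b * b ^ n) := by
  have h := one_add_mul_le_pow (a := (a - b) / b) (by
    rw [le_div_iff₀ hb]; linarith) n
  have h2 : (1 + (a - b) / b) ^ n * b ^ n = a ^ n := by
    rw [← mul_pow]; congr 1; field_simp; ring
  have h3 := mul_le_mul_of_nonneg_right h (pow_nonneg hb.le n)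
  rw [h2] at h3
  calc b ^ n = (1 + n * ((a - b) / b)) * b ^ n + (b - a) * (n / b * b ^ n) := by ring
    _ ≤ _ := by gcongr

theorem exists_Gpt_lipschitz (hβ : 0 ≤ β) (hβ' : β ≤ 1) (hμ : HasGrowthConst d β μ) {z₀ z₁ : ℝ}
    (hz₀ : 0 < z₀) (hz₁ : z₁ < μ⁻¹) (p : ℕ) : ∃ L : ℝ, 0 ≤ L ∧ ∀ w z, z₀ ≤ w → w ≤ z → z ≤ z₁ →
      ∀ x, Gpt d β z x ≤ Gpt d β w x + (z - w) * L * (decay x : ℝ) ^ p := by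
  rcases lt_or_ge z₁ z₀ with h01 | h01
  · exact ⟨0, le_rfl, fun w z h1 h2 h3 => by linarith⟩
  obtain ⟨z₂, hz₂, hz₂μ⟩ := exists_between hz₁
  have hz₂0 : 0 < z₂ := by linarith
  have hz₁0 : 0 < z₁ := by linarith
  have hs₂ := hμ.summable hβ hβ' hz₂0 hz₂μ
  have hsρ := summable_one_add_pow_mul_geometric (p + 1) (ρ := z₁ / z₂) (by positivity)
    ((div_lt_one hz₂0).2 hz₂)
  set χ := ∑' n, cZ d β n * z₂ ^ n
  have hterm : ∀ n, 0 ≤ cZ d β n * z₂ ^ n := fun n =>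
    mul_nonneg (cZ_nonneg hβ' n) (pow_nonneg hz₂0.le n)
  have hχ : 0 ≤ χ := tsum_nonneg hterm
  have hχn : ∀ n, cZ d β n * z₂ ^ n ≤ χ := fun n => hs₂.le_tsum n fun m _ => hterm m
  refine ⟨χ / z₀ * ∑' n : ℕ, (1 + n : ℝ) ^ (p + 1) * (z₁ / z₂) ^ n,
    mul_nonneg (by positivity) (tsum_nonneg fun n => by positivity), fun w z hw hwz hz x => ?_⟩
  have hd0 : (0 : ℝ) ≤ decay x := (decay x).2
  have hw0 : 0 < w := by linarith
  have hz0 : 0 < z := by linarith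
  have hsw := summable_cZx hβ' hw0.le (hμ.summable hβ hβ' hw0 (by linarith)) x
  have hsz := summable_cZx hβ' hz0.le (hμ.summable hβ hβ' hz0 (by linarith)) x
  have hle : ∀ n, cZx d β n x * z ^ n ≤ cZx d β n x * w ^ n + (z - w) * (χ / z₀) *
      (decay x : ℝ) ^ p * ((1 + n : ℝ) ^ (p + 1) * (z₁ / z₂) ^ n) := fun n => by
    have hc := cZx_nonneg (d := d) hβ' n x
    have hc' := cZ_nonneg (d := d) hβ' n
    have hzw : 0 ≤ z - w := by linarith
    have h1 := mul_le_mul_of_nonneg_left (pow_sub_pow_le_mul hw0.le hwz hz0 n) hc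
    have h2 : (n : ℝ) / z * z ^ n ≤ (1 + n) / z₀ * z₁ ^ n := by
      gcongr <;> linarith
    calc _ ≤ cZx d β n x * (w ^ n + (z - w) * (n / z * z ^ n)) := h1
      _ = cZx d β n x * w ^ n + (z - w) * (cZx d β n x * (n / z * z ^ n)) := by ring
      _ ≤ cZx d β n x * w ^ n + (z - w) * ((cZ d β n * ((1 + n) ^ p * (decay x : ℝ) ^ p)) *
          ((1 + n) / z₀ * z₁ ^ n)) := by
          gcongr; exact cZx_le_mul_decay_pow hβ' n p x
      _ = cZx d β n x * w ^ n + (z - w) * (1 / z₀) * (decay x : ℝ) ^ p * ((1 + n : ℝ) ^ (p + 1) *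
          (z₁ / z₂) ^ n) * (cZ d β n * z₂ ^ n) := by
          rw [div_pow]; field_simp; ring
      _ ≤ cZx d β n x * w ^ n + (z - w) * (1 / z₀) * (decay x : ℝ) ^ p * ((1 + n : ℝ) ^ (p + 1) *
          (z₁ / z₂) ^ n) * χ := by
          gcongr; exact hχn n
      _ = _ := by ring
  have hs := hsρ.mul_left ((z - w) * (χ / z₀) * (decay x : ℝ) ^ p)
  calc Gpt d β z x ≤ ∑' n, (cZx d β n x * w ^ n + (z - w) * (χ / z₀) *
        (decay x : ℝ) ^ p * ((1 + n : ℝ) ^ (p + 1) * (z₁ / z₂) ^ n)) :=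
        hsz.tsum_le_tsum hle (hsw.add hs)
    _ = _ := by
        rw [hsw.tsum_add hs, tsum_mul_left, Gpt]; ring

theorem one_le_chiR (hβ : 0 ≤ β) (hβ' : β ≤ 1) (hμ : HasGrowthConst d β μ)
    (hz : 0 < z) (hzμ : z < μ⁻¹) : 1 ≤ chiR d β z := by
  rw [chiR_eq hβ hβ' hz.le, ← ENNReal.toReal_one]
  exact ENNReal.toReal_mono (hμ.tsum_ne_top hβ hβ' hz hzμ)
    ((one_le_greenE_zero _ _).trans (ENNReal.le_tsum 0))

theorem exists_Gpt_le (hd : 4 < d) : ∃ β₀ M : ℝ, 0 < β₀ ∧ β₀ ≤ 1 ∧ 0 < M ∧ ∀ β, 0 < β → β ≤ β₀ →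
    ∀ μ, HasGrowthConst d β μ → ∀ z, 0 < z → z < μ⁻¹ → ∀ x : Fin d → ℤ,
      Gpt d β z x ≤ M * (decay x : ℝ) ^ (d - 2) ∧
        Gpt d β z x ≤ M * √(chiR d β z) ^ 3 * (decay x : ℝ) ^ (d + 1) := by
  obtain ⟨M₁, hM₁, H⟩ := exists_improved_bound hd
  set M₀ : ℝ := ∑' n : ℕ, (1 + n : ℝ) ^ (d + 1) * (1 / 2) ^ n
  have hM₀ : 0 ≤ M₀ := tsum_nonneg fun n => by positivity
  set M : ℝ := M₁ + M₀ + 1 with hM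
  have hM0 : 0 < M := by positivity
  obtain ⟨β₁, hβ₁, hβ₁1, Hβ⟩ := H (2 * M).toNNReal
  refine ⟨β₁, M, hβ₁, hβ₁1, hM0, fun β hβ hββ₁ μ hμ => ?_⟩
  have hβ' : β ≤ 1 := hββ₁.trans hβ₁1
  set z₀ : ℝ := 1 / (4 * d) with hz₀
  have hz₀0 : 0 < z₀ := by
    have : 0 < d := by omega
    positivity
  have hdec : ∀ x : Fin d → ℤ, (0 : ℝ) ≤ decay x ∧ (decay x : ℝ) ≤ 1 := fun x =>
    ⟨(decay x).2, by exact_mod_cast decay_le_one x⟩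
  have hbase : ∀ z, 0 < z → z ≤ z₀ → ∀ x : Fin d → ℤ,
      Gpt d β z x ≤ M₀ * (decay x : ℝ) ^ (d + 1) := fun z hz hz' x =>
    Gpt_le_of_le (by omega) hβ.le hβ' hz.le hz' (d + 1) x
  have hbase' : ∀ z, 0 < z → z ≤ z₀ → ∀ x : Fin d → ℤ,
      Gpt d β z x ≤ M * (decay x : ℝ) ^ (d - 2) := fun z hz hz' x => by
    have h0 := (hdec x).1
    refine (hbase z hz hz' x).trans (mul_le_mul (by linarith)
      (pow_le_pow_of_le_one h0 (hdec x).2 (by omega)) (by positivity) hM0.le)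
  have himp : ∀ z, z₀ ≤ z → z < μ⁻¹ →
      (∀ x : Fin d → ℤ, Gpt d β z x ≤ 2 * M * (decay x : ℝ) ^ (d - 2)) → ∀ x : Fin d → ℤ,
      Gpt d β z x ≤ M₁ * (decay x : ℝ) ^ (d - 2) ∧
        Gpt d β z x ≤ M₁ * √(chiR d β z) ^ 3 * (decay x : ℝ) ^ (d + 1) := by
    intro z hzz₀ hzμ hle x
    have hz : 0 < z := by linarith
    have hfin := hμ.tsum_ne_top hβ.le hβ' hz hzμ
    have := Hβ β.toNNReal z.toNNReal (Real.toNNReal_le_iff_le_coe.2 hββ₁)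
      (by rwa [Real.coe_toNNReal z hz.le]) (fun y => ?_) hfin x
    · rw [Gpt_eq hβ.le hβ' hz.le, chiR_eq hβ.le hβ' hz.le]
      exact this
    · have hne := ne_top_of_le_ne_top hfin (ENNReal.le_tsum y)
      have hy := hle y
      rw [Gpt_eq hβ.le hβ' hz.le] at hy
      refine (ENNReal.toReal_le_toReal hne (by finiteness)).1 (hy.trans (le_of_eq ?_))
      simp [Real.coe_toNNReal (2 * M) (by positivity)]
  have hall : ∀ z₁, z₁ < μ⁻¹ → ∀ z, z₀ ≤ z → z ≤ z₁ → ∀ x : Fin d → ℤ,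
      Gpt d β z x ≤ M * (decay x : ℝ) ^ (d - 2) := by
    intro z₁ hz₁
    obtain ⟨L, hL, HL⟩ := exists_Gpt_lipschitz hβ.le hβ' hμ hz₀0 hz₁ (d - 2)
    set δ : ℝ := M / (L + 1) with hδ
    have hδ0 : 0 < δ := by positivity
    have hδL : δ * L ≤ M := by
      rw [hδ, div_mul_eq_mul_div, div_le_iff₀ (by positivity)]
      nlinarith
    have hind : ∀ k : ℕ, ∀ z, z₀ ≤ z → z ≤ z₁ → z ≤ z₀ + k * δ → ∀ x : Fin d → ℤ,
        Gpt d β z x ≤ M * (decay x : ℝ) ^ (d - 2) := by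
      intro k
      induction k with
      | zero =>
        intro z h1 _ h3 x
        exact hbase' z (by linarith) (by simpa using h3) x
      | succ k ih =>
        intro z h1 h2 h3 x
        have hk : (0 : ℝ) ≤ k * δ := by positivity
        push_cast at h3
        have hw : max z₀ (z - δ) ≤ z := max_le h1 (by linarith)
        have hw' : max z₀ (z - δ) ≤ z₀ + k * δ := max_le (by linarith) (by linarith)
        have hw'' : z - max z₀ (z - δ) ≤ δ := by linarith [le_max_right z₀ (z - δ)]
        refine ((himp z h1 (by linarith) (fun y => ?_) x).1).trans ?_
        · have h0 := (hdec y).1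
          calc _ ≤ _ := HL _ z (le_max_left _ _) hw h2 y
            _ ≤ M * (decay y : ℝ) ^ (d - 2) + δ * L * (decay y : ℝ) ^ (d - 2) := by
              gcongr
              exact ih _ (le_max_left _ _) (hw.trans h2) hw' y
            _ ≤ M * (decay y : ℝ) ^ (d - 2) + M * (decay y : ℝ) ^ (d - 2) := by gcongr
            _ = _ := by ring
        · have h0 := (hdec x).1
          gcongr
          linarith
    intro z h1 h2 x
    obtain ⟨k, hk⟩ := exists_nat_ge ((z - z₀) / δ)
    refine hind k z h1 h2 ?_ x
    rw [div_le_iff₀ hδ0] at hk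
    linarith
  intro z hz hzμ x
  have h0 := (hdec x).1
  rcases le_total z z₀ with hzz | hzz
  · refine ⟨hbase' z hz hzz x, (hbase z hz hzz x).trans ?_⟩
    have h1 : 1 ≤ √(chiR d β z) ^ 3 :=
      one_le_pow₀ (Real.one_le_sqrt.2 (one_le_chiR hβ.le hβ' hμ hz hzμ))
    gcongr
    nlinarith
  · refine ⟨hall z hzμ z hzz le_rfl x, ((himp z hzz hzμ (fun y => ?_) x).2).trans ?_⟩
    · have h0 := (hdec y).1
      refine (hall z hzμ z hzz le_rfl y).trans ?_
      gcongr
      linarith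
    · gcongr
      linarith

end Bootstrap

section Torus

variable {d r : ℕ}

/-- The convolution of two functions on the lattice. -/
noncomputable def latConv (f g : (Fin d → ℤ) → ℝ≥0∞) (x : Fin d → ℤ) : ℝ≥0∞ :=
  ∑' y, f (x - y) * g y

/-- The sum of `f` over the translates of `y` by multiples of `r`. -/
noncomputable def periodize (r : ℕ) (f : (Fin d → ℤ) → ℝ≥0∞) (y : Fin d → ℤ) : ℝ≥0∞ :=
  ∑' u : Fin d → ℤ, f (y + (r : ℤ) • u)

/-- The part of `f` supported at sup distance at least `r / 6` from the origin. -/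
noncomputable def farPart (r : ℕ) (f : (Fin d → ℤ) → ℝ≥0∞) (v : Fin d → ℤ) : ℝ≥0∞ :=
  if (r : ℝ) ≤ 6 * ‖v‖ then f v else 0

/-- The centred representative of a torus point. -/
def torusRep (t : Fin d → ZMod r) : Fin d → ℤ := fun i => repC r (t i)

lemma latConv_comm (f g : (Fin d → ℤ) → ℝ≥0∞) : latConv f g = latConv g f := by
  ext x
  rw [latConv, ← (Equiv.subLeft x).tsum_eq]
  simp [latConv, mul_comm]

lemma tsum_latConv (f g : (Fin d → ℤ) → ℝ≥0∞) :
    ∑' x, latConv f g x = (∑' x, f x) * ∑' x, g x := by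
  simp only [latConv]
  rw [ENNReal.tsum_comm, ← ENNReal.tsum_mul_left]
  refine tsum_congr fun y => ?_
  rw [ENNReal.tsum_mul_right, ← (Equiv.subRight y).tsum_eq f]
  rfl

lemma periodize_latConv (f g : (Fin d → ℤ) → ℝ≥0∞) (y : Fin d → ℤ) :
    periodize r (latConv f g) y = ∑' w, periodize r f (y - w) * g w := by
  simp only [periodize, latConv, ← ENNReal.tsum_mul_right]
  rw [ENNReal.tsum_comm]
  exact tsum_congr fun w => tsum_congr fun u => by rw [add_sub_right_comm]

lemma periodize_latConv_le {f : (Fin d → ℤ) → ℝ≥0∞} (g : (Fin d → ℤ) → ℝ≥0∞) {κ : ℝ≥0∞}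
    (hf : ∀ y, periodize r f y ≤ κ) (y : Fin d → ℤ) :
    periodize r (latConv f g) y ≤ κ * ∑' w, g w := by
  rw [periodize_latConv, ← ENNReal.tsum_mul_left]
  exact ENNReal.tsum_le_tsum fun w => mul_le_mul_left (hf _) _

lemma periodize_le_tsum (hr : r ≠ 0) (f : (Fin d → ℤ) → ℝ≥0∞) (y : Fin d → ℤ) :
    periodize r f y ≤ ∑' v, f v :=
  ENNReal.tsum_comp_le_tsum_of_injective (f := fun u : Fin d → ℤ => y + (r : ℤ) • u)
    (fun _ _ h => smul_right_injective _ (Int.natCast_ne_zero.2 hr) (add_left_cancel h)) f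

lemma periodize_congr (f : (Fin d → ℤ) → ℝ≥0∞) {y y' : Fin d → ℤ}
    (h : ∀ i, (y i : ZMod r) = y' i) : periodize r f y = periodize r f y' := by
  have h' : ∀ i, ∃ c : ℤ, y' i - y i = r * c := fun i =>
    (ZMod.intCast_eq_intCast_iff_dvd_sub _ _ r).1 (h i)
  choose w hw using h'
  rw [periodize, ← (Equiv.addRight w).tsum_eq]
  refine tsum_congr fun u => congrArg f (funext fun i => ?_)
  have := hw i
  simp only [Equiv.coe_addRight, Pi.add_apply, Pi.smul_apply, smul_eq_mul]
  linarith

lemma torusRep_cast [NeZero r] (t : Fin d → ZMod r) (i : Fin d) :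
    ((torusRep t i : ℤ) : ZMod r) = t i := by
  unfold torusRep repC
  split_ifs <;> simp

lemma two_mul_norm_torusRep_le [NeZero r] (t : Fin d → ZMod r) : 2 * ‖torusRep t‖ ≤ r := by
  have : ‖torusRep t‖ ≤ r / 2 := by
    rw [pi_norm_le_iff_of_nonneg (by positivity)]
    intro i
    have h : |2 * torusRep t i| ≤ r := by
      have := ZMod.val_lt (t i)
      unfold torusRep repC
      split_ifs <;> rw [abs_le] <;> constructor <;> omega
    have h' : |2 * (torusRep t i : ℝ)| ≤ r := by exact_mod_cast h
    rw [abs_mul, abs_two] at h'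
    rw [Int.norm_eq_abs]
    linarith
  linarith

lemma norm_natCast_smul (r : ℕ) (u : Fin d → ℤ) : ‖(r : ℤ) • u‖ = r * ‖u‖ := by
  rw [norm_smul]; simp

lemma mul_norm_le_of_torusRep [NeZero r] (t : Fin d → ZMod r) (u : Fin d → ℤ) :
    2 * (r * ‖u‖) ≤ 2 * ‖torusRep t + (r : ℤ) • u‖ + r := by
  have h := norm_sub_le (torusRep t + (r : ℤ) • u) (torusRep t)
  rw [add_sub_cancel_left, norm_natCast_smul] at h
  linarith [two_mul_norm_torusRep_le t]

lemma one_le_norm_of_ne_zero {u : Fin d → ℤ} (hu : u ≠ 0) : 1 ≤ ‖u‖ := by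
  by_contra! h
  have := norm_le_of_lt_add_one (m := 0) (u := u) (by simpa using h)
  exact hu (norm_le_zero_iff.1 (by simpa using this))

lemma le_two_mul_norm_torusRep_add [NeZero r] (t : Fin d → ZMod r) {u : Fin d → ℤ}
    (hu : u ≠ 0) : (r : ℝ) ≤ 2 * ‖torusRep t + (r : ℤ) • u‖ := by
  have h := mul_norm_le_of_torusRep t u
  nlinarith [one_le_norm_of_ne_zero hu, (Nat.cast_nonneg r : (0 : ℝ) ≤ r)]

lemma torusRep_add_bijective [NeZero r] : Function.Bijective
    fun p : (Fin d → ZMod r) × (Fin d → ℤ) => torusRep p.1 + (r : ℤ) • p.2 := by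
  constructor
  · rintro ⟨t, u⟩ ⟨t', u'⟩ h
    have ht : t = t' := funext fun i => by
      have := congrArg (fun v : Fin d → ℤ => ((v i : ℤ) : ZMod r)) h
      simpa [torusRep_cast] using this
    subst ht
    exact Prod.ext rfl (smul_right_injective _ (Int.natCast_ne_zero.2 (NeZero.ne r))
      (add_left_cancel h))
  · intro y
    have h' : ∀ i, ∃ c : ℤ, y i - torusRep (fun i => ((y i : ℤ) : ZMod r)) i = r * c := fun i =>
      (ZMod.intCast_eq_intCast_iff_dvd_sub _ _ r).1 (torusRep_cast _ i)
    choose w hw using h'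
    refine ⟨(fun i => ((y i : ℤ) : ZMod r), w), funext fun i => ?_⟩
    have := hw i
    simp only [Pi.add_apply, Pi.smul_apply, smul_eq_mul]
    linarith

lemma periodize_eq_of_torusRep [NeZero r] (f : (Fin d → ℤ) → ℝ≥0∞) (y : Fin d → ℤ) :
    periodize r f y = periodize r f (torusRep fun i => ((y i : ℤ) : ZMod r)) :=
  periodize_congr f fun i => (torusRep_cast (fun i => ((y i : ℤ) : ZMod r)) i).symm

lemma tsum_periodize_mul [NeZero r] (f g : (Fin d → ℤ) → ℝ≥0∞) (x : Fin d → ZMod r) :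
    ∑' t : Fin d → ZMod r, periodize r f (torusRep (x - t)) * periodize r g (torusRep t) =
      periodize r (latConv f g) (torusRep x) := by
  rw [periodize_latConv, ← (Equiv.ofBijective _ (torusRep_add_bijective (r := r))).tsum_eq,
    ENNReal.tsum_prod']
  refine tsum_congr fun t => ?_
  rw [periodize, periodize, ← periodize, ← ENNReal.tsum_mul_left]
  refine tsum_congr fun u => ?_
  rw [Equiv.ofBijective_apply]
  congr 1
  exact periodize_congr f fun i => by simp [torusRep_cast]

lemma periodize_torusRep_le [NeZero r] {f h : (Fin d → ℤ) → ℝ≥0∞} (x : Fin d → ZMod r)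
    (hf : ∀ v, (r : ℝ) ≤ 2 * ‖v‖ → f v ≤ h v) :
    periodize r f (torusRep x) ≤ f (torusRep x) + periodize r h (torusRep x) := by
  rw [periodize, ENNReal.summable.tsum_eq_add_tsum_ite' 0]
  · gcongr
    · simp
    · refine ENNReal.tsum_le_tsum fun u => ?_
      split_ifs with hu
      · exact zero_le
      · exact hf _ (le_two_mul_norm_torusRep_add x hu)

lemma le_farPart {f : (Fin d → ℤ) → ℝ≥0∞} {v : Fin d → ℤ} (hv : (r : ℝ) ≤ 6 * ‖v‖) :
    f v ≤ farPart r f v := by rw [farPart, if_pos hv]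

lemma latConv_self_le {G : (Fin d → ℤ) → ℝ≥0∞} {v : Fin d → ℤ} (hv : (r : ℝ) ≤ 3 * ‖v‖) :
    latConv G G v ≤ 2 * latConv (farPart r G) G v := by
  rw [two_mul]
  nth_rewrite 3 [latConv_comm]
  rw [latConv, latConv, latConv, ← ENNReal.tsum_add]
  refine ENNReal.tsum_le_tsum fun y => ?_
  have h := norm_add_le (v - y) y
  rw [sub_add_cancel] at h
  rcases le_total ‖y‖ ‖v - y‖ with hy | hy
  · exact le_add_right (mul_le_mul' (le_farPart (by linarith)) le_rfl)
  · exact le_add_left (mul_le_mul' le_rfl (le_farPart (by linarith)))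

lemma latConv_latConv_self_le {G : (Fin d → ℤ) → ℝ≥0∞} {v : Fin d → ℤ}
    (hv : (r : ℝ) ≤ 2 * ‖v‖) :
    latConv (latConv G G) G v ≤ 2 * latConv (latConv (farPart r G) G) G v +
      latConv (farPart r G) (latConv G G) v := by
  rw [latConv_comm (farPart r G) (latConv G G)]
  change ∑' y, latConv G G (v - y) * G y ≤
    2 * ∑' y, latConv (farPart r G) G (v - y) * G y + ∑' y, latConv G G (v - y) * farPart r G y
  rw [← ENNReal.tsum_mul_left, ← ENNReal.tsum_add]
  refine ENNReal.tsum_le_tsum fun y => ?_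
  have h := norm_add_le (v - y) y
  rw [sub_add_cancel] at h
  rcases le_total (2 * ‖y‖) ‖v - y‖ with hy | hy
  · refine le_add_right ?_
    rw [← mul_assoc]
    exact mul_le_mul' (latConv_self_le (by linarith)) le_rfl
  · exact le_add_left (mul_le_mul' le_rfl (le_farPart (by linarith)))

lemma periodize_const_mul (c : ℝ≥0∞) (f : (Fin d → ℤ) → ℝ≥0∞) (y : Fin d → ℤ) :
    periodize r (fun v => c * f v) y = c * periodize r f y := ENNReal.tsum_mul_left

lemma periodize_add (f g : (Fin d → ℤ) → ℝ≥0∞) (y : Fin d → ℤ) :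
    periodize r (fun v => f v + g v) y = periodize r f y + periodize r g y := ENNReal.tsum_add

section

variable [NeZero r] {G : (Fin d → ℤ) → ℝ≥0∞} {κ : ℝ≥0∞}
  (hκ : ∀ y, periodize r (farPart r G) y ≤ κ) (x : Fin d → ZMod r)
include hκ

lemma periodize_le_add : periodize r G (torusRep x) ≤ G (torusRep x) + κ :=
  (periodize_torusRep_le x fun v hv => le_farPart (by linarith [norm_nonneg v])).trans
    (add_le_add le_rfl (hκ _))

lemma periodize_latConv_self_le_add : periodize r (latConv G G) (torusRep x) ≤
    latConv G G (torusRep x) + 2 * κ * ∑' v, G v := by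
  refine (periodize_torusRep_le x fun v hv =>
    latConv_self_le (by linarith [norm_nonneg v])).trans (add_le_add le_rfl ?_)
  rw [periodize_const_mul, mul_assoc]
  gcongr
  exact periodize_latConv_le G hκ _

lemma periodize_latConv_latConv_self_le_add :
    periodize r (latConv (latConv G G) G) (torusRep x) ≤
      latConv (latConv G G) G (torusRep x) + 3 * κ * (∑' v, G v) ^ 2 := by
  refine (periodize_torusRep_le x fun v hv => latConv_latConv_self_le hv).trans
    (add_le_add le_rfl ?_)
  rw [periodize_add, periodize_const_mul]
  have h1 := periodize_latConv_le G (periodize_latConv_le G hκ) (torusRep x)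
  have h2 := periodize_latConv_le (latConv G G) hκ (torusRep x)
  rw [tsum_latConv] at h2
  calc _ ≤ 2 * (κ * (∑' w, G w) * ∑' w, G w) + κ * ((∑' w, G w) * ∑' w, G w) := by gcongr
    _ = _ := by ring

end

lemma exists_periodize_farPart_le (hd : 2 < d) : ∃ K : ℝ≥0, ∀ (M s : ℝ≥0)
    (G : (Fin d → ℤ) → ℝ≥0∞), (∀ x, G x ≤ (M * decay x ^ (d - 2) : ℝ≥0)) →
    (∀ x, G x ≤ (M * s ^ 3 * decay x ^ (d + 1) : ℝ≥0)) → ∀ (r : ℕ) [NeZero r] (y : Fin d → ℤ),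
      periodize r (farPart r G) y ≤ (K * M * s ^ 2 / r ^ d : ℝ≥0) := by
  obtain ⟨C, hC⟩ := exists_tsum_min_le hd
  refine ⟨C * 10 ^ d, fun M s G h₁ h₂ r _ y => ?_⟩
  rw [periodize_eq_of_torusRep]
  set t : Fin d → ZMod r := fun i => ((y i : ℤ) : ZMod r)
  have hr : (0 : ℝ) < r := Nat.cast_pos.2 (NeZero.pos r)
  have hr' : (r : ℝ≥0) ≠ 0 := Nat.cast_ne_zero.2 (NeZero.ne r)
  have key : ∀ u, farPart r G (torusRep t + (r : ℤ) • u) ≤ ((M * (10 / r) ^ (d - 2) : ℝ≥0) : ℝ≥0∞) *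
      (min (decay u ^ (d - 2)) ((10 * s / r) ^ 3 * decay u ^ (d + 1)) : ℝ≥0) := by
    intro u
    set v := torusRep t + (r : ℤ) • u with hv
    unfold farPart
    split_ifs with h
    · have hdec : decay v ≤ 10 / r * decay u := by
        rw [← NNReal.coe_le_coe]
        push_cast
        rw [coe_decay, coe_decay, ← div_eq_mul_inv, div_div, inv_eq_one_div,
          div_le_div_iff₀ (by positivity) (by positivity)]
        have := mul_norm_le_of_torusRep t u
        rw [← hv] at this
        linarith [norm_nonneg v]
      rw [← ENNReal.coe_mul]
      rcases min_choice (decay u ^ (d - 2)) ((10 * s / r) ^ 3 * decay u ^ (d + 1)) with e | e <;>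
        rw [e]
      · refine (h₁ v).trans (ENNReal.coe_le_coe.2 ?_)
        calc M * decay v ^ (d - 2) ≤ M * (10 / r * decay u) ^ (d - 2) := by gcongr
          _ = _ := by rw [mul_pow]; ring
      · refine (h₂ v).trans (ENNReal.coe_le_coe.2 ?_)
        calc M * s ^ 3 * decay v ^ (d + 1) ≤ M * s ^ 3 * (10 / r * decay u) ^ (d + 1) := by gcongr
          _ = _ := by
            rw [mul_pow, show d + 1 = d - 2 + 3 by omega, pow_add (10 / (r : ℝ≥0))]; ring
    · exact zero_le
  refine (ENNReal.tsum_le_tsum key).trans ?_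
  rw [ENNReal.tsum_mul_left]
  refine (mul_le_mul_right (hC _) _).trans (le_of_eq ?_)
  rw [← ENNReal.coe_pow, ← ENNReal.coe_mul, ← ENNReal.coe_mul, ENNReal.coe_inj]
  calc _ = C * M * s ^ 2 * ((10 / r) ^ (d - 2) * (10 / r) ^ 2) := by ring
    _ = _ := by
      rw [← pow_add, show d - 2 + 2 = d by omega, div_pow]; ring

lemma ne_top_of_tsum {f : (Fin d → ℤ) → ℝ≥0∞} (hf : ∑' x, f x ≠ ∞) (x : Fin d → ℤ) :
    f x ≠ ∞ := ne_top_of_le_ne_top hf (ENNReal.le_tsum x)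

lemma tsum_latConv_ne_top {f g : (Fin d → ℤ) → ℝ≥0∞} (hf : ∑' x, f x ≠ ∞)
    (hg : ∑' x, g x ≠ ∞) : ∑' x, latConv f g x ≠ ∞ := by
  rw [tsum_latConv]; exact ENNReal.mul_ne_top hf hg

section Real

variable {β z : ℝ} {G : (Fin d → ℤ) → ℝ≥0∞}
  (hG : ∀ x, Gpt d β z x = (G x).toReal) (hfin : ∑' x, G x ≠ ∞)
include hG hfin

lemma Bpt_eq_toReal (x : Fin d → ℤ) : Bpt d β z x = (latConv G G x).toReal := by
  rw [latConv, ENNReal.tsum_toReal_eq fun y =>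
    ENNReal.mul_ne_top (ne_top_of_tsum hfin _) (ne_top_of_tsum hfin _)]
  simp only [Bpt, hG, ENNReal.toReal_mul]

lemma Tpt_eq_toReal (x : Fin d → ℤ) : Tpt d β z x = (latConv (latConv G G) G x).toReal := by
  rw [latConv, ENNReal.tsum_toReal_eq fun y =>
    ENNReal.mul_ne_top (ne_top_of_tsum (tsum_latConv_ne_top hfin hfin) _) (ne_top_of_tsum hfin _)]
  simp only [Tpt, hG, Bpt_eq_toReal hG hfin, ENNReal.toReal_mul]

lemma Gam_eq_toReal (x : Fin d → ZMod r) :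
    Gam d r β z x = (periodize r G (torusRep x)).toReal := by
  rw [periodize, ENNReal.tsum_toReal_eq fun y => ne_top_of_tsum hfin _]
  simp only [Gam, hG]
  rfl

end Real

lemma tconv_toReal [NeZero r] {f g : (Fin d → ℤ) → ℝ≥0∞} (hf : ∑' x, f x ≠ ∞)
    (hg : ∑' x, g x ≠ ∞) (x : Fin d → ZMod r) :
    tconv d r (fun t => (periodize r f (torusRep t)).toReal)
      (fun t => (periodize r g (torusRep t)).toReal) x =
      (periodize r (latConv f g) (torusRep x)).toReal := by
  have h : ∀ {f : (Fin d → ℤ) → ℝ≥0∞}, ∑' x, f x ≠ ∞ → ∀ y, periodize r f y ≠ ∞ :=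
    fun hf y => ne_top_of_le_ne_top hf (periodize_le_tsum (NeZero.ne r) _ y)
  rw [← tsum_periodize_mul, ENNReal.tsum_toReal_eq fun t => ENNReal.mul_ne_top (h hf _) (h hg _)]
  simp only [tconv, ENNReal.toReal_mul]

end Torus

/-- the plateau upper bounds
`Γ_z ≤ G_z + Cχ/V`, `Γ_z⋆Γ_z ≤ B_z + Cχ²/V`, `Γ_z⋆Γ_z⋆Γ_z ≤ T_z + Cχ³/V`. -/
theorem statement17 (d : ℕ) (hd : 4 < d) :
    ∃ β0 C : ℝ, 0 < β0 ∧ 0 < C ∧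
      ∀ β : ℝ, 0 < β → β ≤ β0 →
        ∀ μ : ℝ, HasGrowthConst d β μ →
          ∀ r : ℕ, 3 ≤ r →
            ∀ z : ℝ, 0 < z → z < μ⁻¹ →
              ∀ x : Fin d → ZMod r,
                Gam d r β z x ≤
                  Gpt d β z (fun i => repC r (x i)) + C * chiR d β z / (r : ℝ) ^ d ∧
                tconv d r (Gam d r β z) (Gam d r β z) x ≤
                  Bpt d β z (fun i => repC r (x i)) + C * chiR d β z ^ 2 / (r : ℝ) ^ d ∧
                tconv d r (tconv d r (Gam d r β z) (Gam d r β z)) (Gam d r β z) x ≤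
                  Tpt d β z (fun i => repC r (x i)) + C * chiR d β z ^ 3 / (r : ℝ) ^ d := by
  obtain ⟨β₀, M, hβ₀, hβ₀', hM, hbound⟩ := exists_Gpt_le hd
  obtain ⟨K, hK⟩ := exists_periodize_farPart_le (d := d) (by omega)
  refine ⟨β₀, 3 * K * M + 1, hβ₀, by positivity, fun β hβ hββ₀ μ hμ r hr z hz hzμ x => ?_⟩
  have hβ' : β ≤ 1 := hββ₀.trans hβ₀'
  have : NeZero r := ⟨by omega⟩
  set G := greenE d (ENNReal.ofReal β) (ENNReal.ofReal z)
  have hfin : ∑' x, G x ≠ ∞ := hμ.tsum_ne_top hβ.le hβ' hz hzμ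
  have hG : ∀ x, Gpt d β z x = (G x).toReal := Gpt_eq hβ.le hβ' hz.le
  have hχG : chiR d β z = (∑' x, G x).toReal := chiR_eq hβ.le hβ' hz.le
  have hχ : 1 ≤ chiR d β z := one_le_chiR hβ.le hβ' hμ hz hzμ
  lift M to ℝ≥0 using hM.le
  set s : ℝ≥0 := ⟨√(chiR d β z), Real.sqrt_nonneg _⟩
  have hs : (s : ℝ) = √(chiR d β z) := rfl
  have hs2 : (s : ℝ) ^ 2 = chiR d β z := Real.sq_sqrt (by linarith)
  have hle : ∀ (x : Fin d → ℤ) (c : ℝ≥0), Gpt d β z x ≤ c → G x ≤ c := fun x c hc => by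
    rw [hG] at hc
    exact (ENNReal.le_ofReal_iff_toReal_le (ne_top_of_tsum hfin x) c.2).2 hc |>.trans (by simp)
  have hκ := hK M s G (fun x => hle x _ (by push_cast; exact (hbound β hβ hββ₀ μ hμ z hz hzμ x).1))
    (fun x => hle x _ (by push_cast; exact (hbound β hβ hββ₀ μ hμ z hz hzμ x).2)) r
  set κ : ℝ≥0 := K * M * s ^ 2 / r ^ d with hκ_def
  have hκ' : (κ : ℝ) = K * M * chiR d β z / r ^ d := by rw [hκ_def]; push_cast; rw [hs2]
  have hr0 : (0 : ℝ) < r ^ d := by have := NeZero.pos r; positivity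
  have hκχ : ∀ a : ℝ, a ≤ 3 → ∀ n : ℕ, a * κ * chiR d β z ^ n ≤
      (3 * K * M + 1) * chiR d β z ^ (n + 1) / r ^ d := fun a ha n => by
    rw [hκ', le_div_iff₀ hr0]
    have h0 : 0 ≤ K * M * chiR d β z ^ (n + 1) := by positivity
    have h1 : 0 ≤ chiR d β z ^ (n + 1) := by positivity
    calc _ = a * (K * M * chiR d β z ^ (n + 1)) := by field_simp; ring
      _ ≤ _ := by nlinarith
  have hΓ : Gam d r β z = fun t => (periodize r G (torusRep t)).toReal :=
    funext (Gam_eq_toReal hG hfin)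
  have hB := tsum_latConv_ne_top hfin hfin
  have hT := tsum_latConv_ne_top hB hfin
  have htoReal : ∀ {a b c : ℝ≥0∞}, a ≤ b + c → b ≠ ∞ → c ≠ ∞ → a.toReal ≤ b.toReal + c.toReal :=
    fun h hb hc => (ENNReal.toReal_mono (ENNReal.add_ne_top.2 ⟨hb, hc⟩) h).trans
      (ENNReal.toReal_add hb hc).le
  have hΓΓ : tconv d r (Gam d r β z) (Gam d r β z) =
      fun t => (periodize r (latConv G G) (torusRep t)).toReal := by
    rw [hΓ]; exact funext (tconv_toReal hfin hfin)
  refine ⟨?_, ?_, ?_⟩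
  · rw [hΓ, hG]
    refine (htoReal (periodize_le_add hκ x) (ne_top_of_tsum hfin _) (by finiteness)).trans ?_
    have := hκχ 1 (by norm_num) 0
    simp only [pow_zero, mul_one, one_mul, zero_add, pow_one] at this
    exact add_le_add le_rfl this
  · rw [hΓΓ, Bpt_eq_toReal hG hfin]
    refine (htoReal (periodize_latConv_self_le_add hκ x) (ne_top_of_tsum hB _)
      (by finiteness)).trans (add_le_add le_rfl ?_)
    simpa [← hχG] using hκχ 2 (by norm_num) 1
  · rw [hΓΓ, hΓ, tconv_toReal hB hfin, Tpt_eq_toReal hG hfin]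
    refine (htoReal (periodize_latConv_latConv_self_le_add hκ x) (ne_top_of_tsum hT _)
      (by finiteness)).trans (add_le_add le_rfl ?_)
    simpa [← hχG] using hκχ 3 le_rfl 2
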